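/- Let X be an irreducible Nash subset of an open set Ω ⊆ ℂ^n. Then there exists an algebraic subset Y of ℂ^n such that X is an analytic irreducible component of Y ∩ Ω. Conversely, every analytic irreducible component of Y ∩ Ω, for Y an algebraic subset of ℂ^n, is an irreducible Nash subset of Ω. -/

import Mathlib

open Set Filter Topology MvPolynomial

noncomputable section

/-- The complex Euclidean space `ℂ^N`. -/
abbrev CE (N : ℕ) := Fin N → ℂ

/-- The natural projection `ℂ^{a+b} → ℂ^a` (onto the first `a` coordinates). -/
def projFst (a b : ℕ) (z : CE (a + b)) : CE a := fun i => z (Fin.castAdd b i)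

/-- The natural projection `ℂ^{a+b} → ℂ^b` (onto the last `b` coordinates). -/
def projSnd (a b : ℕ) (z : CE (a + b)) : CE b := fun i => z (Fin.natAdd a i)

/-- The cylinder `U × ℂ^b ⊆ ℂ^{a+b}` over `U ⊆ ℂ^a`. -/
def cylOver {a : ℕ} (b : ℕ) (U : Set (CE a)) : Set (CE (a + b)) :=
  {z | projFst a b z ∈ U}

/-- The product `U × B ⊆ ℂ^{a+b}` of `U ⊆ ℂ^a` and `B ⊆ ℂ^b`. -/
def prodSet {a b : ℕ} (U : Set (CE a)) (B : Set (CE b)) : Set (CE (a + b)) :=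
  {z | projFst a b z ∈ U ∧ projSnd a b z ∈ B}

/-- The open ball of radius `r` in `ℂ = ℂ^1`. -/
def ball1 (r : ℝ) : Set (CE 1) := {w | ‖w 0‖ < r}

/-- The open Euclidean ball of radius `t` in `ℂ^l`. -/
def eball (l : ℕ) (t : ℝ) : Set (CE l) := {x | ∑ i, ‖x i‖ ^ 2 < t ^ 2}

/-- An algebraic subset of `ℂ^N`: the common zero set of finitely many polynomials. -/
def IsAlgebraicSet {N : ℕ} (X : Set (CE N)) : Prop :=
  ∃ s : Finset (MvPolynomial (Fin N) ℂ), X = {z | ∀ p ∈ s, eval z p = 0}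

/-- An analytic subset `X` of an open set `Ω ⊆ ℂ^N`: locally (at every point of `Ω`)
the common zero set of finitely many holomorphic functions. -/
def IsAnalyticSet {N : ℕ} (Ω X : Set (CE N)) : Prop :=
  X ⊆ Ω ∧ ∀ z ∈ Ω, ∃ U : Set (CE N), IsOpen U ∧ z ∈ U ∧ U ⊆ Ω ∧
    ∃ s : Finset (CE N → ℂ), (∀ f ∈ s, AnalyticOnNhd ℂ f U) ∧
      X ∩ U = {w ∈ U | ∀ f ∈ s, f w = 0}

/-- `X` is, near `a`, a `d`-dimensional complex submanifold of `ℂ^N`: there is a local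
biholomorphism straightening `X` to the linear subspace `{z : z_i = 0 for i ≥ d}`. -/
def IsSubmanifoldPtOfDim {N : ℕ} (X : Set (CE N)) (d : ℕ) (a : CE N) : Prop :=
  ∃ (V W : Set (CE N)) (φ ψ : CE N → CE N),
    IsOpen V ∧ a ∈ V ∧ IsOpen W ∧
    AnalyticOnNhd ℂ φ V ∧ AnalyticOnNhd ℂ ψ W ∧
    MapsTo φ V W ∧ MapsTo ψ W V ∧
    (∀ x ∈ V, ψ (φ x) = x) ∧ (∀ y ∈ W, φ (ψ y) = y) ∧
    φ '' (X ∩ V) = W ∩ {z | ∀ i : Fin N, d ≤ (i : ℕ) → z i = 0}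

/-- `X` is purely `k`-dimensional: every point of `X` near which `X` is a submanifold is a
point of dimension exactly `k`, and such (regular) points are dense in `X`. -/
def PureDimOf {N : ℕ} (X : Set (CE N)) (k : ℕ) : Prop :=
  (∀ a ∈ X, a ∈ closure {b | b ∈ X ∧ IsSubmanifoldPtOfDim X k b}) ∧
  (∀ b ∈ X, ∀ d, IsSubmanifoldPtOfDim X d b → d = k)

/-- The singular locus of `X`: the points of `X` at which `X` is not locally a submanifold. -/
def singLocus {N : ℕ} (X : Set (CE N)) : Set (CE N) :=
  {a ∈ X | ¬ ∃ d, IsSubmanifoldPtOfDim X d a}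

/-- An irreducible analytic subset of the open set `Ω`. -/
def IsIrreducibleAnalyticSet {N : ℕ} (Ω X : Set (CE N)) : Prop :=
  IsAnalyticSet Ω X ∧ X.Nonempty ∧
  ∀ A B : Set (CE N), IsAnalyticSet Ω A → IsAnalyticSet Ω B → X = A ∪ B → X = A ∨ X = B

/-- `C` is an (analytic) irreducible component of the analytic set `X ⊆ Ω`:
an irreducible analytic subset of `Ω` contained in `X`, maximal among such. -/
def IsIrreducibleComponent {N : ℕ} (Ω X C : Set (CE N)) : Prop :=
  IsIrreducibleAnalyticSet Ω C ∧ C ⊆ X ∧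
  ∀ C' : Set (CE N), IsIrreducibleAnalyticSet Ω C' → C ⊆ C' → C' ⊆ X → C' = C

/-- `A` is the union of some of the analytic irreducible components of `X` in `Ω`. -/
def IsUnionOfComponents {N : ℕ} (Ω X A : Set (CE N)) : Prop :=
  ∃ 𝒞 : Set (Set (CE N)), (∀ C ∈ 𝒞, IsIrreducibleComponent Ω X C) ∧ A = ⋃₀ 𝒞

/-- The germ of the analytic set `Z` at `a` is irreducible. -/
def GermIrreducibleAt {N : ℕ} (Z : Set (CE N)) (a : CE N) : Prop :=
  ∀ U A B : Set (CE N), IsOpen U → a ∈ U → IsAnalyticSet U A → IsAnalyticSet U B →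
    Z ∩ U = A ∪ B →
    (∃ V, IsOpen V ∧ a ∈ V ∧ Z ∩ V = A ∩ V) ∨ (∃ V, IsOpen V ∧ a ∈ V ∧ Z ∩ V = B ∩ V)

/-- A Nash function on the open set `U ⊆ ℂ^N`: a holomorphic function annihilated,
locally around every point of `U`, by a nonzero polynomial `P(x, f(x)) = 0`. -/
def IsNashFn {N : ℕ} (U : Set (CE N)) (f : CE N → ℂ) : Prop :=
  AnalyticOnNhd ℂ f U ∧ ∀ x₀ ∈ U, ∃ V : Set (CE N), IsOpen V ∧ x₀ ∈ V ∧ V ⊆ U ∧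
    ∃ P : MvPolynomial (Fin (N + 1)) ℂ, P ≠ 0 ∧
      ∀ x ∈ V, eval (Fin.snoc x (f x)) P = 0

/-- A Nash subset `Y` of the open set `Ω ⊆ ℂ^N`: locally (at every point of `Ω`) the common
zero set of finitely many Nash functions. -/
def IsNashSet {N : ℕ} (Ω Y : Set (CE N)) : Prop :=
  Y ⊆ Ω ∧ ∀ y ∈ Ω, ∃ U : Set (CE N), IsOpen U ∧ y ∈ U ∧ U ⊆ Ω ∧
    ∃ s : Finset (CE N → ℂ), (∀ f ∈ s, IsNashFn U f) ∧
      Y ∩ U = {x ∈ U | ∀ f ∈ s, f x = 0}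

/-- `U` is a domain of holomorphy in `ℂ^N`. -/
def IsDomainOfHolomorphy {N : ℕ} (U : Set (CE N)) : Prop :=
  IsOpen U ∧ ¬ ∃ U₁ U₂ : Set (CE N), IsOpen U₁ ∧ IsOpen U₂ ∧ U₁.Nonempty ∧
    U₁ ⊆ U ∩ U₂ ∧ IsConnected U₂ ∧ ¬ U₂ ⊆ U ∧
    ∀ f : CE N → ℂ, AnalyticOnNhd ℂ f U →
      ∃ F : CE N → ℂ, AnalyticOnNhd ℂ F U₂ ∧ EqOn f F U₁

/-- A Runge domain in `ℂ^N`: a domain of holomorphy on which every holomorphic function can be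
approximated uniformly on compact subsets by polynomials. -/
def IsRungeDomain {N : ℕ} (U : Set (CE N)) : Prop :=
  IsDomainOfHolomorphy U ∧
  ∀ f : CE N → ℂ, AnalyticOnNhd ℂ f U → ∀ K : Set (CE N), IsCompact K → K ⊆ U →
    ∀ ε : ℝ, 0 < ε → ∃ p : MvPolynomial (Fin N) ℂ, ∀ z ∈ K, ‖f z - eval z p‖ < ε

/-- The projection `ℂ^{a+b} → ℂ^a` restricted to `X` maps `X` into `U` and is proper over `U`. -/
def ProperProjTo {a b : ℕ} (X : Set (CE (a + b))) (U : Set (CE a)) : Prop :=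
  (∀ z ∈ X, projFst a b z ∈ U) ∧
  ∀ K : Set (CE a), IsCompact K → K ⊆ U → IsCompact {z ∈ X | projFst a b z ∈ K}

/-- Local uniform convergence of the closed subsets `Y ν` of `W` to `Y'`. -/
def LocUnifConvSets {N : ℕ} (W : Set (CE N)) (Y : ℕ → Set (CE N)) (Y' : Set (CE N)) : Prop :=
  (∀ a ∈ Y', ∃ u : ℕ → CE N, (∀ ν, u ν ∈ Y ν) ∧ Tendsto u atTop (𝓝 a)) ∧
  ∀ K : Set (CE N), IsCompact K → K ⊆ W → K ∩ Y' = ∅ → ∀ᶠ ν in atTop, K ∩ Y ν = ∅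

/-- `X` and `T` meet transversally at `a`: their tangent spaces at `a` span `ℂ^N`. -/
def TransversalAt {N : ℕ} (X T : Set (CE N)) (a : CE N) : Prop :=
  Submodule.span ℂ (tangentConeAt ℂ X a ∪ tangentConeAt ℂ T a) = ⊤

/-- `T` is a `d`-dimensional complex submanifold of the open set `W`. -/
def IsSubmanifoldOfDim {N : ℕ} (W T : Set (CE N)) (d : ℕ) : Prop :=
  T ⊆ W ∧ ∀ a ∈ T, IsSubmanifoldPtOfDim T d a

/-- Convergence, in the open set `W ⊆ ℂ^N`, of the purely `k`-dimensional analytic sets `Z ν`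
to the purely `k`-dimensional analytic set `Z'` in the sense of holomorphic chains (all
multiplicities being `1`): local uniform convergence of supports, together with the degree
condition: for every regular point `a` of `Z'` and every `(N-k)`-dimensional submanifold `T`
transversal to `Z'` at `a`, with compact closure contained in `W` and meeting `Z'` only at `a`
(so that `deg(Z' · T) = 1`), for almost all `ν` the chain `Z ν · T` also has degree one, i.e.
`Z ν` meets `T` in exactly one point, which is a regular point of `Z ν` where the intersection
is transversal. -/
def ChainsConvTo {N : ℕ} (W : Set (CE N)) (k : ℕ) (Z : ℕ → Set (CE N))
    (Z' : Set (CE N)) : Prop :=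
  LocUnifConvSets W Z Z' ∧
  ∀ (a : CE N) (T : Set (CE N)), a ∈ Z' → IsSubmanifoldPtOfDim Z' k a →
    IsSubmanifoldOfDim W T (N - k) → IsCompact (closure T) → closure T ⊆ W →
    Z' ∩ closure T = {a} → TransversalAt Z' T a →
    ∀ᶠ ν in atTop, ∃ b, Z ν ∩ T = {b} ∧ IsSubmanifoldPtOfDim (Z ν) k b ∧
      TransversalAt (Z ν) T b

/-- A polynomial polyhedron in `ℂ^N`: a set of the form `{z : |q₁ z| ≤ c₁, …, |q_s z| ≤ c_s}`. -/
def IsPolyPolyhedron {N : ℕ} (P : Set (CE N)) : Prop :=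
  ∃ (s : Finset (MvPolynomial (Fin N) ℂ)) (c : MvPolynomial (Fin N) ℂ → ℝ),
    P = {z | ∀ q ∈ s, ‖eval z q‖ ≤ c q}

/-- A compact set `K ⊆ ℂ^N` is polynomially convex: it equals its polynomially convex hull. -/
def PolyConvex {N : ℕ} (K : Set (CE N)) : Prop :=
  K = {z | ∀ p : MvPolynomial (Fin N) ℂ,
    ‖eval z p‖ ≤ sSup ((fun w => ‖eval w p‖) '' K)}

/-- Sign condition used in the definition of semialgebraic sets. -/
def signCond (c : Ordering) (t : ℝ) : Prop :=
  match c with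
  | .lt => t < 0
  | .eq => t = 0
  | .gt => 0 < t

/-- Evaluation of a real polynomial in the `2m` real coordinates of `z ∈ ℂ^m`. -/
def realizeRe {m : ℕ} (p : MvPolynomial (Fin m ⊕ Fin m) ℝ) (z : CE m) : ℝ :=
  MvPolynomial.eval (Sum.elim (fun i => (z i).re) (fun i => (z i).im)) p

/-- A subset of `ℂ^m ≅ ℝ^{2m}` is semialgebraic: a finite union of finite intersections of
sets defined by polynomial sign conditions in the real coordinates. -/
def IsSemialgebraic {m : ℕ} (S : Set (CE m)) : Prop :=
  ∃ (n r : ℕ) (P : Fin n → Fin r → MvPolynomial (Fin m ⊕ Fin m) ℝ)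
    (σ : Fin n → Fin r → Ordering),
    S = ⋃ i, ⋂ j, {z | signCond (σ i j) (realizeRe (P i j) z)}

end

namespace NashAux
open MeasureTheory Complex

/-- Cauchy-type torus integrals are analytic in the parameter. -/
theorem analyticAt_torus {n : ℕ} (c : Fin n → ℂ) (r : ℝ) (hr : 0 < r) (k : (Fin n → ℂ) → ℂ)
    (hk : TorusIntegrable k c (fun _ => r)) (x : Fin n → ℂ) (hx : ∀ i, ‖x i - c i‖ < r) :
    AnalyticAt ℂ (fun x : Fin n → ℂ => torusIntegral (fun z => k z * ∏ i, (z i - x i)⁻¹) c (fun _ => r)) x := by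
  have hb : ∀ i (θ : Fin n → ℝ), ‖torusMap c (fun _ => r) θ i‖ ≤ ‖c i‖ + r := by
    intro i θ
    simp only [torusMap]
    refine (norm_add_le _ _).trans ?_
    simp [Complex.norm_exp_ofReal_mul_I, abs_of_pos hr]
  have hcont : ∀ i, Continuous (fun θ : Fin n → ℝ => torusMap c (fun _ => r) θ i) := by
    intro i; simp only [torusMap]; fun_prop
  let Z : Fin n → BoundedContinuousFunction (Fin n → ℝ) ℂ := fun i =>
    BoundedContinuousFunction.ofNormedAddCommGroup _ (hcont i) _ (hb i)
  let a : Fin n → (Fin n → ℂ) → BoundedContinuousFunction (Fin n → ℝ) ℂ := fun i x => Z i - (x i) • 1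
  have ha : ∀ i x θ, a i x θ = torusMap c (fun _ => r) θ i - x i := by
    intro i x θ
    simp [a, Z]
  have haan : ∀ i, AnalyticAt ℂ (a i) x := by
    intro i
    refine AnalyticAt.sub (f := fun _ => Z i) analyticAt_const ?_
    refine AnalyticAt.smul (f := fun x : Fin n → ℂ => x i) ?_ analyticAt_const
    exact (ContinuousLinearMap.proj (R := ℂ) (φ := fun _ : Fin n => ℂ) i).analyticAt x
  -- unit
  have hlow : ∀ x : Fin n → ℂ, ∀ i, ∀ θ, r - ‖x i - c i‖ ≤ ‖torusMap c (fun _ => r) θ i - x i‖ := by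
    intro x i θ
    have h1 : torusMap c (fun _ => r) θ i - x i = r * exp (θ i * I) - (x i - c i) := by
      simp only [torusMap]; ring
    rw [h1]
    refine le_trans ?_ (norm_sub_norm_le _ _)
    simp [Complex.norm_exp_ofReal_mul_I, abs_of_pos hr]
  have hunit : ∀ x : Fin n → ℂ, ∀ i, ‖x i - c i‖ < r → IsUnit (a i x) := by
    intro x i hx
    have hne : ∀ θ, torusMap c (fun _ => r) θ i - x i ≠ 0 := by
      intro θ h
      have := hlow x i θ
      rw [h, norm_zero] at this; linarith
    let b : BoundedContinuousFunction (Fin n → ℝ) ℂ :=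
      BoundedContinuousFunction.ofNormedAddCommGroup
        (fun θ => (torusMap c (fun _ => r) θ i - x i)⁻¹)
        (((hcont i).sub continuous_const).inv₀ hne) ((r - ‖x i - c i‖)⁻¹) (by
          intro θ
          rw [norm_inv]
          exact inv_anti₀ (by linarith) (hlow x i θ))
    refine IsUnit.of_mul_eq_one b ?_
    ext θ
    simp only [BoundedContinuousFunction.mul_apply, ha, BoundedContinuousFunction.coe_one, Pi.one_apply]
    exact mul_inv_cancel₀ (hne θ)
  have hinv : ∀ i, AnalyticAt ℂ (fun x => Ring.inverse (a i x)) x := by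
    intro i
    obtain ⟨u, hu⟩ := hunit x i (hx i)
    exact AnalyticAt.fun_comp (hu ▸ analyticAt_inverse (𝕜 := ℂ) u) (haan i)
  have hval : ∀ x : Fin n → ℂ, ∀ i, ‖x i - c i‖ < r → ∀ θ, (Ring.inverse (a i x)) θ = (torusMap c (fun _ => r) θ i - x i)⁻¹ := by
    intro x i hx θ
    have := Ring.mul_inverse_cancel _ (hunit x i hx)
    have := DFunLike.congr_fun this θ
    simp only [BoundedContinuousFunction.mul_apply, ha, BoundedContinuousFunction.coe_one, Pi.one_apply] at this
    exact eq_inv_of_mul_eq_one_right this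
  have hprod : AnalyticAt ℂ (fun x => ∏ i, Ring.inverse (a i x)) x :=
    Finset.analyticAt_fun_prod _ (fun i _ => hinv i)
  have hIntg := hk.function_integrable
  let w : (Fin n → ℝ) → ℂ := fun θ => (∏ i, (r : ℂ) * exp (θ i * I) * I) * k (torusMap c (fun _ => r) θ)
  let Λ : BoundedContinuousFunction (Fin n → ℝ) ℂ →ₗ[ℂ] ℂ :=
    { toFun := fun u => ∫ θ in Icc (0 : Fin n → ℝ) (fun _ => 2 * Real.pi), w θ * u θ
      map_add' := by
        intro u v
        have hI : ∀ u : BoundedContinuousFunction (Fin n → ℝ) ℂ, Integrable (fun θ => w θ * u θ) (volume.restrict (Icc (0 : Fin n → ℝ) (fun _ => 2 * Real.pi))) := by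
          intro u
          refine Integrable.mul_bdd (c := ‖u‖) ?_ u.continuous.aestronglyMeasurable (Eventually.of_forall fun θ => u.norm_coe_le_norm θ)
          simpa [w, IntegrableOn, smul_eq_mul] using hIntg
        rw [← integral_add (hI u) (hI v)]
        simp [mul_add]
      map_smul' := by
        intro t u
        simp only [BoundedContinuousFunction.coe_smul, smul_eq_mul, RingHom.id_apply]
        rw [← integral_const_mul]
        congr 1; ext θ; ring }
  have hΛ : ∃ C, ∀ u, ‖Λ u‖ ≤ C * ‖u‖ := by
    refine ⟨∫ θ in Icc (0 : Fin n → ℝ) (fun _ => 2 * Real.pi), ‖w θ‖, fun u => ?_⟩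
    have hw : Integrable w (volume.restrict (Icc (0 : Fin n → ℝ) (fun _ => 2 * Real.pi))) := by
      simpa [w, IntegrableOn, smul_eq_mul] using hIntg
    rw [← integral_mul_const]
    refine norm_integral_le_of_norm_le (hw.norm.mul_const _) (Eventually.of_forall fun θ => ?_)
    rw [norm_mul]
    exact mul_le_mul_of_nonneg_left (u.norm_coe_le_norm θ) (norm_nonneg _)
  obtain ⟨C, hC⟩ := hΛ
  have hfin : AnalyticAt ℂ (fun x => Λ.mkContinuous C hC (∏ i, Ring.inverse (a i x))) x :=
    AnalyticAt.fun_comp ((Λ.mkContinuous C hC).analyticAt _) hprod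
  refine hfin.congr ?_
  have hev : ∀ᶠ y : Fin n → ℂ in 𝓝 x, ∀ i, ‖y i - c i‖ < r := by
    rw [eventually_all]
    intro i
    exact (isOpen_lt (by fun_prop) continuous_const).mem_nhds (hx i)
  filter_upwards [hev] with y hy
  have hp : ∀ (s : Finset (Fin n)) (θ), (∏ i ∈ s, Ring.inverse (a i y)) θ = ∏ i ∈ s, (torusMap c (fun _ => r) θ i - y i)⁻¹ := by
    intro s θ
    induction s using Finset.cons_induction with
    | empty => simp
    | cons i s hi ih =>
      rw [Finset.prod_cons, Finset.prod_cons, BoundedContinuousFunction.mul_apply, ih, hval y i (hy i)]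
  simp only [LinearMap.mkContinuous_apply, Λ, LinearMap.coe_mk, AddHom.coe_mk, torusIntegral, hp, w, smul_eq_mul]
  congr 1; ext θ; ring


/-- Cauchy formula on polydiscs. -/
theorem cauchy_torus (n : ℕ) : ∀ (c : Fin n → ℂ) (r : ℝ), 0 < r → ∀ (f : (Fin n → ℂ) → ℂ) (U : Set (Fin n → ℂ)),
    IsOpen U → DifferentiableOn ℂ f U → (∀ z, (∀ i, ‖z i - c i‖ ≤ r) → z ∈ U) →
    ∀ x : Fin n → ℂ, (∀ i, ‖x i - c i‖ < r) →
    torusIntegral (fun z => f z * ∏ i, (z i - x i)⁻¹) c (fun _ => r) = (2 * Real.pi * I) ^ n * f x := by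
  induction n with
  | zero =>
    intro c r hr f U hU hf hsub x hx
    rw [torusIntegral_dim0]
    simp [Subsingleton.elim c x]
  | succ n ih =>
    intro c r hr f U hU hf hsub x hx
    have hnorm : ∀ (θ : Fin (n+1) → ℝ) i, ‖torusMap c (fun _ => r) θ i - c i‖ = r := by
      intro θ i
      simp [torusMap, Complex.norm_exp_ofReal_mul_I, abs_of_pos hr]
    have hne : ∀ (θ : Fin (n+1) → ℝ) i, torusMap c (fun _ => r) θ i - x i ≠ 0 := by
      intro θ i h
      have h1 := hnorm θ i
      rw [sub_eq_zero.1 h] at h1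
      exact (hx i).ne h1
    have hcm : Continuous (torusMap c (fun _ => r)) := by
      unfold torusMap; fun_prop
    have hIntg : TorusIntegrable (fun z => f z * ∏ i, (z i - x i)⁻¹) c (fun _ => r) := by
      unfold TorusIntegrable
      refine Continuous.integrableOn_Icc ?_
      refine Continuous.mul ?_ ?_
      · exact hf.continuousOn.comp_continuous hcm (fun θ => hsub _ fun i => (hnorm θ i).le)
      · refine continuous_finsetProd _ fun i _ => ?_
        exact (((continuous_apply i).comp hcm).sub continuous_const).inv₀ (fun θ => hne θ i)
    rw [torusIntegral_succ hIntg]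
    have key : ∀ z ∈ Metric.sphere (c 0) r, (∯ y in T(c ∘ Fin.succ, (fun _ : Fin (n+1) => r) ∘ Fin.succ),
        f (Fin.cons z y) * ∏ i, ((Fin.cons z y : Fin (n+1) → ℂ) i - x i)⁻¹) =
        (z - x 0)⁻¹ • ((2 * Real.pi * I) ^ n * f (Fin.cons z (fun i => x i.succ))) := by
      intro z hz
      have hz' : ‖z - c 0‖ = r := by simpa [dist_eq_norm] using hz
      have hcons : Continuous (fun y : Fin n → ℂ => (Fin.cons z y : Fin (n+1) → ℂ)) := by fun_prop
      have := ih (c ∘ Fin.succ) r hr (fun y => f (Fin.cons z y)) {y | (Fin.cons z y : Fin (n+1) → ℂ) ∈ U}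
        (hU.preimage hcons) ?_ ?_ (fun i => x i.succ) (fun i => hx i.succ)
      · rw [← this, smul_eq_mul]
        rw [← torusIntegral_const_mul]
        congr 1
        ext y
        rw [Fin.prod_univ_succ]
        simp only [Fin.cons_zero, Fin.cons_succ]
        ring
      · have hd : Differentiable ℂ (fun y : Fin n → ℂ => (Fin.cons z y : Fin (n+1) → ℂ)) := by
          rw [differentiable_pi]
          intro i
          refine Fin.cases ?_ (fun i => ?_) i
          · simp
          · simp only [Fin.cons_succ]; fun_prop
        exact hf.comp hd.differentiableOn (fun y hy => hy)
      · intro y hy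
        refine hsub _ fun i => ?_
        refine Fin.cases ?_ (fun i => ?_) i
        · simpa using hz'.le
        · simpa using hy i
    rw [circleIntegral.integral_congr hr.le key]
    have hd0 : DifferentiableOn ℂ (fun z : ℂ => (2 * Real.pi * I) ^ n * f (Fin.cons z (fun i => x i.succ))) (Metric.closedBall (c 0) r) := by
      refine DifferentiableOn.const_mul ?_ _
      have hd : Differentiable ℂ (fun z : ℂ => (Fin.cons z (fun i => x i.succ) : Fin (n+1) → ℂ)) := by
        rw [differentiable_pi]
        intro i
        refine Fin.cases ?_ (fun i => ?_) i
        · simp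
        · simp
      refine hf.comp hd.differentiableOn (fun z hz => ?_)
      refine hsub _ fun i => ?_
      refine Fin.cases ?_ (fun i => ?_) i
      · simpa [dist_eq_norm] using hz
      · simpa using (hx i.succ).le
    have hx0 : x 0 ∈ Metric.ball (c 0) r := by simpa [dist_eq_norm] using hx 0
    have := hd0.circleIntegral_sub_inv_smul hx0
    rw [this]
    have : (Fin.cons (x 0) (fun i => x i.succ) : Fin (n+1) → ℂ) = x := by
      ext i; refine Fin.cases ?_ (fun i => ?_) i <;> simp
    rw [this]
    simp only [smul_eq_mul]
    ring

/-- Osgood: complex differentiable functions of several variables are analytic. -/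
theorem analyticOnNhd_of_differentiableOn {n : ℕ} {f : (Fin n → ℂ) → ℂ} {U : Set (Fin n → ℂ)} (hU : IsOpen U)
    (hf : DifferentiableOn ℂ f U) : AnalyticOnNhd ℂ f U := by
  intro c hc
  obtain ⟨r0, hr0, hsub⟩ := Metric.isOpen_iff.1 hU c hc
  have hr : 0 < r0 / 2 := by positivity
  have hsub' : ∀ z : Fin n → ℂ, (∀ i, ‖z i - c i‖ ≤ r0 / 2) → z ∈ U := by
    intro z hz
    apply hsub
    rw [Metric.mem_ball, dist_pi_lt_iff hr0]
    intro i
    rw [dist_eq_norm]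
    exact (hz i).trans_lt (by linarith)
  have hcm : Continuous (torusMap c (fun _ => r0 / 2)) := by
    unfold torusMap; fun_prop
  have hIntg : TorusIntegrable f c (fun _ => r0 / 2) := by
    refine Continuous.integrableOn_Icc ?_
    refine hf.continuousOn.comp_continuous hcm (fun θ => hsub' _ fun i => ?_)
    simp [torusMap, Complex.norm_exp_ofReal_mul_I, abs_of_pos hr0]
  have h1 := analyticAt_torus c (r0 / 2) hr f hIntg c (fun i => by simpa using hr)
  have h2 := (analyticAt_const (v := ((2 * Real.pi * I : ℂ) ^ n)⁻¹) (x := c)).mul h1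
  refine h2.congr ?_
  have hev : ∀ᶠ y : Fin n → ℂ in 𝓝 c, ∀ i, ‖y i - c i‖ < r0 / 2 := by
    rw [eventually_all]
    intro i
    exact (isOpen_lt (by fun_prop) continuous_const).mem_nhds (by simpa using hr)
  filter_upwards [hev] with y hy
  simp only [Pi.mul_apply]
  rw [cauchy_torus n c (r0/2) hr f U hU hf hsub' y hy]
  have : (2 * Real.pi * I : ℂ) ^ n ≠ 0 := pow_ne_zero _ Complex.two_pi_I_ne_zero
  field_simp

end NashAux

namespace NashAux
open MeasureTheory Complex

/-- Removable singularities at finitely many points. -/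
theorem removable_finite (F : Finset ℂ) : ∀ (U : Set ℂ), IsOpen U → ∀ (f : ℂ → ℂ) (M : ℝ),
    DifferentiableOn ℂ f (U \ F) → (∀ z ∈ U \ F, ‖f z‖ ≤ M) →
    ∃ f1 : ℂ → ℂ, DifferentiableOn ℂ f1 U ∧ ∀ z, z ∉ F → f1 z = f z := by
  induction F using Finset.induction with
  | empty =>
    intro U hU f M hf _
    exact ⟨f, by simpa using hf, fun _ _ => rfl⟩
  | insert a F ha ih =>
    intro U hU f M hf hM
    have hset : (U \ {a}) \ (F : Set ℂ) = U \ (insert a F : Finset ℂ) := by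
      ext z; simp; tauto
    obtain ⟨f1, hf1, h1⟩ := ih (U \ {a}) (hU.sdiff isClosed_singleton) f M (by rw [hset]; exact hf)
      (by rw [hset]; exact hM)
    by_cases haU : a ∈ U
    · refine ⟨Function.update f1 a (limUnder (𝓝[≠] a) f1), ?_, ?_⟩
      · have hopen : IsOpen (U \ (F : Set ℂ)) := hU.sdiff F.finite_toSet.isClosed
        have haO : a ∈ U \ (F : Set ℂ) := ⟨haU, by simpa using ha⟩
        have h2 := Complex.differentiableOn_update_limUnder_of_bddAbove (f := f1) (hopen.mem_nhds haO)
          (hf1.mono (by intro z hz; exact ⟨hz.1.1, hz.2⟩)) ⟨M, by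
            rintro _ ⟨z, hz, rfl⟩
            have : z ∉ F := by simpa using hz.1.2
            simp only [Function.comp, h1 z this]
            apply hM
            rw [← hset]
            exact ⟨⟨hz.1.1, hz.2⟩, hz.1.2⟩⟩
        intro z hz
        by_cases hza : z = a
        · subst hza
          exact (h2.differentiableAt (hopen.mem_nhds haO)).differentiableWithinAt
        · have hU' : U \ {a} ∈ 𝓝 z := (hU.sdiff isClosed_singleton).mem_nhds ⟨hz, hza⟩
          refine DifferentiableAt.differentiableWithinAt ?_
          refine (hf1.differentiableAt hU').congr_of_eventuallyEq ?_
          filter_upwards [hU'] with w hw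
          exact Function.update_of_ne hw.2 _ _
      · intro z hz
        simp only [Finset.mem_insert, not_or] at hz
        rw [Function.update_of_ne hz.1, h1 z hz.2]
    · refine ⟨f1, ?_, fun z hz => h1 z (fun h => hz (Finset.mem_insert_of_mem h))⟩
      rwa [sdiff_singleton_eq_self haU] at hf1

/-- restriction of a polynomial to a line -/
theorem exists_line_poly {n : ℕ} (q : MvPolynomial (Fin n) ℂ) (x v : Fin n → ℂ) :
    ∃ p : Polynomial ℂ, ∀ s, p.eval s = eval (x + s • v) q := by
  refine ⟨aeval (fun i => Polynomial.C (x i) + Polynomial.X * Polynomial.C (v i)) q, fun s => ?_⟩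
  have : (Polynomial.evalRingHom s).comp (aeval (R := ℂ) (fun i => Polynomial.C (x i) + Polynomial.X * Polynomial.C (v i)) : MvPolynomial (Fin n) ℂ →ₐ[ℂ] Polynomial ℂ).toRingHom
      = eval (x + s • v) := by
    apply MvPolynomial.ringHom_ext
    · intro a; simp
    · intro i; simp; ring
  exact congrArg (fun φ => φ q) this

theorem exists_eval_ne {n : ℕ} {q : MvPolynomial (Fin n) ℂ} (hq : q ≠ 0) : ∃ x, eval x q ≠ 0 := by
  by_contra! h
  exact hq (MvPolynomial.funext (by simpa using h))

theorem dense_ne {n : ℕ} {q : MvPolynomial (Fin n) ℂ} (hq : q ≠ 0) : Dense {x : Fin n → ℂ | eval x q ≠ 0} := by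
  obtain ⟨x1, hx1⟩ := exists_eval_ne hq
  intro x
  obtain ⟨p, hp⟩ := exists_line_poly q x (x1 - x)
  have hp0 : p ≠ 0 := by
    rintro rfl
    have := hp 1
    simp at this
    exact hx1 this.symm
  have hfin : {s | p.eval s = 0}.Finite := by
    have := Polynomial.finite_setOfPred_isRoot hp0
    exact this
  have hd : (0 : ℂ) ∈ closure ({s | p.eval s = 0}ᶜ) := hfin.countable.dense_compl ℂ 0
  have hc : Continuous (fun s : ℂ => x + s • (x1 - x)) := by fun_prop
  have := map_mem_closure hc hd (t := {x : Fin n → ℂ | eval x q ≠ 0}) (by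
    intro s hs
    simp only [mem_setOf_eq]
    rw [← hp]; exact hs)
  simpa using this

theorem continuous_eval_poly {n : ℕ} (q : MvPolynomial (Fin n) ℂ) : Continuous (fun x : Fin n → ℂ => eval x q) :=
  MvPolynomial.continuous_eval q

/-- Riemann extension theorem, local version. -/
theorem riemann_ext {n : ℕ} {q : MvPolynomial (Fin n) ℂ} (hq : q ≠ 0) {g : (Fin n → ℂ) → ℂ} {Q : Set (Fin n → ℂ)}
    (hQ : IsOpen Q) {x0 : Fin n → ℂ} (hx0 : x0 ∈ Q)
    (hg : AnalyticOnNhd ℂ g (Q ∩ {x | eval x q ≠ 0})) {M : ℝ} (hM : ∀ x ∈ Q, eval x q ≠ 0 → ‖g x‖ ≤ M) :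
    ∃ ρ > 0, Metric.ball x0 ρ ⊆ Q ∧ ∃ G : (Fin n → ℂ) → ℂ, AnalyticOnNhd ℂ G (Metric.ball x0 ρ) ∧
      ∀ x ∈ Metric.ball x0 ρ, eval x q ≠ 0 → G x = g x := by
  obtain ⟨x1, hx1⟩ := exists_eval_ne hq
  set v := x1 - x0 with hv
  obtain ⟨p0, hp0⟩ := exists_line_poly q x0 v
  have hp00 : p0 ≠ 0 := by
    rintro rfl
    have := hp0 1
    simp [hv] at this
    exact hx1 this.symm
  have hc2 : Continuous (fun z : (Fin n → ℂ) × ℂ => z.1 + z.2 • v) := by fun_prop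
  have hO : IsOpen (Q ∩ {x | eval x q ≠ 0}) :=
    hQ.inter (isOpen_ne_fun (continuous_eval_poly q) continuous_const)
  -- choose ε
  obtain ⟨ε0, hε0, hε0Q⟩ : ∃ ε0 > 0, ∀ s : ℂ, ‖s‖ < ε0 → x0 + s • v ∈ Q := by
    have : ∀ᶠ s : ℂ in 𝓝 0, x0 + s • v ∈ Q :=
      (hQ.preimage (by fun_prop : Continuous (fun s : ℂ => x0 + s • v))).mem_nhds (by simpa using hx0)
    obtain ⟨e, he, h⟩ := Metric.eventually_nhds_iff.1 this
    exact ⟨e, he, fun s hs => h (by simpa using hs)⟩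
  obtain ⟨ε, ⟨hε, hεε⟩, hεr⟩ : ∃ ε, ε ∈ Ioo 0 ε0 ∧ ε ∉ (fun s : ℂ => ‖s‖) '' {s | p0.IsRoot s} := by
    have h1 : (Ioo (0:ℝ) ε0).Infinite := Ioo_infinite hε0
    have h2 := (Polynomial.finite_setOfPred_isRoot hp00).image (fun s : ℂ => ‖s‖)
    obtain ⟨e, he⟩ := (h1.sdiff h2).nonempty
    exact ⟨e, he.1, he.2⟩
  have hev1 : ∀ᶠ x in 𝓝 x0, ∀ s ∈ Metric.sphere (0:ℂ) ε, x + s • v ∈ Q ∩ {x | eval x q ≠ 0} := by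
    refine (isCompact_sphere _ _).eventually_forall_of_forall_eventually fun s hs => ?_
    refine (hO.preimage hc2).mem_nhds ?_
    have hs' : ‖s‖ = ε := by simpa using hs
    refine ⟨hε0Q s (by rw [hs']; exact hεε), ?_⟩
    simp only [mem_setOf_eq]
    rw [← hp0]
    intro h
    exact hεr ⟨s, h, hs'⟩
  have hev2 : ∀ᶠ x in 𝓝 x0, ∀ s ∈ Metric.closedBall (0:ℂ) ε, x + s • v ∈ Q := by
    refine (isCompact_closedBall _ _).eventually_forall_of_forall_eventually fun s hs => ?_
    refine (hQ.preimage hc2).mem_nhds ?_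
    have hs' : ‖s‖ ≤ ε := by simpa using hs
    exact hε0Q s (hs'.trans_lt hεε)
  obtain ⟨ρ1, hρ1, hρ⟩ := Metric.eventually_nhds_iff.1 (hev1.and hev2)
  have hρ1' : 0 < ρ1 / 2 := by positivity
  have hsubQ : Metric.ball x0 (ρ1/2) ⊆ Q := by
    intro x hx
    have := (hρ (y := x) (by have := Metric.mem_ball.1 hx; linarith)).2 0 (by simp [hε.le])
    simpa using this
  refine ⟨ρ1 / 2, hρ1', hsubQ, fun x => Real.circleAverage (fun s => g (x + s • v)) 0 ε, ?_, ?_⟩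
  · apply analyticOnNhd_of_differentiableOn Metric.isOpen_ball
    intro x hx
    refine DifferentiableAt.differentiableWithinAt ?_
    simp only [Real.circleAverage]
    refine DifferentiableAt.const_smul ?_ _
    have hK : IsCompact ((fun z : (Fin n → ℂ) × ℂ => z.1 + z.2 • v) '' (Metric.closedBall x0 (ρ1/2) ×ˢ Metric.sphere 0 ε)) :=
      ((isCompact_closedBall _ _).prod (isCompact_sphere _ _)).image hc2
    have hKsub : ((fun z : (Fin n → ℂ) × ℂ => z.1 + z.2 • v) '' (Metric.closedBall x0 (ρ1/2) ×ˢ Metric.sphere 0 ε)) ⊆ Q ∩ {x | eval x q ≠ 0} := by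
      rintro _ ⟨⟨x, s⟩, ⟨hx, hs⟩, rfl⟩
      exact (hρ (y := x) (by have := Metric.mem_closedBall.1 hx; linarith)).1 s hs
    have hfc : ContinuousOn (fderiv ℂ g) (Q ∩ {x | eval x q ≠ 0}) := hg.fderiv.continuousOn
    obtain ⟨C, hC⟩ := hK.exists_bound_of_continuousOn (hfc.mono hKsub)
    have hcm : Continuous (circleMap 0 ε) := continuous_circleMap 0 ε
    have hmem : ∀ x ∈ Metric.ball x0 (ρ1/2), ∀ θ, x + circleMap 0 ε θ • v ∈ Q ∩ {x | eval x q ≠ 0} := by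
      intro x hx θ
      exact hKsub ⟨(x, circleMap 0 ε θ), ⟨Metric.ball_subset_closedBall hx, circleMap_mem_sphere 0 hε.le θ⟩, rfl⟩
    have hcont : ∀ x ∈ Metric.ball x0 (ρ1/2), Continuous (fun θ => g (x + circleMap 0 ε θ • v)) := by
      intro x hx
      exact hg.continuousOn.comp_continuous (by fun_prop) (hmem x hx)
    refine HasFDerivAt.differentiableAt (f' := ∫ θ in (0:ℝ)..2 * Real.pi, fderiv ℂ g (x + circleMap 0 ε θ • v)) ?_
    refine intervalIntegral.hasFDerivAt_integral_of_dominated_of_fderiv_le (bound := fun _ => C)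
      (F' := fun x θ => fderiv ℂ g (x + circleMap 0 ε θ • v))
      (Metric.isOpen_ball.mem_nhds hx) ?_ ?_ ?_ ?_ ?_ ?_
    · filter_upwards [Metric.isOpen_ball.mem_nhds hx] with y hy
      exact (hcont y hy).aestronglyMeasurable
    · exact (hcont x hx).intervalIntegrable _ _
    · exact (hfc.comp_continuous (by fun_prop) (hmem x hx)).aestronglyMeasurable
    · refine Eventually.of_forall fun θ _ y hy => ?_
      exact hC _ ⟨(y, circleMap 0 ε θ), ⟨Metric.ball_subset_closedBall hy, circleMap_mem_sphere 0 hε.le θ⟩, rfl⟩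
    · simp
    · refine Eventually.of_forall fun θ _ y hy => ?_
      have h1 := (hg _ (hmem y hy θ)).differentiableAt.hasFDerivAt
      exact (hasFDerivAt_comp_add_right _).2 h1
  · intro x hx hxq
    obtain ⟨p, hp⟩ := exists_line_poly q x v
    have hpne : p ≠ 0 := by
      rintro rfl
      have := hp 0
      simp at this
      exact hxq this.symm
    have hxρ := hρ (y := x) (by have := Metric.mem_ball.1 hx; linarith)
    -- open set of s
    have hUo : IsOpen {s : ℂ | x + s • v ∈ Q} := hQ.preimage (by fun_prop)
    have hF : ∀ s, s ∉ p.roots.toFinset → eval (x + s • v) q ≠ 0 := by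
      intro s hs
      rw [← hp]
      simpa [hpne] using hs
    obtain ⟨f1, hf1, h1⟩ := removable_finite p.roots.toFinset {s : ℂ | x + s • v ∈ Q} hUo
      (fun s => g (x + s • v)) M (by
        intro s hs
        refine DifferentiableAt.differentiableWithinAt ?_
        have := (hg (x + s • v) ⟨hs.1, hF s (by simpa using hs.2)⟩).differentiableAt
        exact this.comp s (by fun_prop)) (by
        intro s hs
        exact hM _ hs.1 (hF s (by simpa using hs.2)))
    have hav : Real.circleAverage f1 0 ε = f1 0 := by
      refine DiffContOnCl.circleAverage ?_
      rw [abs_of_pos hε]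
      refine DifferentiableOn.diffContOnCl (hf1.mono ?_)
      rw [closure_ball _ hε.ne']
      exact fun s hs => hxρ.2 s hs
    have h0 : f1 0 = g x := by
      rw [h1 0 ?_]
      · simp
      · simp only [Multiset.mem_toFinset, Polynomial.mem_roots hpne, Polynomial.IsRoot, hp]
        simpa using hxq
    rw [← h0, ← hav]
    refine Real.circleAverage_congr_sphere fun s hs => ?_
    refine (h1 s ?_).symm
    rw [abs_of_pos hε] at hs
    have := (hxρ.1 s hs).2
    simp only [Multiset.mem_toFinset, Polynomial.mem_roots hpne, Polynomial.IsRoot, hp]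
    exact this

/-- A connected open set minus a hypersurface is connected. -/
theorem isPreconnected_diff {n : ℕ} {q : MvPolynomial (Fin n) ℂ} (hq : q ≠ 0) {B : Set (Fin n → ℂ)} (hB : IsOpen B)
    (hBc : IsPreconnected B) : IsPreconnected (B ∩ {x | eval x q ≠ 0}) := by
  classical
  have hO : IsOpen (B ∩ {x | eval x q ≠ 0}) :=
    hB.inter (isOpen_ne_fun (continuous_eval_poly q) continuous_const)
  intro U V hU hV hUV hUne hVne
  by_contra hcon
  have hdisj : ∀ x ∈ B, eval x q ≠ 0 → x ∈ U → x ∉ V := by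
    intro x hx hxq hxU hxV
    exact hcon ⟨x, ⟨hx, hxq⟩, hxU, hxV⟩
  -- indicator
  let g : (Fin n → ℂ) → ℂ := fun x => if x ∈ U then 1 else 0
  have hg : AnalyticOnNhd ℂ g (B ∩ {x | eval x q ≠ 0}) := by
    intro x hx
    rcases hUV hx with h | h
    · refine (analyticAt_const (v := (1:ℂ))).congr ?_
      filter_upwards [hU.mem_nhds h] with y hy
      simp [g, hy]
    · refine (analyticAt_const (v := (0:ℂ))).congr ?_
      filter_upwards [hV.mem_nhds h, hO.mem_nhds hx] with y hy hy2
      have : y ∉ U := fun hyU => hdisj y hy2.1 hy2.2 hyU hy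
      simp [g, this]
  have hloc : ∀ x ∈ B, ∃ ρ > 0, Metric.ball x ρ ⊆ B ∧ ((∀ y ∈ Metric.ball x ρ, eval y q ≠ 0 → y ∈ U) ∨
      (∀ y ∈ Metric.ball x ρ, eval y q ≠ 0 → y ∈ V)) := by
    intro x hx
    obtain ⟨ρ, hρ, hsub, G, hG, hGg⟩ := riemann_ext hq hB hx hg (M := 1) (by
      intro y _ _; simp only [g]; split_ifs <;> simp)
    refine ⟨ρ, hρ, hsub, ?_⟩
    by_contra! hcon
    obtain ⟨⟨y1, hy1, hy1q, hy1U⟩, ⟨y2, hy2, hy2q, hy2V⟩⟩ := hcon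
    have hy2U : y2 ∈ U := (hUV ⟨hsub hy2, hy2q⟩).resolve_right hy2V
    have e1 : G =ᶠ[𝓝 y2] fun _ => 1 := by
      filter_upwards [hU.mem_nhds hy2U, Metric.isOpen_ball.mem_nhds hy2, hO.mem_nhds ⟨hsub hy2, hy2q⟩] with y a b c
      rw [hGg y b c.2]; simp [g, a]
    have := hG.eqOn_of_preconnected_of_eventuallyEq analyticOnNhd_const
      (convex_ball x ρ).isPreconnected hy2 e1 hy1
    rw [hGg y1 hy1 hy1q] at this
    simp [g, hy1U] at this
  let O1 : Set (Fin n → ℂ) := {x | ∃ N, IsOpen N ∧ x ∈ N ∧ N ⊆ B ∧ ∀ y ∈ N, eval y q ≠ 0 → y ∈ U}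
  let O2 : Set (Fin n → ℂ) := {x | ∃ N, IsOpen N ∧ x ∈ N ∧ N ⊆ B ∧ ∀ y ∈ N, eval y q ≠ 0 → y ∈ V}
  have hO1 : IsOpen O1 := by
    rw [isOpen_iff_mem_nhds]
    rintro x ⟨N, hN, hx, hNB, h⟩
    exact mem_of_superset (hN.mem_nhds hx) fun y hy => ⟨N, hN, hy, hNB, h⟩
  have hO2 : IsOpen O2 := by
    rw [isOpen_iff_mem_nhds]
    rintro x ⟨N, hN, hx, hNB, h⟩
    exact mem_of_superset (hN.mem_nhds hx) fun y hy => ⟨N, hN, hy, hNB, h⟩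
  obtain ⟨u, hu, huU⟩ := hUne
  obtain ⟨w, hw, hwV⟩ := hVne
  obtain ⟨y, hyB, ⟨N1, hN1, hy1, hN1B, h1⟩, ⟨N2, hN2, hy2, hN2B, h2⟩⟩ := hBc O1 O2 hO1 hO2 (by
      intro x hx
      obtain ⟨ρ, hρ, hsub, h | h⟩ := hloc x hx
      · exact Or.inl ⟨_, Metric.isOpen_ball, Metric.mem_ball_self hρ, hsub, h⟩
      · exact Or.inr ⟨_, Metric.isOpen_ball, Metric.mem_ball_self hρ, hsub, h⟩)
    ⟨u, hu.1, _, hO.inter hU, ⟨hu, huU⟩, fun z hz => hz.1.1, fun z hz _ => hz.2⟩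
    ⟨w, hw.1, _, hO.inter hV, ⟨hw, hwV⟩, fun z hz => hz.1.1, fun z hz _ => hz.2⟩
  obtain ⟨z, hz, hzq⟩ := (dense_ne hq).inter_open_nonempty _ (hN1.inter hN2) ⟨y, hy1, hy2⟩
  exact hdisj z (hN1B hz.1) hzq (h1 z hz.1 hzq) (h2 z hz.2 hzq)

end NashAux

namespace NashAux

/-- evaluation of a polynomial in one variable over the polynomial ring. -/
noncomputable def ev2 {n : ℕ} (p : Polynomial (MvPolynomial (Fin n) ℂ)) (x : Fin n → ℂ) (t : ℂ) : ℂ := (p.map (eval x)).eval t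

theorem ev2_eq_eval₂ {n : ℕ} (p : Polynomial (MvPolynomial (Fin n) ℂ)) (x : Fin n → ℂ) (t : ℂ) :
    ev2 p x t = p.eval₂ (eval x) t := by rw [ev2, Polynomial.eval_map]

def AlgOn {n : ℕ} (D : Set (Fin n → ℂ)) (f : (Fin n → ℂ) → ℂ) : Prop :=
  ∃ p : Polynomial (MvPolynomial (Fin n) ℂ), p ≠ 0 ∧ ∀ x ∈ D, ev2 p x (f x) = 0

def IntOn {n : ℕ} (D : Set (Fin n → ℂ)) (f : (Fin n → ℂ) → ℂ) : Prop :=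
  ∃ p : Polynomial (MvPolynomial (Fin n) ℂ), p.Monic ∧ ∀ x ∈ D, ev2 p x (f x) = 0

theorem IntOn.algOn {n : ℕ} {D : Set (Fin n → ℂ)} {f : (Fin n → ℂ) → ℂ} (h : IntOn D f) : AlgOn D f :=
  let ⟨p, hp, h⟩ := h; ⟨p, hp.ne_zero, h⟩

theorem AlgOn.mono {n : ℕ} {D D' : Set (Fin n → ℂ)} {f : (Fin n → ℂ) → ℂ} (h : AlgOn D f) (h' : D' ⊆ D) : AlgOn D' f :=
  let ⟨p, hp, h⟩ := h; ⟨p, hp, fun x hx => h x (h' hx)⟩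

theorem IntOn.mono {n : ℕ} {D D' : Set (Fin n → ℂ)} {f : (Fin n → ℂ) → ℂ} (h : IntOn D f) (h' : D' ⊆ D) : IntOn D' f :=
  let ⟨p, hp, h⟩ := h; ⟨p, hp, fun x hx => h x (h' hx)⟩

theorem IntOn.congr {n : ℕ} {D : Set (Fin n → ℂ)} {f g : (Fin n → ℂ) → ℂ} (h : IntOn D f) (h' : ∀ x ∈ D, f x = g x) : IntOn D g :=
  let ⟨p, hp, h⟩ := h; ⟨p, hp, fun x hx => h' x hx ▸ h x hx⟩

theorem AlgOn.congr {n : ℕ} {D : Set (Fin n → ℂ)} {f g : (Fin n → ℂ) → ℂ} (h : AlgOn D f) (h' : ∀ x ∈ D, f x = g x) : AlgOn D g :=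
  let ⟨p, hp, h⟩ := h; ⟨p, hp, fun x hx => h' x hx ▸ h x hx⟩

/-- the ring of all functions as an algebra over polynomials -/
noncomputable def polyFn {n : ℕ} (D : Set (Fin n → ℂ)) : MvPolynomial (Fin n) ℂ →+* (D → ℂ) :=
  RingHom.pi (fun x : D => eval x.1)

noncomputable abbrev algFn {n : ℕ} (D : Set (Fin n → ℂ)) : Algebra (MvPolynomial (Fin n) ℂ) (D → ℂ) := (polyFn D).toAlgebra

theorem aeval_algFn {n : ℕ} (D : Set (Fin n → ℂ)) (p : Polynomial (MvPolynomial (Fin n) ℂ)) (f : D → ℂ) (x : D) :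
    (p.eval₂ (polyFn D) f) x = ev2 p x (f x) := by
  have := Polynomial.hom_eval₂ p (polyFn D) (Pi.evalRingHom (fun _ => ℂ) x) f
  simp only [Pi.evalRingHom_apply] at this
  rw [this, ev2_eq_eval₂]
  rfl

theorem algOn_iff {n : ℕ} (D : Set (Fin n → ℂ)) (f : (Fin n → ℂ) → ℂ) :
    AlgOn D f ↔ @IsAlgebraic _ _ _ _ (algFn D) (fun x : D => f x) := by
  letI := algFn D
  constructor
  · rintro ⟨p, hp, h⟩
    refine ⟨p, hp, ?_⟩
    funext x
    exact (aeval_algFn D p _ x).trans (h x x.2)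
  · rintro ⟨p, hp, h⟩
    refine ⟨p, hp, fun x hx => ?_⟩
    exact (aeval_algFn D p (fun x : D => f x) ⟨x, hx⟩).symm.trans (congrFun h ⟨x, hx⟩)

theorem intOn_iff {n : ℕ} (D : Set (Fin n → ℂ)) (f : (Fin n → ℂ) → ℂ) :
    IntOn D f ↔ @IsIntegral _ _ _ _ (algFn D) (fun x : D => f x) := by
  letI := algFn D
  constructor
  · rintro ⟨p, hp, h⟩
    refine ⟨p, hp, ?_⟩
    funext x
    exact (aeval_algFn D p _ x).trans (h x x.2)
  · rintro ⟨p, hp, h⟩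
    refine ⟨p, hp, fun x hx => ?_⟩
    exact (aeval_algFn D p (fun x : D => f x) ⟨x, hx⟩).symm.trans (congrFun h ⟨x, hx⟩)

theorem AlgOn.mul {n : ℕ} {D : Set (Fin n → ℂ)} {f g : (Fin n → ℂ) → ℂ} (hf : AlgOn D f) (hg : AlgOn D g) :
    AlgOn D (fun x => f x * g x) := by
  rw [algOn_iff] at *
  letI := algFn D
  exact hf.mul hg

theorem IntOn.mul {n : ℕ} {D : Set (Fin n → ℂ)} {f g : (Fin n → ℂ) → ℂ} (hf : IntOn D f) (hg : IntOn D g) :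
    IntOn D (fun x => f x * g x) := by
  rw [intOn_iff] at *
  letI := algFn D
  exact hf.mul hg

theorem IntOn.add {n : ℕ} {D : Set (Fin n → ℂ)} {f g : (Fin n → ℂ) → ℂ} (hf : IntOn D f) (hg : IntOn D g) :
    IntOn D (fun x => f x + g x) := by
  rw [intOn_iff] at *
  letI := algFn D
  exact hf.add hg

theorem IntOn.sub {n : ℕ} {D : Set (Fin n → ℂ)} {f g : (Fin n → ℂ) → ℂ} (hf : IntOn D f) (hg : IntOn D g) :
    IntOn D (fun x => f x - g x) := by
  rw [intOn_iff] at *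
  letI := algFn D
  exact hf.sub hg

theorem intOn_poly {n : ℕ} (D : Set (Fin n → ℂ)) (q : MvPolynomial (Fin n) ℂ) : IntOn D (fun x => eval x q) :=
  ⟨Polynomial.X - Polynomial.C q, Polynomial.monic_X_sub_C q, fun x _ => by simp [ev2]⟩

theorem intOn_const {n : ℕ} (D : Set (Fin n → ℂ)) (c : ℂ) : IntOn D (fun _ => c) :=
  (intOn_poly D (C c)).congr (by simp)

theorem IntOn.sum {n : ℕ} {D : Set (Fin n → ℂ)} {ι : Type*} (s : Finset ι) {f : ι → (Fin n → ℂ) → ℂ}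
    (hf : ∀ i ∈ s, IntOn D (f i)) : IntOn D (fun x => ∑ i ∈ s, f i x) := by
  classical
  induction s using Finset.induction with
  | empty => simpa using intOn_const D 0
  | insert a s ha ih =>
    simp only [Finset.sum_insert ha]
    exact (hf a (by simp)).add (ih fun i hi => hf i (by simp [hi]))

theorem IntOn.prod {n : ℕ} {D : Set (Fin n → ℂ)} {ι : Type*} (s : Finset ι) {f : ι → (Fin n → ℂ) → ℂ}
    (hf : ∀ i ∈ s, IntOn D (f i)) : IntOn D (fun x => ∏ i ∈ s, f i x) := by
  classical
  induction s using Finset.induction with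
  | empty => simpa using intOn_const D 1
  | insert a s ha ih =>
    simp only [Finset.prod_insert ha]
    exact (hf a (by simp)).mul (ih fun i hi => hf i (by simp [hi]))

/-! ### translation to the frozen definition -/

theorem exists_poly_of_ev2 {n : ℕ} {p : Polynomial (MvPolynomial (Fin n) ℂ)} (hp : p ≠ 0) :
    ∃ P : MvPolynomial (Fin (n+1)) ℂ, P ≠ 0 ∧ ∀ (x : Fin n → ℂ) t, eval (Fin.snoc x t : Fin (n+1) → ℂ) P = ev2 p x t := by
  refine ⟨rename (finRotate (n+1)).symm ((finSuccEquiv ℂ n).symm p), ?_, fun x t => ?_⟩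
  · intro h
    rw [← map_zero (rename (finRotate (n+1)).symm)] at h
    have := rename_injective _ (finRotate (n+1)).symm.injective h
    exact hp (by simpa using this)
  · rw [eval_rename, Fin.snoc_eq_cons_rotate]
    have : ((fun i => (Fin.cons t x : Fin (n+1) → ℂ) (finRotate (n+1) i)) ∘ (finRotate (n+1)).symm) = (Fin.cons t x : Fin (n+1) → ℂ) := by
      funext i; simp
    rw [this, eval_eq_eval_mv_eval']
    simp [ev2]

theorem exists_ev2_of_poly {n : ℕ} {P : MvPolynomial (Fin (n+1)) ℂ} (hP : P ≠ 0) :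
    ∃ p : Polynomial (MvPolynomial (Fin n) ℂ), p ≠ 0 ∧ ∀ (x : Fin n → ℂ) t, eval (Fin.snoc x t : Fin (n+1) → ℂ) P = ev2 p x t := by
  refine ⟨finSuccEquiv ℂ n (rename (finRotate (n+1)) P), ?_, fun x t => ?_⟩
  · intro h
    rw [← map_zero (finSuccEquiv ℂ n)] at h
    have h := (finSuccEquiv ℂ n).injective h
    rw [← map_zero (rename (finRotate (n+1)))] at h
    exact hP (rename_injective _ (finRotate (n+1)).injective h)
  · rw [ev2, ← eval_eq_eval_mv_eval', eval_rename, Fin.snoc_eq_cons_rotate]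
    rfl

theorem isNashFn_iff {n : ℕ} {U : Set (CE n)} {f : CE n → ℂ} :
    IsNashFn U f ↔ AnalyticOnNhd ℂ f U ∧ ∀ x ∈ U, ∃ V, IsOpen V ∧ x ∈ V ∧ V ⊆ U ∧ AlgOn V f := by
  refine and_congr_right fun _ => forall₂_congr fun x _ => exists_congr fun V => ?_
  refine and_congr_right fun _ => and_congr_right fun _ => and_congr_right fun _ => ?_
  constructor
  · rintro ⟨P, hP, h⟩
    obtain ⟨p, hp, hpe⟩ := exists_ev2_of_poly hP
    exact ⟨p, hp, fun x hx => (hpe x _).symm.trans (h x hx)⟩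
  · rintro ⟨p, hp, h⟩
    obtain ⟨P, hP, hpe⟩ := exists_poly_of_ev2 hp
    exact ⟨P, hP, fun x hx => (hpe x _).trans (h x hx)⟩

theorem isNashFn_mul {n : ℕ} {U : Set (CE n)} {f g : CE n → ℂ} (hf : IsNashFn U f) (hg : IsNashFn U g) :
    IsNashFn U (fun x => f x * g x) := by
  rw [isNashFn_iff] at *
  refine ⟨hf.1.mul hg.1, fun x hx => ?_⟩
  obtain ⟨V, hV, hxV, hVU, h⟩ := hf.2 x hx
  obtain ⟨V', hV', hxV', hVU', h'⟩ := hg.2 x hx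
  exact ⟨V ∩ V', hV.inter hV', ⟨hxV, hxV'⟩, fun y hy => hVU hy.1,
    (h.mono inter_subset_left).mul (h'.mono inter_subset_right)⟩

theorem isNashFn_mono {n : ℕ} {U U' : Set (CE n)} {f : CE n → ℂ} (hf : IsNashFn U f) (hU' : IsOpen U') (h : U' ⊆ U) :
    IsNashFn U' f := by
  rw [isNashFn_iff] at *
  refine ⟨hf.1.mono h, fun x hx => ?_⟩
  obtain ⟨V, hV, hxV, hVU, ha⟩ := hf.2 x (h hx)
  exact ⟨V ∩ U', hV.inter hU', ⟨hxV, hx⟩, inter_subset_right, ha.mono inter_subset_left⟩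

theorem isNashFn_poly {n : ℕ} {U : Set (CE n)} (hU : IsOpen U) (q : MvPolynomial (Fin n) ℂ) :
    IsNashFn U (fun x => eval x q) := by
  rw [isNashFn_iff]
  exact ⟨(AnalyticOnNhd.eval_mvPolynomial q).mono (subset_univ _),
    fun x hx => ⟨U, hU, hx, subset_rfl, (intOn_poly U q).algOn⟩⟩

end NashAux

namespace NashAux

/-- holomorphic functions on `D`. -/
noncomputable def Hol {d : ℕ} (D : Set (Fin d → ℂ)) : Subring (D → ℂ) where
  carrier := {f | ∃ F : (Fin d → ℂ) → ℂ, AnalyticOnNhd ℂ F D ∧ ∀ x : D, f x = F x}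
  mul_mem' := by
    rintro f g ⟨F, hF, h⟩ ⟨G, hG, h'⟩
    exact ⟨fun x => F x * G x, hF.mul hG, fun x => by simp [h, h']⟩
  add_mem' := by
    rintro f g ⟨F, hF, h⟩ ⟨G, hG, h'⟩
    exact ⟨fun x => F x + G x, hF.add hG, fun x => by simp [h, h']⟩
  neg_mem' := by
    rintro f ⟨F, hF, h⟩
    exact ⟨fun x => - F x, hF.neg, fun x => by simp [h]⟩
  one_mem' := ⟨fun _ => 1, analyticOnNhd_const, fun _ => rfl⟩
  zero_mem' := ⟨fun _ => 0, analyticOnNhd_const, fun _ => rfl⟩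

noncomputable def polyHol {d : ℕ} (D : Set (Fin d → ℂ)) : MvPolynomial (Fin d) ℂ →+* Hol D :=
  (polyFn D).codRestrict (Hol D) (fun q => ⟨fun x => eval x q,
    (AnalyticOnNhd.eval_mvPolynomial q).mono (subset_univ _), fun _ => rfl⟩)

noncomputable instance algHol {d : ℕ} (D : Set (Fin d → ℂ)) : Algebra (MvPolynomial (Fin d) ℂ) (Hol D) :=
  (polyHol D).toAlgebra

theorem aeval_hol {n : ℕ} (D : Set (Fin n → ℂ)) (p : Polynomial (MvPolynomial (Fin n) ℂ)) (f : Hol D) (x : D) :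
    (p.eval₂ (polyHol D) f).1 x = ev2 p x (f.1 x) := by
  have := Polynomial.hom_eval₂ p (polyHol D) (Hol D).subtype f
  rw [← aeval_algFn]
  exact congrFun this x

theorem eq_zero_of_open {d : ℕ} {D : Set (Fin d → ℂ)} (hDc : IsPreconnected D) {F : (Fin d → ℂ) → ℂ} (hF : AnalyticOnNhd ℂ F D)
    {x : Fin d → ℂ} (hx : x ∈ D) (h : ∀ᶠ y in 𝓝 x, F y = 0) : ∀ y ∈ D, F y = 0 := fun y hy =>
  hF.eqOn_of_preconnected_of_eventuallyEq (g := fun _ => 0) analyticOnNhd_const hDc hx h hy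

theorem hol_domain {d : ℕ} {D : Set (Fin d → ℂ)} (hD : IsOpen D) (hDc : IsPreconnected D) (hne : D.Nonempty) : IsDomain (Hol D) := by
  haveI : Nontrivial (Hol D) := ⟨0, 1, fun h => by
    obtain ⟨x, hx⟩ := hne
    have := congrFun (congrArg Subtype.val h) ⟨x, hx⟩
    simp at this⟩
  haveI : NoZeroDivisors (Hol D) := ⟨by
    rintro ⟨f, F, hF, h⟩ ⟨g, G, hG, h'⟩ hfg
    by_cases h0 : ∀ x ∈ D, F x = 0
    · left; ext x; simp [h, h0 x x.2]
    · right
      push Not at h0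
      obtain ⟨x, hx, hFx⟩ := h0
      have := eq_zero_of_open hDc hG hx (by
        filter_upwards [(hF x hx).continuousAt.eventually_ne hFx, hD.mem_nhds hx] with y hy hyD
        have := congrFun (congrArg Subtype.val hfg) ⟨y, hyD⟩
        simp [h, h', hy] at this
        exact this)
      ext x; simp [h', this x x.2]⟩
  exact NoZeroDivisors.to_isDomain _

theorem intOn_hol {d : ℕ} {D : Set (Fin d → ℂ)} {F : (Fin d → ℂ) → ℂ} (hF : AnalyticOnNhd ℂ F D) (h : IntOn D F) :
    IsIntegral (MvPolynomial (Fin d) ℂ) (⟨fun x : D => F x, F, hF, fun _ => rfl⟩ : Hol D) := by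
  obtain ⟨p, hp, h⟩ := h
  refine ⟨p, hp, ?_⟩
  apply Subtype.ext
  funext x
  exact (aeval_hol D p _ x).trans (h x x.2)

theorem continuous_two (q : Polynomial (Polynomial ℂ)) :
    Continuous (fun τs : ℂ × ℂ => (q.map (Polynomial.evalRingHom τs.1)).eval τs.2) := by
  induction q using Polynomial.induction_on' with
  | add p q hp hq => simp only [Polynomial.map_add, Polynomial.eval_add]; exact hp.add hq
  | monomial n a =>
    simp only [Polynomial.map_monomial, Polynomial.coe_evalRingHom, Polynomial.eval_monomial]
    exact ((Polynomial.continuous a).comp continuous_fst).mul (continuous_snd.pow n)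

theorem ac_lemma {d n : ℕ} {D : Set (Fin d → ℂ)} (hD : IsOpen D) (hDc : IsPreconnected D) (hne : D.Nonempty)
    {σ : (Fin d → ℂ) → (Fin n → ℂ)} (hσ : ∀ i, AnalyticOnNhd ℂ (fun z => σ z i) D)
    (hIntg : ∀ i, IntOn D (fun z => σ z i)) {U : Set (Fin n → ℂ)} (hU : IsOpen U) (hσU : ∀ z ∈ D, σ z ∈ U)
    {f : (Fin n → ℂ) → ℂ} (hf : AnalyticOnNhd ℂ f U) (hfa : AlgOn U f) :
    AnalyticOnNhd ℂ (fun z => f (σ z)) D ∧ AlgOn D (fun z => f (σ z)) := by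
  obtain ⟨P, hP, hPf⟩ := hfa
  have hfσ : AnalyticOnNhd ℂ (fun z => f (σ z)) D := by
    intro z hz
    exact (hf _ (hσU z hz)).comp (AnalyticAt.pi fun i => hσ i z hz)
  refine ⟨hfσ, ?_⟩
  obtain ⟨z1, hz1⟩ := hne
  haveI := hol_domain hD hDc ⟨z1, hz1⟩
  let R := MvPolynomial (Fin d) ℂ
  let A : Subalgebra R (Hol D) := integralClosure R (Hol D)
  let σA : Fin n → A := fun i => ⟨⟨fun x : D => σ x i, _, hσ i, fun _ => rfl⟩, intOn_hol (hσ i) (hIntg i)⟩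
  -- constants
  let cA : ℂ →+* A := (algebraMap R A).comp C
  obtain ⟨x1, hx1⟩ : ∃ x1, P.map (eval x1) ≠ 0 := by
    obtain ⟨k, hk⟩ : ∃ k, P.coeff k ≠ 0 := by
      by_contra! h
      exact hP (Polynomial.ext (by simpa using h))
    obtain ⟨x, hx⟩ := exists_eval_ne hk
    refine ⟨x, fun h => hx ?_⟩
    have := congrArg (fun p => p.coeff k) h
    simpa using this
  let v : Fin n → ℂ := x1 - σ z1
  let φ : MvPolynomial (Fin n) ℂ →+* Polynomial (Polynomial A) :=
    eval₂Hom ((Polynomial.C.comp Polynomial.C).comp cA)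
      (fun i => Polynomial.C (Polynomial.C (σA i)) + Polynomial.X * Polynomial.C (Polynomial.C (cA (v i))))
  let Ψ : Polynomial (MvPolynomial (Fin n) ℂ) →+* Polynomial (Polynomial A) :=
    Polynomial.eval₂RingHom (S := Polynomial (Polynomial A)) φ (Polynomial.C Polynomial.X)
  let evA (z : D) : A →+* ℂ := ((Pi.evalRingHom (fun _ : D => ℂ) z).comp (Hol D).subtype).comp A.toSubring.subtype
  let ev (z : D) (τ s : ℂ) : Polynomial (Polynomial A) →+* ℂ :=
    Polynomial.eval₂RingHom (Polynomial.eval₂RingHom (evA z) τ) s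
  have hevc : ∀ z c, evA z (cA c) = c := by
    intro z c
    change eval z.1 (C c) = c
    simp
  have hevσ : ∀ z i, evA z (σA i) = σ z i := fun z i => rfl
  have hevΨ : ∀ (z : D) (τ s : ℂ) (Q : Polynomial (MvPolynomial (Fin n) ℂ)), ev z τ s (Ψ Q) = ev2 Q (σ z + s • v) τ := by
    intro z τ s Q
    have : (ev z τ s).comp Ψ = Polynomial.eval₂RingHom (eval (σ z + s • v)) τ := by
      apply Polynomial.ringHom_ext'
      · apply MvPolynomial.ringHom_ext
        · intro c
          simp [ev, Ψ, φ, hevc]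
        · intro i
          simp [ev, Ψ, φ, hevc, hevσ]
          ring
      · simp [ev, Ψ]
    rw [ev2_eq_eval₂]
    exact congrArg (fun ψ => ψ Q) this
  have hΨP : Ψ P ≠ 0 := by
    intro h
    apply hx1
    apply Polynomial.funext
    intro τ
    have := hevΨ ⟨z1, hz1⟩ τ 1 P
    rw [h, map_zero] at this
    simp only [ev2, v, one_smul, add_sub_cancel] at this
    simpa using this.symm
  obtain ⟨q, hq, hqn⟩ := Polynomial.exists_eq_pow_rootMultiplicity_mul_and_not_dvd (R := Polynomial A) (Ψ P) hΨP 0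
  set m := Polynomial.rootMultiplicity (R := Polynomial A) 0 (Ψ P)
  simp only [Polynomial.C_0, sub_zero] at hq hqn
  rw [Polynomial.X_dvd_iff] at hqn
  have hG : ∀ z : D, ev z (f (σ z)) 0 q = 0 := by
    intro z
    let qz : Polynomial (Polynomial ℂ) := q.map (Polynomial.mapRingHom (evA z))
    have hev : ∀ τ s, ev z τ s q = (qz.map (Polynomial.evalRingHom τ)).eval s := by
      intro τ s
      simp only [ev, qz, Polynomial.map_map, Polynomial.eval_map, Polynomial.coe_eval₂RingHom]
      congr 1
      ext <;> simp
    have hc : ContinuousAt (fun s : ℂ => ev z (f (σ z + s • v)) s q) 0 := by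
      simp only [hev]
      have h1 : ContinuousAt (fun s : ℂ => f (σ z + s • v)) 0 := by
        refine ContinuousAt.comp (f := fun s : ℂ => σ z + s • v) ?_ (by fun_prop)
        simpa using (hf _ (hσU z z.2)).continuousAt
      exact (continuous_two qz).continuousAt.comp (h1.prodMk continuousAt_id)
    have hz : ∀ᶠ s : ℂ in 𝓝[≠] 0, ev z (f (σ z + s • v)) s q = 0 := by
      have h1 : ∀ᶠ s : ℂ in 𝓝 0, σ z + s • v ∈ U :=
        (hU.preimage (by fun_prop : Continuous fun s : ℂ => σ z + s • v)).mem_nhds (by simpa using hσU z z.2)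
      filter_upwards [nhdsWithin_le_nhds h1, self_mem_nhdsWithin] with s hs hs0
      have h2 := hevΨ z (f (σ z + s • v)) s P
      rw [hPf _ hs, hq, map_mul, map_pow] at h2
      have h3 : ev z (f (σ z + s • v)) s Polynomial.X = s := by simp [ev]
      rw [h3] at h2
      exact (mul_eq_zero.1 h2).resolve_left (pow_ne_zero _ hs0)
    have hlim : Tendsto (fun s : ℂ => ev z (f (σ z + s • v)) s q) (𝓝[≠] 0) (𝓝 (ev z (f (σ z + (0:ℂ) • v)) 0 q)) :=
      hc.tendsto.mono_left nhdsWithin_le_nhds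
    have := tendsto_nhds_unique hlim ((tendsto_congr' hz).2 tendsto_const_nhds)
    simpa using this
  let fσ : Hol D := ⟨fun x : D => f (σ x), _, hfσ, fun _ => rfl⟩
  have halg : IsAlgebraic A fσ := by
    refine ⟨q.coeff 0, hqn, ?_⟩
    apply Subtype.ext
    funext z
    have h1 := hG z
    simp only [ev, Polynomial.coe_eval₂RingHom] at h1
    rw [Polynomial.eval₂_at_zero] at h1
    have h2 := Polynomial.hom_eval₂ (q.coeff 0) (algebraMap A (Hol D)) ((Pi.evalRingHom (fun _ : D => ℂ) z).comp (Hol D).subtype) fσ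
    refine Eq.trans ?_ (h2.trans h1)
    rfl
  obtain ⟨p, hp, hpf⟩ := IsAlgebraic.restrictScalars_of_isIntegral R halg
  refine ⟨p, hp, fun z hz => ?_⟩
  rw [← aeval_hol D p fσ ⟨z, hz⟩]
  exact congrFun (congrArg Subtype.val hpf) ⟨z, hz⟩

/-- If `F` is algebraic, holomorphic and not identically zero, we can choose the equation with nonzero constant coefficient. -/
theorem algOn_const_ne {d : ℕ} {D : Set (Fin d → ℂ)} (hD : IsOpen D) (hDc : IsPreconnected D)
    {F : (Fin d → ℂ) → ℂ} (hF : AnalyticOnNhd ℂ F D) (ha : AlgOn D F) (h0 : ∃ z ∈ D, F z ≠ 0) :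
    ∃ p : Polynomial (MvPolynomial (Fin d) ℂ), p.coeff 0 ≠ 0 ∧ ∀ z ∈ D, ev2 p z (F z) = 0 := by
  obtain ⟨p, hp, h⟩ := ha
  obtain ⟨q, hq, hqn⟩ := Polynomial.exists_eq_pow_rootMultiplicity_mul_and_not_dvd p hp 0
  simp only [Polynomial.C_0, sub_zero] at hq hqn
  rw [Polynomial.X_dvd_iff] at hqn
  refine ⟨q, hqn, ?_⟩
  obtain ⟨z0, hz0, hFz0⟩ := h0
  have hqa : AnalyticOnNhd ℂ (fun z => ev2 q z (F z)) D := by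
    simp only [ev2, Polynomial.eval_map, Polynomial.eval₂_eq_sum_range]
    refine Finset.analyticOnNhd_fun_sum _ fun i _ => ?_
    exact ((AnalyticOnNhd.eval_mvPolynomial _).mono (subset_univ _)).mul (hF.pow i)
  refine eq_zero_of_open hDc hqa hz0 ?_
  filter_upwards [hD.mem_nhds hz0, (hF z0 hz0).continuousAt.eventually_ne hFz0] with z hz hFz
  have := h z hz
  rw [hq] at this
  simp only [ev2, Polynomial.map_mul, Polynomial.map_pow, Polynomial.map_X, Polynomial.eval_mul, Polynomial.eval_pow, Polynomial.eval_X] at this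
  exact (mul_eq_zero.1 this).resolve_left (pow_ne_zero _ hFz)

end NashAux

namespace NashAux
open scoped IntermediateField nonZeroDivisors

theorem prim_elt (R A : Type) [CommRing R] [IsDomain R] [IsIntegrallyClosed R] [CharZero R] [CommRing A] [IsDomain A]
    [Algebra R A] [Module.Finite R A] (hinj : Function.Injective (algebraMap R A)) :
    ∃ (a : A) (P : Polynomial R), P.Monic ∧ Polynomial.aeval a P = 0 ∧ (∀ H : Polynomial R, Polynomial.aeval a H = 0 → P ∣ H) ∧
      (∃ δ : R, δ ≠ 0 ∧ ∃ y : A, Polynomial.aeval a P.derivative * y = algebraMap R A δ) ∧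
      ∀ b : A, ∃ δ : R, δ ≠ 0 ∧ ∃ G : Polynomial R, algebraMap R A δ * b = Polynomial.aeval a G := by
  haveI : Module.IsTorsionFree R A := by
    rw [Module.isTorsionFree_iff_algebraMap_injective]; exact hinj
  let K := FractionRing R
  let L := FractionRing A
  letI : Algebra K L := FractionRing.liftAlgebra R L
  haveI : FiniteDimensional K L := inferInstance
  haveI : CharZero K := inferInstance
  obtain ⟨α, hα⟩ := Field.exists_primitive_element K L
  obtain ⟨a0, b0, hb0, hab⟩ := IsFractionRing.div_surjective (A := A) α
  obtain ⟨r, hr, c, hc⟩ := (IsIntegral.isAlgebraic (IsIntegral.of_finite R b0)).exists_nonzero_dvd hb0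
  let a : A := a0 * c
  have hrL : algebraMap R L r ≠ 0 := by
    rw [IsScalarTower.algebraMap_apply R A L]
    intro h
    have := (IsFractionRing.injective A L) (h.trans (map_zero _).symm)
    exact hr (hinj (this.trans (map_zero _).symm))
  have hra : algebraMap R L r * α = algebraMap A L a := by
    rw [← hab, IsScalarTower.algebraMap_apply R A L, hc, map_mul]
    have : algebraMap A L b0 ≠ 0 := by
      intro h
      exact nonZeroDivisors.ne_zero hb0 ((IsFractionRing.injective A L) (h.trans (map_zero _).symm))
    simp only [a, map_mul]
    rw [mul_comm (algebraMap A L b0), mul_assoc, mul_div_cancel₀ _ this, mul_comm]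
  have htop : K⟮algebraMap A L a⟯ = ⊤ := by
    rw [eq_top_iff, ← hα, IntermediateField.adjoin_simple_le_iff]
    have h1 : algebraMap A L a ∈ K⟮algebraMap A L a⟯ := IntermediateField.mem_adjoin_simple_self K _
    have h2 : algebraMap R L r ∈ K⟮algebraMap A L a⟯ := by
      rw [IsScalarTower.algebraMap_apply R K L]
      exact IntermediateField.algebraMap_mem _ _
    have : α = (algebraMap R L r)⁻¹ * algebraMap A L a := by
      rw [← hra, inv_mul_cancel_left₀ hrL]
    rw [this]
    exact mul_mem (inv_mem h2) h1
  have hai : IsIntegral R a := IsIntegral.of_finite R a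
  have hdvd : ∀ H : Polynomial R, Polynomial.aeval a H = 0 → minpoly R a ∣ H := fun H hH => minpoly.isIntegrallyClosed_dvd hai hH
  refine ⟨a, minpoly R a, minpoly.monic hai, minpoly.aeval R a, hdvd, ?_, ?_⟩
  · have hne : Polynomial.aeval a (minpoly R a).derivative ≠ 0 := by
      intro h
      have h1 := hdvd _ h
      have hpos := minpoly.natDegree_pos hai
      have h2 : (minpoly R a).derivative ≠ 0 := by
        intro h0
        have := Polynomial.natDegree_eq_zero_of_derivative_eq_zero h0
        omega
      have h3 := Polynomial.natDegree_le_of_dvd h1 h2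
      have h4 := Polynomial.natDegree_derivative_lt hpos.ne'
      omega
    obtain ⟨δ, hδ, y, hy⟩ := (IsIntegral.isAlgebraic (IsIntegral.of_finite R (Polynomial.aeval a (minpoly R a).derivative))).exists_nonzero_dvd (mem_nonZeroDivisors_of_ne_zero hne)
    exact ⟨δ, hδ, y, hy.symm⟩
  · intro b
    have hb : algebraMap A L b ∈ K⟮algebraMap A L a⟯ := by rw [htop]; trivial
    have hia : IsIntegral K (algebraMap A L a) := IsIntegral.of_finite K _
    rw [← IntermediateField.mem_toSubalgebra, IntermediateField.adjoin_simple_toSubalgebra_of_isAlgebraic hia.isAlgebraic, Algebra.adjoin_singleton_eq_range_aeval] at hb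
    obtain ⟨q, hq⟩ := hb
    obtain ⟨m, hm⟩ := IsLocalization.integerNormalization_map_to_map R⁰ q
    refine ⟨m, nonZeroDivisors.ne_zero m.2, IsLocalization.integerNormalization R⁰ q, ?_⟩
    apply IsFractionRing.injective A L
    rw [map_mul, ← hq, ← IsScalarTower.algebraMap_apply R A L, ← Polynomial.aeval_algebraMap_apply,
      ← Polynomial.aeval_map_algebraMap K, hm]
    rw [← Algebra.smul_def, ← algebraMap_smul K (m : R) q, map_smul, algebraMap_smul]
    rfl


theorem ev2_add {n : ℕ} (p q : Polynomial (MvPolynomial (Fin n) ℂ)) (x : Fin n → ℂ) (t : ℂ) : ev2 (p + q) x t = ev2 p x t + ev2 q x t := by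
  simp [ev2]

theorem ev2_sub {n : ℕ} (p q : Polynomial (MvPolynomial (Fin n) ℂ)) (x : Fin n → ℂ) (t : ℂ) : ev2 (p - q) x t = ev2 p x t - ev2 q x t := by
  simp [ev2]

theorem ev2_mul {n : ℕ} (p q : Polynomial (MvPolynomial (Fin n) ℂ)) (x : Fin n → ℂ) (t : ℂ) : ev2 (p * q) x t = ev2 p x t * ev2 q x t := by
  simp [ev2]

theorem ev2_C {n : ℕ} (p : MvPolynomial (Fin n) ℂ) (x : Fin n → ℂ) (t : ℂ) : ev2 (Polynomial.C p) x t = eval x p := by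
  simp [ev2]

theorem ev2_X {n : ℕ} (x : Fin n → ℂ) (t : ℂ) : ev2 (Polynomial.X) x t = t := by
  simp [ev2]

/-- The zero locus of an ideal. -/
def VI {n : ℕ} (I : Ideal (MvPolynomial (Fin n) ℂ)) : Set (Fin n → ℂ) := {x | ∀ p ∈ I, eval x p = 0}

noncomputable def zm {n d : ℕ} (ζ : Fin d → MvPolynomial (Fin n) ℂ) (x : Fin n → ℂ) : Fin d → ℂ := fun i => eval x (ζ i)

theorem eval_zm {n d : ℕ} (ζ : Fin d → MvPolynomial (Fin n) ℂ) (x : Fin n → ℂ) (q : MvPolynomial (Fin d) ℂ) :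
    eval (zm ζ x) q = eval x (aeval ζ q) := by
  have : (eval (zm ζ x)) = (eval x).comp (aeval ζ : MvPolynomial (Fin d) ℂ →ₐ[ℂ] _).toRingHom := by
    apply MvPolynomial.ringHom_ext
    · intro a; simp
    · intro i; simp [zm]
  exact congrArg (fun φ => φ q) this

/-- Noether normalization data for a prime ideal. -/
structure NData {n : ℕ} (I : Ideal (MvPolynomial (Fin n) ℂ)) where
  d : ℕ
  ζ : Fin d → MvPolynomial (Fin n) ℂ
  θ : MvPolynomial (Fin n) ℂ
  P : Polynomial (MvPolynomial (Fin d) ℂ)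
  δ : MvPolynomial (Fin d) ℂ
  G : Fin n → Polynomial (MvPolynomial (Fin d) ℂ)
  Q : Fin n → Polynomial (MvPolynomial (Fin d) ℂ)
  δ_ne : δ ≠ 0
  P_monic : P.Monic
  inj : ∀ q : MvPolynomial (Fin d) ℂ, q ≠ 0 → aeval ζ q ∉ I
  onP : ∀ x ∈ VI I, ev2 P (zm ζ x) (eval x θ) = 0
  onG : ∀ x ∈ VI I, ∀ i, eval (zm ζ x) δ * x i = ev2 (G i) (zm ζ x) (eval x θ)
  Q_monic : ∀ i, (Q i).Monic
  onQ : ∀ i, ∀ x ∈ VI I, ev2 (Q i) (zm ζ x) (x i) = 0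
  lift : ∀ z t, eval z δ ≠ 0 → ev2 P z t = 0 → (fun i => ev2 (G i) z t / eval z δ) ∈ VI I ∧
    zm ζ (fun i => ev2 (G i) z t / eval z δ) = z ∧ eval (fun i => ev2 (G i) z t / eval z δ) θ = t
  der : ∀ z t, eval z δ ≠ 0 → ev2 P z t = 0 → ev2 P.derivative z t ≠ 0

theorem exists_ndata_aux {n : ℕ} (I : Ideal (MvPolynomial (Fin n) ℂ)) (A : Type) [CommRing A] [IsDomain A] [Algebra ℂ A]
    (π : MvPolynomial (Fin n) ℂ →ₐ[ℂ] A) (hπs : Function.Surjective π) (hπ : ∀ p, π p = 0 ↔ p ∈ I) : Nonempty (NData I) := by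
  classical
  haveI : Algebra.FiniteType ℂ A := Algebra.FiniteType.of_surjective π hπs
  obtain ⟨d, g, hginj, hgfin⟩ := exists_finite_inj_algHom_of_fg ℂ A
  let R := MvPolynomial (Fin d) ℂ
  letI : Algebra R A := g.toRingHom.toAlgebra
  haveI : Module.Finite R A := hgfin
  have halg : ∀ r : R, algebraMap R A r = g r := fun r => rfl
  obtain ⟨a, P, hPm, hPa, hPdvd, ⟨δ1, hδ1, y1, hy1⟩, hG⟩ := prim_elt R A hginj
  let X' : Fin n → A := fun i => π (X i)
  choose δ' hδ' G' hG' using fun i => hG (X' i)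
  obtain ⟨δ, hδdef⟩ : ∃ δ : R, δ = δ1 * ∏ i, δ' i := ⟨_, rfl⟩
  have hδ0 : δ ≠ 0 := hδdef ▸ mul_ne_zero hδ1 (Finset.prod_ne_zero_iff.2 fun i _ => hδ' i)
  have hdv : ∀ i, ∃ e, δ = e * δ' i := by
    intro i
    obtain ⟨e, he⟩ := Finset.dvd_prod_of_mem δ' (Finset.mem_univ i)
    exact ⟨δ1 * e, by simp only [hδdef, he]; ring⟩
  choose e he using hdv
  let G : Fin n → Polynomial R := fun i => Polynomial.C (e i) * G' i
  have hGa : ∀ i, algebraMap R A δ * X' i = Polynomial.aeval a (G i) := by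
    intro i
    simp only [G, he i, map_mul, Polynomial.aeval_C, ← hG', mul_assoc]
  choose ζ hζ using fun i : Fin d => hπs (g (X i))
  obtain ⟨θ, hθ⟩ := hπs a
  have hgq : ∀ q : R, g q = π (aeval ζ q) := by
    intro q
    have : g = (π).comp (aeval ζ) := by
      apply MvPolynomial.algHom_ext
      intro i
      simp [hζ]
    rw [this]; rfl
  -- evaluation at points
  have hevA : ∀ x ∈ VI I, ∃ φ : A →+* ℂ, (∀ p, φ (π p) = eval x p) := by
    intro x hx
    refine ⟨RingHom.liftOfSurjective π.toRingHom hπs ⟨eval x, fun p hp => hx p ((hπ p).1 hp)⟩, fun p => ?_⟩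
    exact RingHom.liftOfRightInverse_comp_apply π.toRingHom _ _ _ p
  have hevR : ∀ x (φ : A →+* ℂ), (∀ p, φ (π p) = eval x p) →
      ∀ (b : MvPolynomial (Fin n) ℂ) (H : Polynomial R), φ (Polynomial.aeval (π b) H) = ev2 H (zm ζ x) (eval x b) := by
    intro x φ hφ b H
    rw [ev2_eq_eval₂, Polynomial.aeval_def, Polynomial.hom_eval₂, hφ]
    congr 1
    ext q
    · have h1 := hφ (C q)
      rw [eval_C, ← algebraMap_eq, AlgHom.commutes] at h1
      simp [halg, hgq, h1]
    · simp [halg, hgq, hφ, zm]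
  choose Q hQm hQ using fun i : Fin n => (IsIntegral.of_finite R (X' i))
  -- homogenization
  have hhom : ∀ p : MvPolynomial (Fin n) ℂ, ∃ (N : ℕ) (H : Polynomial R),
      (algebraMap R A δ)^N * π p = Polynomial.aeval a H ∧
      ∀ z t, eval z δ ≠ 0 → (eval z δ)^N * eval (fun i => ev2 (G i) z t / eval z δ) p = ev2 H z t := by
    intro p
    induction p using MvPolynomial.induction_on with
    | C c =>
      refine ⟨0, Polynomial.C (C c), ?_, ?_⟩
      · simp only [pow_zero, one_mul, Polynomial.aeval_C, halg, hgq]; simp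
      · intro z t _; simp [ev2]
    | add p q hp hq =>
      obtain ⟨N1, H1, h1, h1'⟩ := hp
      obtain ⟨N2, H2, h2, h2'⟩ := hq
      refine ⟨N1 + N2, Polynomial.C (δ ^ N2) * H1 + Polynomial.C (δ ^ N1) * H2, ?_, ?_⟩
      · simp only [map_add, map_mul, Polynomial.aeval_C, ← h1, ← h2, map_pow]; ring
      · intro z t hz
        have e1 := h1' z t hz
        have e2 := h2' z t hz
        rw [ev2_add, ev2_mul, ev2_mul, ev2_C, ev2_C, ← e1, ← e2, map_pow, map_pow, map_add]; ring
    | mul_X p i hp =>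
      obtain ⟨N1, H1, h1, h1'⟩ := hp
      refine ⟨N1 + 1, H1 * G i, ?_, ?_⟩
      · simp only [map_mul, ← h1, ← hGa, X']; ring
      · intro z t hz
        have e1 := h1' z t hz
        rw [ev2_mul, ← e1, map_mul _ p (X i), eval_X, pow_succ]
        have h3 : ev2 (G i) z t = eval z δ * (ev2 (G i) z t / eval z δ) := by rw [mul_div_cancel₀ _ hz]
        generalize ev2 (G i) z t / eval z δ = u at h3 ⊢
        rw [h3]; ring
  have hzero : ∀ z t, eval z δ ≠ 0 → ev2 P z t = 0 → ∀ (p : MvPolynomial (Fin n) ℂ) (H : Polynomial R),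
      π p = Polynomial.aeval a H → eval (fun i => ev2 (G i) z t / eval z δ) p = ev2 H z t := by
    intro z t hz ht p H hpH
    obtain ⟨N, H1, h1, h2⟩ := hhom p
    have h3 : Polynomial.aeval a (H1 - Polynomial.C (δ^N) * H) = 0 := by
      rw [map_sub, ← h1, map_mul, hpH, Polynomial.aeval_C, map_pow, sub_self]
    obtain ⟨w, hw⟩ := hPdvd _ h3
    have h4 : ev2 H1 z t - (eval z δ)^N * ev2 H z t = 0 := by
      have h5 : ev2 (H1 - Polynomial.C (δ^N) * H) z t = ev2 (P * w) z t := congrArg (fun H => ev2 H z t) hw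
      have h6 : eval z (δ ^ N) = (eval z δ) ^ N := map_pow _ _ _
      rw [ev2_sub, ev2_mul, ev2_mul, ht, zero_mul, ev2_C, h6] at h5
      exact h5
    rw [← h2 z t hz] at h4
    have := mul_left_cancel₀ (pow_ne_zero N hz) (sub_eq_zero.1 h4)
    exact this
  have hlift : ∀ z t, eval z δ ≠ 0 → ev2 P z t = 0 → (fun i => ev2 (G i) z t / eval z δ) ∈ VI I ∧
    zm ζ (fun i => ev2 (G i) z t / eval z δ) = z ∧ eval (fun i => ev2 (G i) z t / eval z δ) θ = t := by
    intro z t hz ht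
    refine ⟨fun p hp => ?_, ?_, ?_⟩
    · rw [hzero z t hz ht p 0 (by rw [(hπ p).2 hp, map_zero])]
      simp [ev2]
    · funext i
      have := hzero z t hz ht (ζ i) (Polynomial.C (X i)) (by rw [hζ, Polynomial.aeval_C]; rfl)
      simpa [ev2, zm] using this
    · have := hzero z t hz ht θ Polynomial.X (by rw [hθ, Polynomial.aeval_X])
      simpa [ev2] using this
  refine ⟨⟨d, ζ, θ, P, δ, G, Q, hδ0, hPm, ?_, ?_, ?_, hQm, ?_, hlift, ?_⟩⟩
  · intro q hq hqI
    rw [← hπ, ← hgq] at hqI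
    exact hq (hginj (hqI.trans (map_zero _).symm))
  · intro x hx
    obtain ⟨φ, hφ⟩ := hevA x hx
    rw [← hevR x φ hφ, hθ, hPa, map_zero]
  · intro x hx i
    obtain ⟨φ, hφ⟩ := hevA x hx
    rw [← hevR x φ hφ, hθ, ← hGa, map_mul, hφ, halg, hgq, hφ, ← eval_zm, eval_X]
  · intro i x hx
    obtain ⟨φ, hφ⟩ := hevA x hx
    have := hevR x φ hφ (X i) (Q i)
    rw [eval_X] at this
    rw [← this]
    have h0 : Polynomial.aeval (π (X i)) (Q i) = 0 := hQ i
    rw [h0, map_zero]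
  · intro z t hz ht h0
    obtain ⟨hV, hz', ht'⟩ := hlift z t hz ht
    obtain ⟨φ, hφ⟩ := hevA _ hV
    have h1 := congrArg φ hy1
    rw [map_mul, ← hθ, hevR _ φ hφ, hz', ht', h0, zero_mul, halg, hgq, hφ, ← eval_zm, hz'] at h1
    apply hz
    simp [hδdef, ← h1]

theorem exists_ndata {n : ℕ} (I : Ideal (MvPolynomial (Fin n) ℂ)) (hI : I.IsPrime) : Nonempty (NData I) :=
  exists_ndata_aux I (MvPolynomial (Fin n) ℂ ⧸ I) (Ideal.Quotient.mkₐ ℂ I) (Ideal.Quotient.mkₐ_surjective ℂ I)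
    (fun _ => Ideal.Quotient.eq_zero_iff_mem)

end NashAux

namespace NashAux

theorem analyticAt_eval_comp {n : ℕ} {E : Type*} [NormedAddCommGroup E] [NormedSpace ℂ E] (q : MvPolynomial (Fin n) ℂ)
    {g : E → (Fin n → ℂ)} {u : E} (hg : ∀ i, AnalyticAt ℂ (fun v => g v i) u) : AnalyticAt ℂ (fun v => eval (g v) q) u := by
  have := AnalyticAt.aeval_mvPolynomial hg q
  simpa [MvPolynomial.aeval_def, MvPolynomial.eval, eval₂_eq'] using this

theorem analyticAt_ev2_comp {n : ℕ} {E : Type*} [NormedAddCommGroup E] [NormedSpace ℂ E] (P : Polynomial (MvPolynomial (Fin n) ℂ))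
    {g : E → (Fin n → ℂ)} {h : E → ℂ} {u : E} (hg : ∀ i, AnalyticAt ℂ (fun v => g v i) u) (hh : AnalyticAt ℂ h u) :
    AnalyticAt ℂ (fun v => ev2 P (g v) (h v)) u := by
  simp only [ev2_eq_eval₂, Polynomial.eval₂_eq_sum_range]
  exact Finset.analyticAt_fun_sum _ fun i _ => (analyticAt_eval_comp _ hg).mul (hh.pow i)

theorem continuous_ev2_comp {n : ℕ} {E : Type*} [TopologicalSpace E] (P : Polynomial (MvPolynomial (Fin n) ℂ))
    {g : E → (Fin n → ℂ)} {h : E → ℂ} (hg : Continuous g) (hh : Continuous h) :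
    Continuous (fun v => ev2 P (g v) (h v)) := by
  simp only [ev2_eq_eval₂, Polynomial.eval₂_eq_sum_range]
  exact continuous_finset_sum _ fun i _ => ((continuous_eval_poly _).comp hg).mul (hh.pow i)

theorem continuous_zm {n d : ℕ} (ζ : Fin d → MvPolynomial (Fin n) ℂ) : Continuous (zm ζ) :=
  continuous_pi fun i => continuous_eval_poly (ζ i)

theorem isClosed_VI {n : ℕ} (I : Ideal (MvPolynomial (Fin n) ℂ)) : IsClosed (VI I) := by
  have : VI I = ⋂ p ∈ I, {x | eval x p = 0} := by ext; simp [VI]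
  rw [this]
  exact isClosed_biInter fun p _ => isClosed_eq (continuous_eval_poly p) continuous_const

theorem root_exists {d : ℕ} (P : Polynomial (MvPolynomial (Fin d) ℂ)) (z0 : Fin d → ℂ) (t0 : ℂ) (h0 : ev2 P z0 t0 = 0)
    (h1 : ev2 P.derivative z0 t0 ≠ 0) : ∃ τ : (Fin d → ℂ) → ℂ, AnalyticAt ℂ τ z0 ∧ τ z0 = t0 ∧ (∀ᶠ z in 𝓝 z0, ev2 P z (τ z) = 0) ∧
      ∀ᶠ v in 𝓝 (z0, t0), ev2 P v.1 v.2 = 0 → τ v.1 = v.2 := by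
  let f : (Fin d → ℂ) × ℂ → ℂ := fun v => ev2 P v.1 v.2
  have hfa : AnalyticAt ℂ f (z0, t0) := by
    refine analyticAt_ev2_comp P (fun i => ?_) analyticAt_snd
    exact ((ContinuousLinearMap.proj (R := ℂ) (φ := fun _ : Fin d => ℂ) i).analyticAt _).comp analyticAt_fst
  have cdf : ContDiffAt ℂ ⊤ f (z0, t0) := hfa.contDiffAt
  have hd : HasFDerivAt (fun t => f (z0, t)) (fderiv ℂ f (z0, t0) ∘L .inr ℂ (Fin d → ℂ) ℂ) t0 := by
    have := hfa.differentiableAt.hasFDerivAt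
    exact this.comp t0 (hasFDerivAt_prodMk_right z0 t0)
  have hd2 : HasDerivAt (fun t => f (z0, t)) (ev2 P.derivative z0 t0) t0 := by
    have := (P.map (eval z0)).hasDerivAt t0
    rw [Polynomial.derivative_map] at this
    exact this
  have hL : (fderiv ℂ f (z0, t0) ∘L .inr ℂ (Fin d → ℂ) ℂ) 1 = ev2 P.derivative z0 t0 := by
    have := hd.hasDerivAt
    exact this.unique hd2
  have if2 : (fderiv ℂ f (z0, t0) ∘L .inr ℂ (Fin d → ℂ) ℂ).IsInvertible := by
    refine ⟨ContinuousLinearEquiv.unitsEquivAut ℂ (Units.mk0 _ h1), ?_⟩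
    ext
    simp [← hL]
  refine ⟨cdf.implicitFunction (by simp) if2, ?_, ?_, ?_, ?_⟩
  · exact (cdf.contDiffAt_implicitFunction (by simp) if2).analyticAt
  · exact cdf.implicitFunction_apply_self (by simp) if2
  · filter_upwards [cdf.eventually_apply_implicitFunction (by simp) if2] with z hz
    exact hz.trans h0
  · filter_upwards [cdf.eventually_apply_eq_iff_implicitFunction (by simp) if2] with v hv h
    exact hv.1 (h.trans h0.symm)

end NashAux

namespace NashAux

/-- A holomorphic section of the Noether projection. -/
structure Sec {n : ℕ} {I : Ideal (MvPolynomial (Fin n) ℂ)} (N : NData I) (D : Set (Fin N.d → ℂ))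
    (σ : (Fin N.d → ℂ) → (Fin n → ℂ)) : Prop where
  ana : ∀ i, AnalyticOnNhd ℂ (fun z => σ z i) D
  mem : ∀ z ∈ D, σ z ∈ VI I
  proj : ∀ z ∈ D, zm N.ζ (σ z) = z
  ne : ∀ z ∈ D, eval z N.δ ≠ 0

theorem Sec.mono {n : ℕ} {I : Ideal (MvPolynomial (Fin n) ℂ)} {N : NData I} {D D' : Set (Fin N.d → ℂ)}
    {σ : (Fin N.d → ℂ) → (Fin n → ℂ)} (h : Sec N D σ) (h' : D' ⊆ D) : Sec N D' σ :=
  ⟨fun i z hz => h.ana i z (h' hz), fun z hz => h.mem z (h' hz), fun z hz => h.proj z (h' hz), fun z hz => h.ne z (h' hz)⟩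

theorem Sec.intOn {n : ℕ} {I : Ideal (MvPolynomial (Fin n) ℂ)} {N : NData I} {D : Set (Fin N.d → ℂ)}
    {σ : (Fin N.d → ℂ) → (Fin n → ℂ)} (h : Sec N D σ) (i : Fin n) : IntOn D (fun z => σ z i) :=
  ⟨N.Q i, N.Q_monic i, fun z hz => by
    have := N.onQ i _ (h.mem z hz)
    rwa [h.proj z hz] at this⟩

theorem Sec.continuousAt {n : ℕ} {I : Ideal (MvPolynomial (Fin n) ℂ)} {N : NData I} {D : Set (Fin N.d → ℂ)}
    {σ : (Fin N.d → ℂ) → (Fin n → ℂ)} (h : Sec N D σ) {z} (hz : z ∈ D) : ContinuousAt σ z :=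
  continuousAt_pi.2 fun i => (h.ana i z hz).continuousAt

theorem Sec.analyticAt {n : ℕ} {I : Ideal (MvPolynomial (Fin n) ℂ)} {N : NData I} {D : Set (Fin N.d → ℂ)}
    {σ : (Fin N.d → ℂ) → (Fin n → ℂ)} (h : Sec N D σ) {z} (hz : z ∈ D) : AnalyticAt ℂ σ z :=
  analyticAt_pi_iff.2 fun i => h.ana i z hz

theorem sec_exists {n : ℕ} {I : Ideal (MvPolynomial (Fin n) ℂ)} (N : NData I) {x : Fin n → ℂ} (hx : x ∈ VI I)
    (hδ : eval (zm N.ζ x) N.δ ≠ 0) {O : Set (Fin n → ℂ)} (hO : O ∈ 𝓝 x) :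
    ∃ r > 0, ∃ σ, Sec N (Metric.ball (zm N.ζ x) r) σ ∧ (∀ z ∈ Metric.ball (zm N.ζ x) r, σ z ∈ O) ∧ σ (zm N.ζ x) = x ∧
      ∀ᶠ x' in 𝓝 x, x' ∈ VI I → σ (zm N.ζ x') = x' := by
  obtain ⟨τ, hτa, hτ0, hτP, hτu⟩ := root_exists N.P (zm N.ζ x) (eval x N.θ) (N.onP x hx) (N.der _ _ hδ (N.onP x hx))
  let σ : (Fin N.d → ℂ) → (Fin n → ℂ) := fun z i => ev2 (N.G i) z (τ z) / eval z N.δ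
  have hid : ∀ z : Fin N.d → ℂ, ∀ i, AnalyticAt ℂ (fun v : Fin N.d → ℂ => v i) z := fun z i =>
    (ContinuousLinearMap.proj (R := ℂ) (φ := fun _ : Fin N.d => ℂ) i).analyticAt _
  have hσx : σ (zm N.ζ x) = x := by
    funext i
    simp only [σ, hτ0]
    rw [← N.onG x hx i, mul_div_cancel_left₀ _ hδ]
  have hne : ∀ᶠ z in 𝓝 (zm N.ζ x), eval z N.δ ≠ 0 := (continuous_eval_poly N.δ).continuousAt.eventually_ne hδ
  have hσa : ∀ᶠ z in 𝓝 (zm N.ζ x), ∀ i, AnalyticAt ℂ (fun z => σ z i) z := by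
    filter_upwards [hτa.eventually_analyticAt, hne] with z h1 h2 i
    exact (analyticAt_ev2_comp (N.G i) (hid z) h1).div (analyticAt_eval_comp N.δ (hid z)) h2
  have hσc : ContinuousAt σ (zm N.ζ x) := continuousAt_pi.2 fun i => (hσa.self_of_nhds i).continuousAt
  have hσO : ∀ᶠ z in 𝓝 (zm N.ζ x), σ z ∈ O := hσc (by rw [hσx]; exact hO)
  obtain ⟨r, hr, hball⟩ := Metric.eventually_nhds_iff_ball.1 (hne.and (hσa.and (hσO.and hτP)))
  refine ⟨r, hr, σ, ⟨fun i z hz => (hball z hz).2.1 i, fun z hz => ?_, fun z hz => ?_, fun z hz => (hball z hz).1⟩,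
    fun z hz => (hball z hz).2.2.1, hσx, ?_⟩
  · exact (N.lift z (τ z) (hball z hz).1 (hball z hz).2.2.2).1
  · exact (N.lift z (τ z) (hball z hz).1 (hball z hz).2.2.2).2.1
  · have hc : ContinuousAt (fun x' => (zm N.ζ x', eval x' N.θ)) x :=
      ((continuous_zm N.ζ).prodMk (continuous_eval_poly N.θ)).continuousAt
    filter_upwards [hc.eventually hτu, (continuous_zm N.ζ).continuousAt.eventually hne] with x' h1 h2 hx'
    funext i
    simp only [σ]
    have h3 := h1 (N.onP x' hx')
    rw [h3, ← N.onG x' hx' i, mul_div_cancel_left₀ _ h2]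

theorem fiber_finite {n : ℕ} {I : Ideal (MvPolynomial (Fin n) ℂ)} (N : NData I) (z : Fin N.d → ℂ) :
    {x | x ∈ VI I ∧ zm N.ζ x = z}.Finite := by
  have : (Set.pi univ fun i : Fin n => {t : ℂ | ((N.Q i).map (eval z)).IsRoot t}).Finite := by
    apply Set.Finite.pi
    intro i
    exact Polynomial.finite_setOf_isRoot ((N.Q_monic i).map _).ne_zero
  refine this.subset ?_
  rintro x ⟨hx, hz⟩ i _
  have := N.onQ i x hx
  rw [hz] at this
  exact this

theorem fiber_card {n : ℕ} {I : Ideal (MvPolynomial (Fin n) ℂ)} (N : NData I) (z : Fin N.d → ℂ) (hz : eval z N.δ ≠ 0) 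
    (s : Finset (Fin n → ℂ)) (hs : ∀ x ∈ s, x ∈ VI I ∧ zm N.ζ x = z) : s.card ≤ N.P.natDegree := by
  classical
  have h1 : (s.image fun x => eval x N.θ) ⊆ (N.P.map (eval z)).roots.toFinset := by
    intro t ht
    obtain ⟨x, hx, rfl⟩ := Finset.mem_image.1 ht
    rw [Multiset.mem_toFinset, Polynomial.mem_roots (N.P_monic.map _).ne_zero]
    have := N.onP x (hs x hx).1
    rw [(hs x hx).2] at this
    exact this
  have h2 : (s.image fun x => eval x N.θ).card = s.card := by
    apply Finset.card_image_of_injOn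
    intro x hx x' hx' hxx
    obtain ⟨a1, a2⟩ := hs x hx
    obtain ⟨b1, b2⟩ := hs x' hx'
    funext i
    have e1 := N.onG x a1 i
    have e2 := N.onG x' b1 i
    simp only at hxx
    rw [b2, ← hxx] at e2
    rw [a2] at e1
    exact mul_left_cancel₀ hz (e1.trans e2.symm)
  calc s.card = _ := h2.symm
    _ ≤ _ := Finset.card_le_card h1
    _ ≤ _ := Multiset.toFinset_card_le _
    _ ≤ _ := Polynomial.card_roots' _
    _ = _ := (N.P_monic.natDegree_map _)

end NashAux

namespace NashAux

theorem exists_tube {n : ℕ} {I : Ideal (MvPolynomial (Fin n) ℂ)} (N : NData I) (y : Fin n → ℂ) {ρ0 : ℝ} (hρ0 : 0 < ρ0) :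
    ∃ ρ, 0 < ρ ∧ ρ ≤ ρ0 ∧ ∀ ε > 0, ∃ r > 0, ∀ x ∈ VI I, x ∈ Metric.closedBall y ρ → zm N.ζ x ∈ Metric.ball (zm N.ζ y) r → x ∈ Metric.ball y ε := by
  have hfin := (fiber_finite N (zm N.ζ y)).subset (t := {x | (x ∈ VI I ∧ zm N.ζ x = zm N.ζ y) ∧ x ≠ y}) (fun x hx => hx.1)
  have hnhds : {x | (x ∈ VI I ∧ zm N.ζ x = zm N.ζ y) ∧ x ≠ y}ᶜ ∈ 𝓝 y := hfin.isClosed.isOpen_compl.mem_nhds (by simp)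
  obtain ⟨ρ1, hρ1, hb⟩ := Metric.nhds_basis_closedBall.mem_iff.1 hnhds
  refine ⟨min ρ0 ρ1, lt_min hρ0 hρ1, min_le_left _ _, fun ε hε => ?_⟩
  have hK : IsCompact (VI I ∩ Metric.closedBall y (min ρ0 ρ1)) := (isCompact_closedBall _ _).inter_left (isClosed_VI I)
  have key : ∀ᶠ z in 𝓝 (zm N.ζ y), ∀ x ∈ VI I ∩ Metric.closedBall y (min ρ0 ρ1), zm N.ζ x = z → x ∈ Metric.ball y ε := by
    apply hK.eventually_forall_of_forall_eventually
    rintro x ⟨hx, hxb⟩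
    by_cases hxy : x = y
    · have : ∀ᶠ w : (Fin N.d → ℂ) × (Fin n → ℂ) in 𝓝 (zm N.ζ y, x), w.2 ∈ Metric.ball y ε := by
        apply continuous_snd.continuousAt.eventually
        exact Metric.isOpen_ball.mem_nhds (by simp [hxy, hε])
      filter_upwards [this] with w hw _ using hw
    · have hne : zm N.ζ x ≠ zm N.ζ y := by
        intro h
        exact hb (Metric.closedBall_subset_closedBall (min_le_right _ _) hxb) ⟨⟨hx, h⟩, hxy⟩
      have : ∀ᶠ w : (Fin N.d → ℂ) × (Fin n → ℂ) in 𝓝 (zm N.ζ y, x), zm N.ζ w.2 ≠ w.1 := by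
        exact (isOpen_ne_fun ((continuous_zm N.ζ).comp continuous_snd) continuous_fst).mem_nhds hne
      filter_upwards [this] with w hw h using absurd h hw
  obtain ⟨r, hr, h⟩ := Metric.eventually_nhds_iff_ball.1 key
  exact ⟨r, hr, fun x hx hxb hz => h _ hz x ⟨hx, hxb⟩ rfl⟩

/-- the regular part of the tube -/
def Rg {n : ℕ} {I : Ideal (MvPolynomial (Fin n) ℂ)} (N : NData I) (y : Fin n → ℂ) (ρ r : ℝ) : Set (Fin n → ℂ) :=
  {x | x ∈ VI I ∧ x ∈ Metric.closedBall y ρ ∧ zm N.ζ x ∈ Metric.ball (zm N.ζ y) r ∧ eval (zm N.ζ x) N.δ ≠ 0}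

/-- tube condition -/
def Tb {n : ℕ} {I : Ideal (MvPolynomial (Fin n) ℂ)} (N : NData I) (y : Fin n → ℂ) (ρ r : ℝ) : Prop :=
  ∀ x ∈ VI I, x ∈ Metric.closedBall y ρ → zm N.ζ x ∈ Metric.ball (zm N.ζ y) r → x ∈ Metric.ball y ρ

/-- relatively clopen subsets -/
structure Clo {n : ℕ} {I : Ideal (MvPolynomial (Fin n) ℂ)} (N : NData I) (y : Fin n → ℂ) (ρ r : ℝ) (C : Set (Fin n → ℂ)) : Prop where
  sub : C ⊆ Rg N y ρ r
  op : ∀ x ∈ C, ∀ᶠ x' in 𝓝 x, x' ∈ VI I → x' ∈ C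
  cl : ∀ x ∈ Rg N y ρ r, x ∉ C → ∀ᶠ x' in 𝓝 x, x' ∈ VI I → x' ∉ C

noncomputable def Fb {n : ℕ} {I : Ideal (MvPolynomial (Fin n) ℂ)} (N : NData I) (C : Set (Fin n → ℂ)) (z : Fin N.d → ℂ) : Finset (Fin n → ℂ) :=
  ((fiber_finite N z).inter_of_left C).toFinset

theorem mem_Fb {n : ℕ} {I : Ideal (MvPolynomial (Fin n) ℂ)} (N : NData I) (C : Set (Fin n → ℂ)) (z : Fin N.d → ℂ) (x : Fin n → ℂ) :
    x ∈ Fb N C z ↔ (x ∈ VI I ∧ zm N.ζ x = z) ∧ x ∈ C := by simp [Fb]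

theorem clo_univ {n : ℕ} {I : Ideal (MvPolynomial (Fin n) ℂ)} {N : NData I} {y : Fin n → ℂ} {ρ r : ℝ} (h : Tb N y ρ r) :
    Clo N y ρ r (Rg N y ρ r) := by
  refine ⟨subset_rfl, ?_, fun x hx hx' => absurd hx hx'⟩
  rintro x ⟨h1, h2, h3, h4⟩
  filter_upwards [Metric.isOpen_ball.mem_nhds (h x h1 h2 h3), (continuous_zm N.ζ).continuousAt.eventually (Metric.isOpen_ball.mem_nhds h3),
    ((continuous_eval_poly N.δ).comp (continuous_zm N.ζ)).continuousAt.eventually_ne h4] with x' e1 e2 e3 hx'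
  exact ⟨hx', Metric.ball_subset_closedBall e1, e2, e3⟩

theorem even_cover {n : ℕ} {I : Ideal (MvPolynomial (Fin n) ℂ)} {N : NData I} {y : Fin n → ℂ} {ρ r : ℝ} {C : Set (Fin n → ℂ)}
    (hC : Clo N y ρ r C) {b : Fin N.d → ℂ} (hb : b ∈ Metric.ball (zm N.ζ y) r) (hδ : eval b N.δ ≠ 0) :
    ∃ r1 > 0, Metric.ball b r1 ⊆ Metric.ball (zm N.ζ y) r ∧ ∃ σ : (Fin n → ℂ) → (Fin N.d → ℂ) → (Fin n → ℂ),
      (∀ p ∈ Fb N C b, Sec N (Metric.ball b r1) (σ p)) ∧ ∀ z ∈ Metric.ball b r1, eval z N.δ ≠ 0 ∧ (∀ p ∈ Fb N C b, σ p z ∈ C) ∧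
        Set.InjOn (fun p => σ p z) (Fb N C b) ∧ Fb N C z = (Fb N C b).image (fun p => σ p z) := by
  classical
  obtain ⟨U, hU, hUd⟩ := (Fb N C b).finite_toSet.t2_separation
  have hsec : ∀ p : Fin n → ℂ, p ∈ Fb N C b → ∃ r > 0, ∃ σ, Sec N (Metric.ball b r) σ ∧ (∀ z ∈ Metric.ball b r, σ z ∈ U p ∩ C) ∧ σ b = p ∧
      ∀ᶠ x' in 𝓝 p, x' ∈ VI I → σ (zm N.ζ x') = x' := by
    intro p hp
    obtain ⟨⟨h1, h2⟩, h3⟩ := (mem_Fb N C b p).1 hp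
    have := sec_exists N h1 (by rw [h2]; exact hδ) (O := U p ∩ {x' | x' ∈ VI I → x' ∈ C}) (inter_mem ((hU p).2.mem_nhds (hU p).1) (hC.op p h3))
    rw [h2] at this
    obtain ⟨r, hr, σ, a1, a2, a3, a4⟩ := this
    exact ⟨r, hr, σ, a1, fun z hz => ⟨(a2 z hz).1, (a2 z hz).2 (a1.mem z hz)⟩, a3, a4⟩
  choose! rr hrr σ hσ hσU hσb hσu using hsec
  have hK : IsCompact (VI I ∩ Metric.closedBall y ρ) := (isCompact_closedBall _ _).inter_left (isClosed_VI I)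
  have key : ∀ᶠ z in 𝓝 b, ∀ x ∈ VI I ∩ Metric.closedBall y ρ, x ∈ C → zm N.ζ x = z → ∃ p ∈ Fb N C b, σ p z = x := by
    apply hK.eventually_forall_of_forall_eventually
    rintro x ⟨hx, hxb⟩
    have hsnd : Tendsto (fun w : (Fin N.d → ℂ) × (Fin n → ℂ) => w.2) (𝓝 (b, x)) (𝓝 x) := continuous_snd.continuousAt
    by_cases hz : zm N.ζ x = b
    · by_cases hxC : x ∈ C
      · have hp : x ∈ Fb N C b := (mem_Fb _ _ _ _).2 ⟨⟨hx, hz⟩, hxC⟩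
        filter_upwards [hsnd.eventually (hσu x hp)] with w hw h1 h2
        refine ⟨x, hp, ?_⟩
        rw [← h2]
        exact hw ((hC.sub h1).1)
      · filter_upwards [hsnd.eventually (hC.cl x ⟨hx, hxb, by rw [hz]; exact hb, by rw [hz]; exact hδ⟩ hxC)] with w hw h1 h2
        exact absurd h1 (hw ((hC.sub h1).1))
    · have : ∀ᶠ w : (Fin N.d → ℂ) × (Fin n → ℂ) in 𝓝 (b, x), zm N.ζ w.2 ≠ w.1 := by
        exact (isOpen_ne_fun ((continuous_zm N.ζ).comp continuous_snd) continuous_fst).mem_nhds hz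
      filter_upwards [this] with w hw _ h using absurd h hw
  have hall : ∀ᶠ z in 𝓝 b, ∀ p ∈ Fb N C b, z ∈ Metric.ball b (rr p) := by
    rw [Filter.eventually_all_finset]
    intro p hp
    exact Metric.isOpen_ball.mem_nhds (Metric.mem_ball_self (hrr p hp))
  have hne : ∀ᶠ z in 𝓝 b, eval z N.δ ≠ 0 := (continuous_eval_poly N.δ).continuousAt.eventually_ne hδ
  have hin : ∀ᶠ z in 𝓝 b, z ∈ Metric.ball (zm N.ζ y) r := Metric.isOpen_ball.mem_nhds hb
  obtain ⟨r1, hr1, H⟩ := Metric.eventually_nhds_iff_ball.1 (key.and (hall.and (hne.and hin)))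
  refine ⟨r1, hr1, fun z hz => (H z hz).2.2.2, σ, fun p hp => (hσ p hp).mono fun z hz => (H z hz).2.1 p hp, fun z hz => ?_⟩
  obtain ⟨k1, k2, k3, k4⟩ := H z hz
  refine ⟨k3, fun p hp => (hσU p hp z (k2 p hp)).2, ?_, ?_⟩
  · intro p hp q hq hpq
    by_contra hne
    have hd := hUd hp hq hne
    simp only at hpq
    exact Set.disjoint_left.1 hd (hσU p hp z (k2 p hp)).1 (hpq ▸ (hσU q hq z (k2 q hq)).1)
  · ext x
    rw [mem_Fb, Finset.mem_image]
    constructor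
    · rintro ⟨⟨h1, h2⟩, h3⟩
      exact k1 x ⟨h1, (hC.sub h3).2.1⟩ h3 h2
    · rintro ⟨p, hp, rfl⟩
      exact ⟨⟨(hσ p hp).mem z (k2 p hp), (hσ p hp).proj z (k2 p hp)⟩, (hσU p hp z (k2 p hp)).2⟩

end NashAux

namespace NashAux

variable {n : ℕ} {I : Ideal (MvPolynomial (Fin n) ℂ)} {N : NData I} {y : Fin n → ℂ} {ρ r : ℝ}

theorem card_const {C : Set (Fin n → ℂ)} (hC : Clo N y ρ r C) {b b' : Fin N.d → ℂ} (hb : b ∈ Metric.ball (zm N.ζ y) r) (hδ : eval b N.δ ≠ 0)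
    (hb' : b' ∈ Metric.ball (zm N.ζ y) r) (hδ' : eval b' N.δ ≠ 0) : (Fb N C b).card = (Fb N C b').card := by
  classical
  have hpre := isPreconnected_diff N.δ_ne (B := Metric.ball (zm N.ζ y) r) Metric.isOpen_ball (convex_ball _ _).isPreconnected
  refine hpre.constant (f := fun b => (Fb N C b).card) ?_ ⟨hb, hδ⟩ ⟨hb', hδ'⟩
  rintro c ⟨hc, hcδ⟩
  apply ContinuousAt.continuousWithinAt
  obtain ⟨r1, hr1, -, σ, hσ, H⟩ := even_cover hC hc hcδ
  have : (fun b => (Fb N C b).card) =ᶠ[𝓝 c] fun _ => (Fb N C c).card := by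
    filter_upwards [Metric.ball_mem_nhds c hr1] with z hz
    rw [(H z hz).2.2.2, Finset.card_image_of_injOn (H z hz).2.2.1]
  exact continuousAt_const.congr this.symm

/-- the tube over a smaller ball -/
def Tz (N : NData I) (y : Fin n → ℂ) (r : ℝ) : Set (Fin n → ℂ) := {x | zm N.ζ x ∈ Metric.ball (zm N.ζ y) r}

theorem isOpen_Tz (N : NData I) (y : Fin n → ℂ) (r : ℝ) : IsOpen (Tz N y r) := Metric.isOpen_ball.preimage (continuous_zm N.ζ)

theorem Tz_mono {r' : ℝ} (h : r' ≤ r) : Tz N y r' ⊆ Tz N y r := fun _ hx => Metric.ball_subset_ball h hx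

theorem mem_Tz_self (hr : 0 < r) : y ∈ Tz N y r := Metric.mem_ball_self hr

theorem Clo.restrict {C : Set (Fin n → ℂ)} (hC : Clo N y ρ r C) {r' : ℝ} (h : r' ≤ r) : Clo N y ρ r' (C ∩ Tz N y r') := by
  refine ⟨fun x hx => ?_, fun x hx => ?_, fun x hx hx' => ?_⟩
  · obtain ⟨h1, h2, h3, h4⟩ := hC.sub hx.1
    exact ⟨h1, h2, hx.2, h4⟩
  · filter_upwards [hC.op x hx.1, (isOpen_Tz N y r').mem_nhds hx.2] with x' h1 h2 h3 using ⟨h1 h3, h2⟩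
  · obtain ⟨h1, h2, h3, h4⟩ := hx
    have : x ∉ C := fun h => hx' ⟨h, h3⟩
    filter_upwards [hC.cl x ⟨h1, h2, Metric.ball_subset_ball h h3, h4⟩ this] with x' k1 k2 k3 using k1 k2 k3.1

theorem Clo.diff {C C' : Set (Fin n → ℂ)} (hC : Clo N y ρ r C) (hC' : Clo N y ρ r C') : Clo N y ρ r (C \ C') := by
  refine ⟨fun x hx => hC.sub hx.1, fun x hx => ?_, fun x hx hx' => ?_⟩
  · filter_upwards [hC.op x hx.1, hC'.cl x (hC.sub hx.1) hx.2] with x' h1 h2 h3 using ⟨h1 h3, h2 h3⟩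
  · by_cases h : x ∈ C
    · have h' : x ∈ C' := by by_contra h'; exact hx' ⟨h, h'⟩
      filter_upwards [hC'.op x h'] with x' h1 h2 h3 using h3.2 (h1 h2)
    · filter_upwards [hC.cl x hx h] with x' h1 h2 h3 using h1 h2 h3.1

theorem Clo.fiber_nonempty {C : Set (Fin n → ℂ)} (hC : Clo N y ρ r C) (hne : C.Nonempty) {b : Fin N.d → ℂ}
    (hb : b ∈ Metric.ball (zm N.ζ y) r) (hδ : eval b N.δ ≠ 0) : 0 < (Fb N C b).card := by
  obtain ⟨x, hx⟩ := hne
  obtain ⟨h1, h2, h3, h4⟩ := hC.sub hx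
  rw [card_const hC hb hδ h3 h4]
  exact Finset.card_pos.2 ⟨x, (mem_Fb _ _ _ _).2 ⟨⟨h1, rfl⟩, hx⟩⟩

theorem exists_base (N : NData I) (y : Fin n → ℂ) (hr : 0 < r) : ∃ b ∈ Metric.ball (zm N.ζ y) r, eval b N.δ ≠ 0 := by
  obtain ⟨b, h1, h2⟩ := (dense_ne N.δ_ne).exists_mem_open (Metric.isOpen_ball (x := zm N.ζ y) (ε := r)) ⟨_, Metric.mem_ball_self hr⟩
  exact ⟨b, h2, h1⟩

theorem Clo.restrict_nonempty {C : Set (Fin n → ℂ)} (hC : Clo N y ρ r C) (hne : C.Nonempty) {r' : ℝ} (h0 : 0 < r') (h : r' ≤ r) :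
    (C ∩ Tz N y r').Nonempty := by
  obtain ⟨b, hb, hδ⟩ := exists_base N y h0
  obtain ⟨x, hx⟩ := Finset.card_pos.1 (hC.fiber_nonempty hne (Metric.ball_subset_ball h hb) hδ)
  obtain ⟨⟨h1, h2⟩, h3⟩ := (mem_Fb _ _ _ _).1 hx
  exact ⟨x, h3, by rw [Tz, mem_setOf_eq, h2]; exact hb⟩

structure GIrr (N : NData I) (y : Fin n → ℂ) (ρ r : ℝ) (C : Set (Fin n → ℂ)) : Prop where
  clo : Clo N y ρ r C
  ne : C.Nonempty
  irr : ∀ r', 0 < r' → r' ≤ r → ∀ C', Clo N y ρ r' C' → C' ⊆ C → C'.Nonempty → C ∩ Tz N y r' ⊆ C'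

theorem GIrr.restrict {C : Set (Fin n → ℂ)} (hC : GIrr N y ρ r C) {r' : ℝ} (h0 : 0 < r') (h : r' ≤ r) : GIrr N y ρ r' (C ∩ Tz N y r') :=
  ⟨hC.clo.restrict h, hC.clo.restrict_nonempty hC.ne h0 h, fun r'' h0' h' C' hC' hs hn x hx =>
    hC.irr r'' h0' (h'.trans h) C' hC' (hs.trans inter_subset_left) hn ⟨hx.1.1, hx.2⟩⟩

theorem girr_decomp (k : ℕ) : ∀ r : ℝ, 0 < r → ∀ C : Set (Fin n → ℂ), Clo N y ρ r C →
    (∀ b ∈ Metric.ball (zm N.ζ y) r, eval b N.δ ≠ 0 → (Fb N C b).card ≤ k) → 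
    ∃ r', 0 < r' ∧ r' ≤ r ∧ ∃ S : Set (Set (Fin n → ℂ)), S.Finite ∧ (∀ C' ∈ S, GIrr N y ρ r' C') ∧ C ∩ Tz N y r' = ⋃₀ S := by
  classical
  induction k with
  | zero =>
    intro r hr C hC hk
    refine ⟨r, hr, le_rfl, ∅, finite_empty, by simp, ?_⟩
    rw [sUnion_empty, ← Set.not_nonempty_iff_eq_empty]
    intro hne
    obtain ⟨b, hb, hδ⟩ := exists_base N y hr
    have h1 := hC.fiber_nonempty (hne.mono inter_subset_left) hb hδ
    have h2 := hk b hb hδ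
    omega
  | succ k ih =>
    intro r hr C hC hk
    by_cases hne : C.Nonempty
    swap
    · refine ⟨r, hr, le_rfl, ∅, finite_empty, by simp, ?_⟩
      rw [Set.not_nonempty_iff_eq_empty] at hne
      simp [hne]
    by_cases hg : GIrr N y ρ r C
    · refine ⟨r, hr, le_rfl, {C}, finite_singleton _, by simpa using hg, ?_⟩
      rw [sUnion_singleton]
      exact inter_eq_left.2 fun x hx => (hC.sub hx).2.2.1
    have : ∃ r', 0 < r' ∧ r' ≤ r ∧ ∃ C', Clo N y ρ r' C' ∧ C' ⊆ C ∧ C'.Nonempty ∧ ¬ C ∩ Tz N y r' ⊆ C' := by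
      by_contra hcon
      push Not at hcon
      exact hg ⟨hC, hne, fun r' h1 h2 C' h3 h4 h5 => hcon r' h1 h2 C' h3 h4 h5⟩
    obtain ⟨r', hr', hrr, C1, hC1, hsub, hne1, hnot⟩ := this
    have hCr := hC.restrict hrr
    have hC1r : C1 ⊆ C ∩ Tz N y r' := fun x hx => ⟨hsub hx, (hC1.sub hx).2.2.1⟩
    have hC2 := hCr.diff hC1
    have hne2 : ((C ∩ Tz N y r') \ C1).Nonempty := Set.diff_nonempty.2 hnot
    have hcard : ∀ b ∈ Metric.ball (zm N.ζ y) r', eval b N.δ ≠ 0 → (Fb N C1 b).card + (Fb N ((C ∩ Tz N y r') \ C1) b).card ≤ k + 1 := by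
      intro b hb hδ
      refine le_trans ?_ (hk b (Metric.ball_subset_ball hrr hb) hδ)
      rw [← Finset.card_union_of_disjoint]
      · apply Finset.card_le_card
        intro x hx
        rw [Finset.mem_union, mem_Fb, mem_Fb] at hx
        rw [mem_Fb]
        rcases hx with hx | hx
        · exact ⟨hx.1, hsub hx.2⟩
        · exact ⟨hx.1, hx.2.1.1⟩
      · rw [Finset.disjoint_left]
        intro x h1 h2
        rw [mem_Fb] at h1 h2
        exact h2.2.2 h1.2
    obtain ⟨r1, a1, a2, S1, f1, g1, e1⟩ := ih r' hr' C1 hC1 (fun b hb hδ => by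
      have h1 := hcard b hb hδ
      have h2 := hC2.fiber_nonempty hne2 hb hδ
      omega)
    obtain ⟨r2, b1, b2, S2, f2, g2, e2⟩ := ih r' hr' _ hC2 (fun b hb hδ => by
      have h1 := hcard b hb hδ
      have h2 := hC1.fiber_nonempty hne1 hb hδ
      omega)
    have m0 : 0 < min r1 r2 := lt_min a1 b1
    have ml : min r1 r2 ≤ r1 := min_le_left _ _
    have mr : min r1 r2 ≤ r2 := min_le_right _ _
    refine ⟨min r1 r2, m0, ml.trans (a2.trans hrr),
      (fun C' => C' ∩ Tz N y (min r1 r2)) '' (S1 ∪ S2), (f1.union f2).image _, ?_, ?_⟩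
    · rintro _ ⟨C', hC' | hC', rfl⟩
      · exact (g1 C' hC').restrict m0 ml
      · exact (g2 C' hC').restrict m0 mr
    · rw [sUnion_image, ← iUnion₂_inter, biUnion_union, ← sUnion_eq_biUnion, ← sUnion_eq_biUnion, ← e1, ← e2]
      ext x
      constructor
      · rintro ⟨h1, h2⟩
        refine ⟨?_, h2⟩
        by_cases h : x ∈ C1
        · exact Or.inl ⟨h, Tz_mono ml h2⟩
        · exact Or.inr ⟨⟨⟨h1, Tz_mono (ml.trans a2) h2⟩, h⟩, Tz_mono mr h2⟩
      · rintro ⟨h1 | h1, h2⟩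
        · exact ⟨hsub h1.1, h2⟩
        · exact ⟨h1.1.1.1, h2⟩

end NashAux

namespace NashAux

/-- relative identity principle -/
def RelID {n : ℕ} (X W V : Set (CE n)) : Prop := ∀ A, IsAnalyticSet W A → ∀ N, IsOpen N → (X ∩ V ∩ N).Nonempty → X ∩ V ∩ N ⊆ A → X ∩ V ⊆ A

def GermID {n : ℕ} (X : Set (CE n)) (y : CE n) : Prop := ∀ W, IsOpen W → y ∈ W → ∃ V, IsOpen V ∧ y ∈ V ∧ V ⊆ W ∧ RelID X W V

theorem analytic_closed {n : ℕ} {W A : Set (CE n)} (hA : IsAnalyticSet W A) {x : CE n} (hx : x ∈ W) (hc : x ∈ closure A) : x ∈ A := by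
  obtain ⟨U, hU, hxU, -, s, hs, hAU⟩ := hA.2 x hx
  have : x ∈ A ∩ U := by
    rw [hAU]
    refine ⟨hxU, fun f hf => ?_⟩
    by_contra hne
    have h1 : ∀ᶠ x' in 𝓝 x, f x' ≠ 0 := (hs f hf x hxU).continuousAt.eventually_ne hne
    obtain ⟨x', ⟨h2, h3⟩, h4⟩ := mem_closure_iff_nhds.1 hc _ (inter_mem h1 (hU.mem_nhds hxU))
    have : x' ∈ A ∩ U := ⟨h4, h3⟩
    rw [hAU] at this
    exact h2 (this.2 f hf)
  exact this.1

variable {n : ℕ} {I : Ideal (MvPolynomial (Fin n) ℂ)} {N : NData I} {y : Fin n → ℂ} {ρ r : ℝ}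

theorem core_id {C : Set (Fin n → ℂ)} (hC : GIrr N y ρ r C) {r' : ℝ} (h0 : 0 < r') (h : r' ≤ r) {W A : Set (CE n)}
    (hW : C ∩ Tz N y r' ⊆ W) (hA : IsAnalyticSet W A) {x0 : CE n} (hx0 : x0 ∈ C ∩ Tz N y r') (hx0A : ∀ᶠ x' in 𝓝 x0, x' ∈ VI I → x' ∈ A) :
    C ∩ Tz N y r' ⊆ A := by
  have hCr := hC.clo.restrict h
  let O : Set (CE n) := {x | x ∈ C ∩ Tz N y r' ∧ ∀ᶠ x' in 𝓝 x, x' ∈ VI I → x' ∈ A}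
  have hO : Clo N y ρ r' O := by
    refine ⟨fun x hx => hCr.sub hx.1, fun x hx => ?_, fun x hx hxO => ?_⟩
    · filter_upwards [hCr.op x hx.1, eventually_eventually_nhds.2 hx.2] with x' h1 h2 h3 using ⟨h1 h3, h2⟩
    · by_cases hxC : x ∈ C ∩ Tz N y r'
      swap
      · filter_upwards [hCr.cl x hx hxC] with x' h1 h2 h3 using h1 h2 h3.1
      obtain ⟨U, hU, hxU, -, s, hs, hAU⟩ := hA.2 x (hW hxC)
      obtain ⟨r1, hr1, σ, hσ, hσU, hσx, hσu⟩ := sec_exists N hx.1 hx.2.2.2 (hU.mem_nhds hxU)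
      have hball : ∀ᶠ x' in 𝓝 x, zm N.ζ x' ∈ Metric.ball (zm N.ζ x) r1 :=
        (continuous_zm N.ζ).continuousAt.eventually (Metric.ball_mem_nhds _ hr1)
      filter_upwards [hσu, hball] with x' h1 h2 h3 h4
      apply hxO
      refine ⟨hxC, ?_⟩
      have hz : ∀ z ∈ Metric.ball (zm N.ζ x) r1, σ z ∈ A := by
        have hzz : ∀ f ∈ s, ∀ z ∈ Metric.ball (zm N.ζ x) r1, f (σ z) = 0 := by
          intro f hf
          apply eq_zero_of_open (convex_ball _ _).isPreconnected (F := fun z => f (σ z)) _ h2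
          · have hc := hσ.continuousAt h2
            have h5 : ∀ᶠ z in 𝓝 (zm N.ζ x'), σ z ∈ VI I → σ z ∈ A := hc.eventually (by rw [h1 h3]; exact h4.2)
            filter_upwards [h5, Metric.isOpen_ball.mem_nhds h2] with z h6 h7
            have : σ z ∈ A ∩ U := ⟨h6 (hσ.mem z h7), hσU z h7⟩
            rw [hAU] at this
            exact this.2 f hf
          · intro z hz
            exact (hs f hf (σ z) (hσU z hz)).comp' (hσ.analyticAt hz)
        intro z hz
        have : σ z ∈ A ∩ U := by
          rw [hAU]
          exact ⟨hσU z hz, fun f hf => hzz f hf z hz⟩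
        exact this.1
      filter_upwards [hσu, hball] with x'' k1 k2 k3
      rw [← k1 k3]
      exact hz _ k2
  have := hC.irr r' h0 h O hO (fun x hx => hx.1.1) ⟨x0, hx0, hx0A⟩
  intro x hx
  exact (this hx).2.self_of_nhds ((hC.clo.sub hx.1).1)

theorem relID_of {C X : Set (Fin n → ℂ)} (hC : GIrr N y ρ r C) {r' : ℝ} (h0 : 0 < r') (h : r' ≤ r) {W O : Set (CE n)} (hOo : IsOpen O)
    (hO : C ∩ Tz N y r' ⊆ O) (hOW : O ⊆ W) (hX : X ∩ O = closure C ∩ O) : RelID X W (O ∩ Tz N y r') := by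
  intro A hA M hM hne hsub
  obtain ⟨x1, ⟨hx1, hx1O, hx1T⟩, hx1M⟩ := hne
  have hx1c : x1 ∈ closure C := (hX.subset ⟨hx1, hx1O⟩).1
  have hop := (hOo.inter (isOpen_Tz N y r')).inter hM
  obtain ⟨x0, h1, h2⟩ := mem_closure_iff_nhds.1 hx1c _ (hop.mem_nhds ⟨⟨hx1O, hx1T⟩, hx1M⟩)
  have hCA : C ∩ Tz N y r' ⊆ A := by
    refine core_id hC h0 h (hO.trans hOW) hA (x0 := x0) ⟨h2, h1.1.2⟩ ?_
    filter_upwards [hC.clo.op x0 h2, hop.mem_nhds h1] with x' k1 k2 k3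
    refine hsub ⟨⟨?_, k2.1⟩, k2.2⟩
    exact (hX.superset ⟨subset_closure (k1 k3), k2.1.1⟩).1
  rintro x ⟨hx, hxO, hxT⟩
  have hxc : x ∈ closure C := (hX.subset ⟨hx, hxO⟩).1
  apply analytic_closed hA (hOW hxO)
  rw [mem_closure_iff_nhds]
  intro t ht
  obtain ⟨x', h1, h2⟩ := mem_closure_iff_nhds.1 hxc _ (inter_mem ht ((isOpen_Tz N y r').mem_nhds hxT))
  exact ⟨x', h1.1, hCA ⟨h2, h1.2⟩⟩

theorem germID_of {C X W0 : Set (Fin n → ℂ)} (hr : 0 < r)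
    (htube : ∀ ε > 0, ∃ r > 0, ∀ x ∈ VI I, x ∈ Metric.closedBall y ρ → zm N.ζ x ∈ Metric.ball (zm N.ζ y) r → x ∈ Metric.ball y ε)
    (hC : GIrr N y ρ r C) (hW0 : IsOpen W0) (hy : y ∈ W0) (hX : X ∩ W0 = closure C ∩ W0) :
    ∀ W, IsOpen W → y ∈ W → ∃ V, IsOpen V ∧ y ∈ V ∧ V ⊆ W ∧ RelID X W V ∧ (C ∩ V).Nonempty := by
  intro W hW hyW
  obtain ⟨ε, hε, hb⟩ := Metric.isOpen_iff.1 (hW.inter hW0) y ⟨hyW, hy⟩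
  obtain ⟨r1, hr1, ht⟩ := htube ε hε
  have m0 : 0 < min r1 r := lt_min hr1 hr
  have hsub : C ∩ Tz N y (min r1 r) ⊆ Metric.ball y ε := by
    intro x hx
    obtain ⟨h1, h2, h3, h4⟩ := hC.clo.sub hx.1
    exact ht x h1 h2 (Tz_mono (min_le_left _ _) hx.2)
  refine ⟨Metric.ball y ε ∩ Tz N y (min r1 r), Metric.isOpen_ball.inter (isOpen_Tz _ _ _), ⟨Metric.mem_ball_self hε, mem_Tz_self m0⟩,
    fun x hx => (hb hx.1).1, relID_of hC m0 (min_le_right _ _) Metric.isOpen_ball hsub (fun x hx => (hb hx).1) ?_, ?_⟩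
  · ext x
    constructor
    · rintro ⟨h1, h2⟩; exact ⟨(hX.subset ⟨h1, (hb h2).2⟩).1, h2⟩
    · rintro ⟨h1, h2⟩; exact ⟨(hX.superset ⟨h1, (hb h2).2⟩).1, h2⟩
  · obtain ⟨x, hx⟩ := hC.clo.restrict_nonempty hC.ne m0 (min_le_right _ _)
    exact ⟨x, hx.1, hsub hx, hx.2⟩

end NashAux

namespace NashAux

/-- linear forms on `ℂ^n` of Vandermonde type -/
noncomputable def hl {n : ℕ} (c : ℕ) (v : Fin n → ℂ) : ℂ := ∑ i : Fin n, (c : ℂ) ^ (i : ℕ) * v i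

theorem continuous_hl {n : ℕ} (c : ℕ) : Continuous (hl (n := n) c) := by
  unfold hl; fun_prop

theorem hl_zero {n : ℕ} (c : ℕ) : hl (n := n) c 0 = 0 := by simp [hl]

theorem hl_pos {n k L : ℕ} (hL : k * n < L) (v : Fin k → Fin n → ℂ) (hv : ∀ i, v i ≠ 0) :
    ∃ c < L, ∏ i, hl c (v i) ≠ 0 := by
  classical
  let p : Fin k → Polynomial ℂ := fun i => ∑ j : Fin n, Polynomial.C (v i j) * Polynomial.X ^ (j : ℕ)
  have hpe : ∀ i c, (p i).eval ((c : ℕ) : ℂ) = hl c (v i) := by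
    intro i c
    simp only [p, hl, Polynomial.eval_finset_sum]
    refine Finset.sum_congr rfl fun j _ => ?_
    rw [Polynomial.eval_mul, Polynomial.eval_C, Polynomial.eval_pow, Polynomial.eval_X, mul_comm]
  have hcoef : ∀ i (j : Fin n), (p i).coeff j = v i j := by
    intro i j
    simp only [p, Polynomial.finset_sum_coeff, Polynomial.coeff_C_mul, Polynomial.coeff_X_pow]
    rw [Finset.sum_eq_single j]
    · simp
    · intro b _ hb
      have : ¬ ((j : ℕ) = b) := fun h => hb (Fin.ext h.symm)
      simp [this]
    · simp
  have hp0 : ∀ i, p i ≠ 0 := by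
    intro i h
    apply hv i
    funext j
    rw [← hcoef, h]; simp
  have hdeg : ∀ i, (p i).natDegree ≤ n := by
    intro i
    apply Polynomial.natDegree_sum_le_of_forall_le
    intro j _
    exact (Polynomial.natDegree_C_mul_X_pow_le _ _).trans j.2.le
  have hP0 : ∏ i, p i ≠ 0 := Finset.prod_ne_zero_iff.2 fun i _ => hp0 i
  have hPd : (∏ i, p i).natDegree ≤ k * n := by
    refine (Polynomial.natDegree_prod_le _ _).trans ?_
    refine (Finset.sum_le_sum fun i _ => hdeg i).trans ?_
    simp
  by_contra! hcon
  have h1 : (Finset.range L).image (fun c : ℕ => (c : ℂ)) ⊆ (∏ i, p i).roots.toFinset := by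
    intro t ht
    obtain ⟨c, hc, rfl⟩ := Finset.mem_image.1 ht
    rw [Multiset.mem_toFinset, Polynomial.mem_roots hP0, Polynomial.IsRoot.def, Polynomial.eval_prod]
    simp only [hpe]
    exact hcon c (Finset.mem_range.1 hc)
  have h2 := Finset.card_le_card h1
  rw [Finset.card_image_of_injective _ Nat.cast_injective, Finset.card_range] at h2
  have h3 := (Multiset.toFinset_card_le (∏ i, p i).roots).trans (Polynomial.card_roots' _)
  omega

theorem hl_min {n k L : ℕ} (hL : k * n < L) {ε : ℝ} (hε : 0 < ε) (M : ℝ) :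
    ∃ η > 0, ∀ (s : Finset (Fin n → ℂ)) (w : (Fin n → ℂ) → (Fin n → ℂ)), s.card = k → (∀ p ∈ s, ε ≤ ‖w p‖ ∧ ‖w p‖ ≤ M) →
      η ≤ ∑ c ∈ Finset.range L, ‖∏ p ∈ s, hl c (w p)‖ := by
  classical
  let K : Set (Fin k → Fin n → ℂ) := {v | ∀ i, ε ≤ ‖v i‖ ∧ ‖v i‖ ≤ M}
  have hKc : IsCompact K := by
    have : K ⊆ Set.pi univ (fun _ => Metric.closedBall (0 : Fin n → ℂ) M) := by
      intro v hv i _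
      simpa using (hv i).2
    refine (isCompact_univ_pi fun _ => isCompact_closedBall _ _).of_isClosed_subset ?_ this
    have e : K = ⋂ i, {v : Fin k → Fin n → ℂ | ε ≤ ‖v i‖ ∧ ‖v i‖ ≤ M} := by ext; simp [K]
    rw [e]
    refine isClosed_iInter fun i => IsClosed.and ?_ ?_
    · exact isClosed_le continuous_const (by fun_prop)
    · exact isClosed_le (by fun_prop) continuous_const
  have hcont : Continuous (fun v : Fin k → Fin n → ℂ => ∑ c ∈ Finset.range L, ‖∏ i, hl c (v i)‖) := by
    refine continuous_finset_sum _ fun c _ => Continuous.norm ?_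
    exact continuous_finset_prod _ fun i _ => (continuous_hl c).comp (continuous_apply i)
  obtain ⟨η, hη, h⟩ := hKc.exists_forall_le' hcont.continuousOn (a := 0) (by
    intro v hv
    obtain ⟨c, hc, hne⟩ := hl_pos hL v (fun i h0 => by
      have := (hv i).1
      rw [h0, norm_zero] at this
      linarith)
    exact Finset.sum_pos' (fun _ _ => norm_nonneg _) ⟨c, Finset.mem_range.2 hc, norm_pos_iff.2 hne⟩)
  refine ⟨η, hη, fun s w hs hw => ?_⟩
  let e := s.equivFinOfCardEq hs
  have := h (fun i => w (e.symm i)) (fun i => hw _ (e.symm i).2)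
  refine this.trans (le_of_eq ?_)
  refine Finset.sum_congr rfl fun c _ => ?_
  congr 1
  rw [← Finset.prod_coe_sort s]
  exact Fintype.prod_equiv e.symm _ _ fun i => rfl

theorem intOn_pull {n d : ℕ} (ζ : Fin d → MvPolynomial (Fin n) ℂ) {D : Set (Fin d → ℂ)} {f : (Fin d → ℂ) → ℂ} (h : IntOn D f) :
    IntOn {x | zm ζ x ∈ D} (fun x => f (zm ζ x)) := by
  obtain ⟨p, hp, h⟩ := h
  refine ⟨p.map (aeval ζ : MvPolynomial (Fin d) ℂ →ₐ[ℂ] _).toRingHom, hp.map _, fun x hx => ?_⟩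
  rw [← h _ hx]
  simp only [ev2, Polynomial.map_map]
  congr 2
  exact RingHom.ext fun q => (eval_zm ζ x q).symm

end NashAux

namespace NashAux

variable {n : ℕ} {I : Ideal (MvPolynomial (Fin n) ℂ)} {N : NData I} {y : Fin n → ℂ} {ρ r : ℝ}

theorem exists_min_rad (L : ℕ) (f : ℕ → ℝ) (hf : ∀ c, 0 < f c) : ∃ r0 > 0, ∀ c < L, r0 ≤ f c := by
  induction L with
  | zero => exact ⟨1, one_pos, by simp⟩
  | succ k ih =>
    obtain ⟨r0, h0, h⟩ := ih
    refine ⟨min r0 (f k), lt_min h0 (hf k), fun c hc => ?_⟩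
    rcases Nat.lt_succ_iff_lt_or_eq.1 hc with hc | rfl
    · exact (min_le_left _ _).trans (h c hc)
    · exact min_le_right _ _

noncomputable def Ff (N : NData I) (C : Set (Fin n → ℂ)) (c : ℕ) (x : Fin n → ℂ) : ℂ := ∏ p ∈ Fb N C (zm N.ζ x), hl c (x - p)

theorem norm_hl_le (c : ℕ) (v : Fin n → ℂ) : ‖hl c v‖ ≤ (∑ i : Fin n, (c : ℝ) ^ (i : ℕ)) * ‖v‖ := by
  unfold hl
  refine (norm_sum_le _ _).trans ?_
  rw [Finset.sum_mul]
  refine Finset.sum_le_sum fun i _ => ?_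
  rw [norm_mul, norm_pow, Complex.norm_natCast]
  gcongr
  exact norm_le_pi_norm v i

theorem Ff_bound {C : Set (Fin n → ℂ)} (hC : Clo N y ρ r C) (c : ℕ) : ∃ M, ∀ x ∈ Metric.ball y ρ, eval (zm N.ζ x) N.δ ≠ 0 → ‖Ff N C c x‖ ≤ M := by
  set B : ℝ := max 1 ((∑ i : Fin n, (c : ℝ) ^ (i : ℕ)) * (2 * ρ)) with hB
  refine ⟨B ^ N.P.natDegree, fun x hx hδ => ?_⟩
  have hB1 : 1 ≤ B := le_max_left _ _
  unfold Ff
  rw [norm_prod]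
  have h1 : ∏ p ∈ Fb N C (zm N.ζ x), ‖hl c (x - p)‖ ≤ ∏ p ∈ Fb N C (zm N.ζ x), B := by
    refine Finset.prod_le_prod (fun _ _ => norm_nonneg _) fun p hp => ?_
    refine (norm_hl_le c _).trans (le_trans ?_ (le_max_right _ _))
    gcongr
    have h2 := (hC.sub ((mem_Fb _ _ _ _).1 hp).2).2.1
    rw [← dist_eq_norm]
    have := dist_triangle_right x p y
    rw [Metric.mem_ball] at hx
    rw [Metric.mem_closedBall] at h2
    linarith
  refine h1.trans ?_
  rw [Finset.prod_const]
  exact pow_le_pow_right₀ hB1 (fiber_card N _ hδ _ fun p hp => ((mem_Fb _ _ _ _).1 hp).1)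

theorem Ff_local {C : Set (Fin n → ℂ)} (hC : Clo N y ρ r C) (c : ℕ) {x0 : Fin n → ℂ} (hx : x0 ∈ Tz N y r) (hδ : eval (zm N.ζ x0) N.δ ≠ 0) :
    AnalyticAt ℂ (Ff N C c) x0 ∧ ∃ O, IsOpen O ∧ x0 ∈ O ∧ IntOn O (Ff N C c) := by
  classical
  obtain ⟨r1, hr1, hsub, σ, hσ, H⟩ := even_cover hC (b := zm N.ζ x0) hx hδ
  set D := Metric.ball (zm N.ζ x0) r1 with hD
  have hloc : ∀ x, zm N.ζ x ∈ D → Ff N C c x = ∏ p ∈ Fb N C (zm N.ζ x0), ∑ i : Fin n, (c : ℂ) ^ (i : ℕ) * (x i - σ p (zm N.ζ x) i) := by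
    intro x hx
    obtain ⟨-, -, h1, h2⟩ := H _ hx
    unfold Ff
    rw [h2, Finset.prod_image h1]
    rfl
  have hO : IsOpen {x | zm N.ζ x ∈ D} := Metric.isOpen_ball.preimage (continuous_zm N.ζ)
  have hx0 : x0 ∈ {x | zm N.ζ x ∈ D} := Metric.mem_ball_self hr1
  have hid : ∀ z : Fin n → ℂ, ∀ i, AnalyticAt ℂ (fun v : Fin n → ℂ => v i) z := fun z i =>
    (ContinuousLinearMap.proj (R := ℂ) (φ := fun _ : Fin n => ℂ) i).analyticAt _
  have hz : AnalyticAt ℂ (zm N.ζ) x0 := analyticAt_pi_iff.2 fun i => analyticAt_eval_comp _ (hid x0)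
  constructor
  · have : AnalyticAt ℂ (fun x => ∏ p ∈ Fb N C (zm N.ζ x0), ∑ i : Fin n, (c : ℂ) ^ (i : ℕ) * (x i - σ p (zm N.ζ x) i)) x0 := by
      refine Finset.analyticAt_fun_prod _ fun p hp => Finset.analyticAt_fun_sum _ fun i _ => analyticAt_const.mul ((hid x0 i).sub ?_)
      exact ((hσ p hp).ana i _ hx0).comp (f := zm N.ζ) hz
    refine this.congr ?_
    filter_upwards [hO.mem_nhds hx0] with x hx using (hloc x hx).symm
  · refine ⟨_, hO, hx0, IntOn.congr ?_ fun x hx => (hloc x hx).symm⟩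
    refine IntOn.prod _ fun p hp => IntOn.sum _ fun i _ => (intOn_const _ _).mul (IntOn.sub ?_ (intOn_pull N.ζ ((hσ p hp).intOn i)))
    exact (intOn_poly _ (X i)).congr (by simp)

theorem nash_clo {C : Set (Fin n → ℂ)} (hr : 0 < r) (hρ : 0 < ρ) (hC : Clo N y ρ r C) :
    ∃ W0, IsOpen W0 ∧ y ∈ W0 ∧ ∃ X, IsNashSet W0 X ∧ X ∩ W0 = closure C ∩ W0 := by
  classical
  set q := aeval N.ζ N.δ with hq
  have hq0 : q ≠ 0 := fun h => N.inj _ N.δ_ne (by rw [← hq, h]; exact I.zero_mem)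
  have hqe : ∀ x, eval x q = eval (zm N.ζ x) N.δ := fun x => (eval_zm N.ζ x N.δ).symm
  have hex : ∀ c, ∃ ρ' > 0, Metric.ball y ρ' ⊆ Metric.ball y ρ ∩ Tz N y r ∧ ∃ G : (Fin n → ℂ) → ℂ, AnalyticOnNhd ℂ G (Metric.ball y ρ') ∧
      ∀ x ∈ Metric.ball y ρ', eval x q ≠ 0 → G x = Ff N C c x := by
    intro c
    obtain ⟨M, hM⟩ := Ff_bound hC c
    exact riemann_ext hq0 (Metric.isOpen_ball.inter (isOpen_Tz N y r)) ⟨Metric.mem_ball_self hρ, mem_Tz_self hr⟩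
      (fun x hx => (Ff_local hC c hx.1.2 (hqe x ▸ hx.2)).1) (fun x hx h => hM x hx.1 (hqe x ▸ h))
  choose R hR hRs G hGa hG using hex
  obtain ⟨b0, hb0, hb0δ⟩ := exists_base N y hr
  set k := (Fb N C b0).card with hk
  set L := k * n + 1 with hL
  obtain ⟨r0, hr0, hr0L⟩ := exists_min_rad L R hR
  have hr0' : ∀ c < L, Metric.ball y r0 ⊆ Metric.ball y (R c) := fun c hc => Metric.ball_subset_ball (hr0L c hc)
  have hr0s : Metric.ball y r0 ⊆ Metric.ball y ρ ∩ Tz N y r := (hr0' 0 (by omega)).trans (hRs 0)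
  have hdense := dense_ne hq0
  have hid : ∀ z : Fin n → ℂ, ∀ i, AnalyticAt ℂ (fun v : Fin n → ℂ => v i) z := fun z i =>
    (ContinuousLinearMap.proj (R := ℂ) (φ := fun _ : Fin n => ℂ) i).analyticAt _
  have hnash : ∀ c < L, IsNashFn (Metric.ball y r0) (G c) := by
    intro c hc
    rw [isNashFn_iff]
    refine ⟨(hGa c).mono (hr0' c hc), fun x hx => ⟨_, Metric.isOpen_ball, hx, subset_rfl, ?_⟩⟩
    obtain ⟨x0, hx0, hx0q⟩ := hdense.exists_mem_open Metric.isOpen_ball ⟨y, Metric.mem_ball_self hr0⟩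
    obtain ⟨-, O, hO, hxO, p, hp, hpO⟩ := Ff_local hC c (hr0s hx0q).2 (hqe x0 ▸ hx0)
    refine ⟨p, hp.ne_zero, ?_⟩
    refine eq_zero_of_open (F := fun x => ev2 p x (G c x)) (convex_ball y r0).isPreconnected ?_ hx0q ?_
    · intro x hx
      exact analyticAt_ev2_comp p (hid x) (hGa c x (hr0' c hc hx))
    · filter_upwards [hO.mem_nhds hxO, Metric.isOpen_ball.mem_nhds hx0q, (continuous_eval_poly q).continuousAt.eventually_ne hx0] with x h1 h2 h3
      rw [hG c x (hr0' c hc h2) h3]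
      exact hpO x h1
  have hset : closure C ∩ Metric.ball y r0 = {x ∈ Metric.ball y r0 | ∀ c < L, G c x = 0} := by
    ext x
    constructor
    · rintro ⟨hxC, hx⟩
      refine ⟨hx, fun c hc => ?_⟩
      have hcl : ContinuousAt (G c) x := (hGa c x (hr0' c hc hx)).continuousAt
      by_contra hne
      obtain ⟨x', ⟨h1, h2⟩, h3⟩ := mem_closure_iff_nhds.1 hxC _ (inter_mem (hcl.eventually_ne hne) (Metric.isOpen_ball.mem_nhds hx))
      apply h1
      have h4 := hC.sub h3
      rw [hG c x' (hr0' c hc h2) (by rw [hqe]; exact h4.2.2.2)]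
      exact Finset.prod_eq_zero ((mem_Fb _ _ _ _).2 ⟨⟨h4.1, rfl⟩, h3⟩) (by rw [sub_self, hl_zero])
    · rintro ⟨hx, hz⟩
      refine ⟨?_, hx⟩
      by_contra hxC
      obtain ⟨ε, hε, hεb⟩ := Metric.isOpen_iff.1 isClosed_closure.isOpen_compl x hxC
      obtain ⟨η, hη, hmin⟩ := hl_min (n := n) (k := k) (L := L) (by omega) (half_pos hε) (2 * ρ)
      have hcs : ContinuousAt (fun x => ∑ c ∈ Finset.range L, ‖G c x‖) x :=
        tendsto_finset_sum _ fun c hc => ((hGa c x (hr0' c (Finset.mem_range.1 hc) hx)).continuousAt).norm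
      have hlt : ∀ᶠ x' in 𝓝 x, ∑ c ∈ Finset.range L, ‖G c x'‖ < η := by
        apply hcs.eventually_lt continuousAt_const
        rw [Finset.sum_eq_zero]
        · exact hη
        · intro c hc
          rw [hz c (Finset.mem_range.1 hc), norm_zero]
      obtain ⟨V, hVs, hVo, hxV⟩ := mem_nhds_iff.1 (inter_mem hlt (inter_mem (Metric.isOpen_ball.mem_nhds hx) (Metric.ball_mem_nhds x (half_pos hε))))
      obtain ⟨x', hx'q, hx'V⟩ := hdense.exists_mem_open hVo ⟨x, hxV⟩
      obtain ⟨h1, h2, h3⟩ := hVs hx'V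
      have h4 := hmin (Fb N C (zm N.ζ x')) (fun p => x' - p) (card_const hC (hr0s h2).2 (hqe x' ▸ hx'q) hb0 hb0δ) (by
        intro p hp
        have hpC := ((mem_Fb _ _ _ _).1 hp).2
        have hpB := (hC.sub hpC).2.1
        have h2' := (hr0s h2).1
        have hxp : ¬ dist p x < ε := fun h => hεb h (subset_closure hpC)
        rw [Metric.mem_closedBall] at hpB
        rw [Metric.mem_ball] at h2'
        replace h3 : dist x' x < ε / 2 := h3
        rw [← dist_eq_norm]
        have t1 := dist_triangle_right x' p y
        have t2 := dist_triangle_left p x x'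
        constructor <;> linarith)
      refine absurd h1 (not_lt.2 (h4.trans (le_of_eq ?_)))
      refine Finset.sum_congr rfl fun c hc => ?_
      rw [hG c x' (hr0' c (Finset.mem_range.1 hc) h2) hx'q]
      rfl
  refine ⟨Metric.ball y r0, Metric.isOpen_ball, Metric.mem_ball_self hr0, closure C ∩ Metric.ball y r0, ⟨inter_subset_right, fun z hz => ?_⟩, by
    rw [inter_assoc, inter_self]⟩
  refine ⟨_, Metric.isOpen_ball, hz, subset_rfl, (Finset.range L).image G, ?_, ?_⟩
  · intro f hf
    obtain ⟨c, hc, rfl⟩ := Finset.mem_image.1 hf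
    exact hnash c (Finset.mem_range.1 hc)
  · rw [inter_assoc, inter_self, hset]
    ext x
    simp

end NashAux

namespace NashAux

/-- common abstraction of analytic and Nash sets -/
def LocSet {N : ℕ} (P : Set (CE N) → (CE N → ℂ) → Prop) (Ω X : Set (CE N)) : Prop :=
  X ⊆ Ω ∧ ∀ z ∈ Ω, ∃ U : Set (CE N), IsOpen U ∧ z ∈ U ∧ U ⊆ Ω ∧
    ∃ s : Finset (CE N → ℂ), (∀ f ∈ s, P U f) ∧ X ∩ U = {w ∈ U | ∀ f ∈ s, f w = 0}

structure Good {N : ℕ} (P : Set (CE N) → (CE N → ℂ) → Prop) : Prop where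
  mono : ∀ {U V f}, P U f → IsOpen V → V ⊆ U → P V f
  mul : ∀ {U f g}, P U f → P U g → P U (fun x => f x * g x)
  one : ∀ {U}, IsOpen U → P U (fun _ => 1)

theorem good_an {N : ℕ} : Good (fun U (f : CE N → ℂ) => AnalyticOnNhd ℂ f U) :=
  ⟨fun h _ h' => h.mono h', fun h h' => h.mul h', fun _ => analyticOnNhd_const⟩

theorem good_nash {N : ℕ} : Good (fun U (f : CE N → ℂ) => IsNashFn U f) :=
  ⟨fun h h1 h' => isNashFn_mono h h1 h', fun h h' => isNashFn_mul h h', fun h => by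
    simpa using isNashFn_poly h (1 : MvPolynomial (Fin N) ℂ)⟩

section
variable {N : ℕ} {P : Set (CE N) → (CE N → ℂ) → Prop} {Ω X Y : Set (CE N)}

theorem LocSet.restrict (hP : Good P) (h : LocSet P Ω X) {V : Set (CE N)} (hV : IsOpen V) (hVO : V ⊆ Ω) : LocSet P V (X ∩ V) := by
  refine ⟨inter_subset_right, fun z hz => ?_⟩
  obtain ⟨U, hU, hzU, hUO, s, hs, e⟩ := h.2 z (hVO hz)
  refine ⟨U ∩ V, hU.inter hV, ⟨hzU, hz⟩, inter_subset_right, s, fun f hf => hP.mono (hs f hf) (hU.inter hV) inter_subset_left, ?_⟩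
  ext w
  have := Set.ext_iff.1 e w
  simp only [mem_inter_iff, mem_setOf_eq] at *
  tauto

theorem LocSet.of_local (h0 : X ⊆ Ω) (h : ∀ y ∈ Ω, ∃ V, IsOpen V ∧ y ∈ V ∧ V ⊆ Ω ∧ LocSet P V (X ∩ V)) : LocSet P Ω X := by
  refine ⟨h0, fun z hz => ?_⟩
  obtain ⟨V, hV, hzV, hVO, -, h2⟩ := h z hz
  obtain ⟨U, hU, hzU, hUV, s, hs, e⟩ := h2 z hzV
  refine ⟨U, hU, hzU, hUV.trans hVO, s, hs, ?_⟩
  rw [← e, inter_assoc, inter_eq_self_of_subset_right hUV]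

theorem LocSet.inter (hP : Good P) (hX : LocSet P Ω X) (hY : LocSet P Ω Y) : LocSet P Ω (X ∩ Y) := by
  classical
  refine ⟨fun x hx => hX.1 hx.1, fun z hz => ?_⟩
  obtain ⟨U, hU, hzU, hUO, s, hs, e⟩ := hX.2 z hz
  obtain ⟨U', hU', hzU', hUO', s', hs', e'⟩ := hY.2 z hz
  refine ⟨U ∩ U', hU.inter hU', ⟨hzU, hzU'⟩, fun x hx => hUO hx.1, s ∪ s', fun f hf => ?_, ?_⟩
  · rcases Finset.mem_union.1 hf with hf | hf
    · exact hP.mono (hs f hf) (hU.inter hU') inter_subset_left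
    · exact hP.mono (hs' f hf) (hU.inter hU') inter_subset_right
  · ext w
    have h1 := Set.ext_iff.1 e w
    have h2 := Set.ext_iff.1 e' w
    simp only [mem_inter_iff, mem_setOf_eq, Finset.mem_union] at *
    constructor
    · rintro ⟨⟨a, b⟩, c, d⟩
      refine ⟨⟨c, d⟩, ?_⟩
      rintro f (hf | hf)
      · exact (h1.1 ⟨a, c⟩).2 f hf
      · exact (h2.1 ⟨b, d⟩).2 f hf
    · rintro ⟨⟨a, b⟩, c⟩
      exact ⟨⟨(h1.2 ⟨a, fun f hf => c f (Or.inl hf)⟩).1, (h2.2 ⟨b, fun f hf => c f (Or.inr hf)⟩).1⟩, a, b⟩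

theorem LocSet.union (hP : Good P) (hX : LocSet P Ω X) (hY : LocSet P Ω Y) : LocSet P Ω (X ∪ Y) := by
  classical
  refine ⟨union_subset hX.1 hY.1, fun z hz => ?_⟩
  obtain ⟨U, hU, hzU, hUO, s, hs, e⟩ := hX.2 z hz
  obtain ⟨U', hU', hzU', hUO', s', hs', e'⟩ := hY.2 z hz
  refine ⟨U ∩ U', hU.inter hU', ⟨hzU, hzU'⟩, fun x hx => hUO hx.1,
    (s ×ˢ s').image (fun p => fun x => p.1 x * p.2 x), fun f hf => ?_, ?_⟩
  · obtain ⟨p, hp, rfl⟩ := Finset.mem_image.1 hf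
    rw [Finset.mem_product] at hp
    exact hP.mul (hP.mono (hs _ hp.1) (hU.inter hU') inter_subset_left) (hP.mono (hs' _ hp.2) (hU.inter hU') inter_subset_right)
  · ext w
    have h1 := Set.ext_iff.1 e w
    have h2 := Set.ext_iff.1 e' w
    simp only [mem_inter_iff, mem_union, mem_setOf_eq, Finset.mem_image, Finset.mem_product] at *
    constructor
    · rintro ⟨a | a, b, c⟩
      · refine ⟨⟨b, c⟩, ?_⟩
        rintro f ⟨p, hp, rfl⟩
        simp [(h1.1 ⟨a, b⟩).2 _ hp.1]
      · refine ⟨⟨b, c⟩, ?_⟩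
        rintro f ⟨p, hp, rfl⟩
        simp [(h2.1 ⟨a, c⟩).2 _ hp.2]
    · rintro ⟨⟨a, b⟩, c⟩
      refine ⟨?_, a, b⟩
      by_cases hw : ∀ f ∈ s, f w = 0
      · exact Or.inl (h1.2 ⟨a, hw⟩).1
      · push Not at hw
        obtain ⟨f, hf, hfw⟩ := hw
        refine Or.inr (h2.2 ⟨b, fun g hg => ?_⟩).1
        exact (mul_eq_zero.1 (c _ ⟨(f, g), ⟨hf, hg⟩, rfl⟩)).resolve_left hfw

theorem LocSet.empty (hP : Good P) (hΩ : IsOpen Ω) : LocSet P Ω ∅ :=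
  ⟨empty_subset _, fun z hz => ⟨Ω, hΩ, hz, subset_rfl, {fun _ => 1}, by simpa using hP.one hΩ, by simp⟩⟩

theorem LocSet.full (hΩ : IsOpen Ω) : LocSet P Ω Ω :=
  ⟨subset_rfl, fun z hz => ⟨Ω, hΩ, hz, subset_rfl, ∅, by simp, by simp⟩⟩

theorem LocSet.sUnion (hP : Good P) (hΩ : IsOpen Ω) {S : Set (Set (CE N))} (hS : S.Finite) (h : ∀ X ∈ S, LocSet P Ω X) : LocSet P Ω (⋃₀ S) := by
  induction S, hS using Set.Finite.induction_on with
  | empty => simpa using LocSet.empty hP hΩ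
  | @insert a S _ _ ih =>
    rw [sUnion_insert]
    exact (h a (mem_insert _ _)).union hP (ih fun X hX => h X (mem_insert_of_mem _ hX))

theorem LocSet.zero (hΩ : IsOpen Ω) {f : CE N → ℂ} (hf : P Ω f) : LocSet P Ω {x ∈ Ω | f x = 0} :=
  ⟨fun x hx => hx.1, fun z hz => ⟨Ω, hΩ, hz, subset_rfl, {f}, by simpa using hf, by ext; simp; tauto⟩⟩

theorem nash_analytic (h : IsNashSet Ω X) : IsAnalyticSet Ω X := by
  refine ⟨h.1, fun z hz => ?_⟩
  obtain ⟨U, hU, hzU, hUO, s, hs, e⟩ := h.2 z hz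
  exact ⟨U, hU, hzU, hUO, s, fun f hf => (hs f hf).1, e⟩

theorem nash_alg (hΩ : IsOpen Ω) (hY : IsAlgebraicSet Y) : IsNashSet Ω (Y ∩ Ω) := by
  classical
  obtain ⟨s, rfl⟩ := hY
  refine ⟨inter_subset_right, fun z hz => ⟨Ω, hΩ, hz, subset_rfl, s.image (fun p => fun x => eval x p), ?_, ?_⟩⟩
  · intro f hf
    obtain ⟨p, -, rfl⟩ := Finset.mem_image.1 hf
    exact isNashFn_poly hΩ p
  · ext w; simp; tauto

theorem VI_alg {n : ℕ} (I : Ideal (MvPolynomial (Fin n) ℂ)) : IsAlgebraicSet (VI I) := by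
  obtain ⟨s, hs⟩ := (IsNoetherian.noetherian I : I.FG)
  refine ⟨s, ?_⟩
  ext x
  constructor
  · intro h p hp
    exact h p (hs ▸ Submodule.subset_span hp)
  · intro h p hp
    have : I ≤ RingHom.ker (eval x) := by
      rw [← hs]
      exact Submodule.span_le.2 fun p hp => h p hp
    exact this hp
end

end NashAux

namespace NashAux

/-- a Nash function germ either vanishes on `X` or its zero set on `X` lies in a proper subvariety -/
def Dich {n : ℕ} (I : Ideal (MvPolynomial (Fin n) ℂ)) (X : Set (CE n)) (y : CE n) : Prop :=
  ∀ U f, y ∈ U → IsNashFn U f → ∃ V, IsOpen V ∧ y ∈ V ∧ ((∀ x ∈ X ∩ V, f x = 0) ∨ ∃ q, q ∉ I ∧ ∀ x ∈ X ∩ V, f x = 0 → eval x q = 0)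

section
variable {n : ℕ} {I : Ideal (MvPolynomial (Fin n) ℂ)} {N : NData I} {y : Fin n → ℂ} {ρ r : ℝ}

theorem dich_of {C X W0 : Set (Fin n → ℂ)} (hr : 0 < r)
    (htube : ∀ ε > 0, ∃ r > 0, ∀ x ∈ VI I, x ∈ Metric.closedBall y ρ → zm N.ζ x ∈ Metric.ball (zm N.ζ y) r → x ∈ Metric.ball y ε)
    (hC : GIrr N y ρ r C) (hW0 : IsOpen W0) (hy : y ∈ W0) (hX : X ∩ W0 = closure C ∩ W0) : Dich I X y := by
  intro U f hyU hf
  rw [isNashFn_iff] at hf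
  obtain ⟨V1, hV1, hyV1, hV1U, hfa⟩ := hf.2 y hyU
  have hWo := hV1.inter hW0
  obtain ⟨V, hV, hyV, hVW, hid, x0, hx0C, hx0V⟩ := germID_of hr htube hC hW0 hy hX (V1 ∩ W0) hWo ⟨hyV1, hy⟩
  refine ⟨V, hV, hyV, ?_⟩
  have hx0R := hC.clo.sub hx0C
  obtain ⟨r1, hr1, σ, hσ, hσO, hσ0, hσu⟩ := sec_exists N hx0R.1 hx0R.2.2.2 (inter_mem (hC.clo.op x0 hx0C) (hV.mem_nhds hx0V))
  have hfW : AnalyticOnNhd ℂ f (V1 ∩ W0) := hf.1.mono fun x hx => hV1U hx.1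
  obtain ⟨ha, hal⟩ := ac_lemma Metric.isOpen_ball (convex_ball (zm N.ζ x0) r1).isPreconnected ⟨_, Metric.mem_ball_self hr1⟩ hσ.ana hσ.intOn
    hWo (fun z hz => hVW (hσO z hz).2) hfW (hfa.mono inter_subset_left)
  -- a small neighbourhood on which points of `X` are on the section
  have hx0X : x0 ∈ X := (hX.superset ⟨subset_closure hx0C, (hVW hx0V).2⟩).1
  have hXVI : ∀ x ∈ X ∩ W0, x ∈ VI I := fun x hx => by
    have h1 := (hX.subset hx).1
    exact closure_minimal (fun x hx => (hC.clo.sub hx).1) (isClosed_VI I) h1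
  obtain ⟨M, hMs, hMo, hx0M⟩ := mem_nhds_iff.1 (inter_mem hσu ((continuous_zm N.ζ).continuousAt.preimage_mem_nhds (Metric.ball_mem_nhds _ hr1)))
  have hsec : ∀ x ∈ X ∩ V ∩ M, zm N.ζ x ∈ Metric.ball (zm N.ζ x0) r1 ∧ σ (zm N.ζ x) = x := fun x hx =>
    ⟨(hMs hx.2).2, (hMs hx.2).1 (hXVI x ⟨hx.1.1, (hVW hx.1.2).2⟩)⟩
  have hne : (X ∩ V ∩ M).Nonempty := ⟨x0, ⟨hx0X, hx0V⟩, hx0M⟩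
  by_cases h0 : ∃ z ∈ Metric.ball (zm N.ζ x0) r1, f (σ z) ≠ 0
  · right
    obtain ⟨Q, hQ0, hQ⟩ := algOn_const_ne Metric.isOpen_ball (convex_ball (zm N.ζ x0) r1).isPreconnected ha hal h0
    have hid' : ∀ z : Fin n → ℂ, ∀ i, AnalyticAt ℂ (fun v : Fin n → ℂ => v i) z := fun z i =>
      (ContinuousLinearMap.proj (R := ℂ) (φ := fun _ : Fin n => ℂ) i).analyticAt _
    have hA : IsAnalyticSet (V1 ∩ W0) {x ∈ V1 ∩ W0 | ev2 Q (zm N.ζ x) (f x) = 0} :=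
      LocSet.zero (P := fun U (f : CE n → ℂ) => AnalyticOnNhd ℂ f U) hWo (fun x hx => analyticAt_ev2_comp Q (fun i => analyticAt_eval_comp _ (hid' x)) (hfW x hx))
    have := hid _ hA M hMo hne (fun x hx => ⟨hVW hx.1.2, by
      obtain ⟨h1, h2⟩ := hsec x hx
      have := hQ _ h1
      rwa [h2] at this⟩)
    refine ⟨aeval N.ζ (Q.coeff 0), N.inj _ hQ0, fun x hx hfx => ?_⟩
    have h3 := (this hx).2
    rw [hfx, ev2_eq_eval₂, Polynomial.eval₂_at_zero, eval_zm] at h3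
    exact h3
  · left
    push Not at h0
    have hA : IsAnalyticSet (V1 ∩ W0) {x ∈ V1 ∩ W0 | f x = 0} :=
      LocSet.zero (P := fun U (f : CE n → ℂ) => AnalyticOnNhd ℂ f U) hWo hfW
    have := hid _ hA M hMo hne (fun x hx => ⟨hVW hx.1.2, by
      obtain ⟨h1, h2⟩ := hsec x hx
      have := h0 _ h1
      rwa [h2] at this⟩)
    exact fun x hx => (this hx).2

theorem thmF (hI : I.IsPrime) (y : Fin n → ℂ) : ∃ q0, q0 ∉ I ∧ ∃ W0, IsOpen W0 ∧ y ∈ W0 ∧ ∃ S : Set (Set (Fin n → ℂ)), S.Finite ∧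
    (∀ X ∈ S, IsNashSet W0 X ∧ GermID X y ∧ Dich I X y) ∧ VI I ∩ W0 ⊆ {x | eval x q0 = 0} ∪ ⋃₀ S := by
  obtain ⟨N⟩ := exists_ndata I hI
  obtain ⟨ρ, hρ, -, htube⟩ := exists_tube N y one_pos
  obtain ⟨r, hr, hTb⟩ := htube ρ hρ
  obtain ⟨r', hr', hr'r, S, hS, hSC, hSu⟩ := girr_decomp N.P.natDegree r hr _ (clo_univ hTb) (fun b hb hδ =>
    fiber_card N b hδ _ fun x hx => ((mem_Fb _ _ _ _).1 hx).1)
  have hex : ∀ C ∈ S, ∃ W0, IsOpen W0 ∧ y ∈ W0 ∧ ∃ X, IsNashSet W0 X ∧ X ∩ W0 = closure C ∩ W0 := fun C hC => nash_clo hr' hρ (hSC C hC).clo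
  choose! W hWo hyW X hXn hX using hex
  set W0 := (⋂ C ∈ S, W C) ∩ (Metric.ball y ρ ∩ Tz N y r') with hW0
  have hW0o : IsOpen W0 := (hS.isOpen_biInter fun C hC => hWo C hC).inter (Metric.isOpen_ball.inter (isOpen_Tz _ _ _))
  have hyW0 : y ∈ W0 := ⟨mem_iInter₂.2 fun C hC => hyW C hC, Metric.mem_ball_self hρ, mem_Tz_self hr'⟩
  have hsub : ∀ C ∈ S, W0 ⊆ W C := fun C hC x hx => mem_iInter₂.1 hx.1 C hC
  have hXC : ∀ C ∈ S, X C ∩ W0 ∩ W0 = closure C ∩ W0 := by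
    intro C hC
    ext x
    constructor
    · rintro ⟨⟨h1, h2⟩, -⟩
      exact ⟨((hX C hC).subset ⟨h1, hsub C hC h2⟩).1, h2⟩
    · rintro ⟨h1, h2⟩
      exact ⟨⟨((hX C hC).superset ⟨h1, hsub C hC h2⟩).1, h2⟩, h2⟩
  refine ⟨aeval N.ζ N.δ, N.inj _ N.δ_ne, W0, hW0o, hyW0, (fun C => X C ∩ W0) '' S, hS.image _, ?_, ?_⟩
  · rintro _ ⟨C, hC, rfl⟩
    refine ⟨LocSet.restrict good_nash (hXn C hC) hW0o (hsub C hC), ?_, dich_of hr' htube (hSC C hC) hW0o hyW0 (hXC C hC)⟩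
    intro W' hW' hyW'
    obtain ⟨V, h1, h2, h3, h4, -⟩ := germID_of hr' htube (hSC C hC) hW0o hyW0 (hXC C hC) W' hW' hyW'
    exact ⟨V, h1, h2, h3, h4⟩
  · rintro x ⟨hx, hxW⟩
    by_cases hδ : eval x (aeval N.ζ N.δ) = 0
    · exact Or.inl hδ
    · right
      rw [← eval_zm] at hδ
      have : x ∈ Rg N y ρ r ∩ Tz N y r' := ⟨⟨hx, Metric.ball_subset_closedBall hxW.2.1, Tz_mono hr'r hxW.2.2, hδ⟩, hxW.2.2⟩
      rw [hSu] at this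
      obtain ⟨C, hC, hxC⟩ := this
      exact ⟨_, ⟨C, hC, rfl⟩, ((hXC C hC).superset ⟨subset_closure hxC, hxW⟩).1⟩
end

end NashAux

namespace NashAux

variable {n : ℕ} {y : CE n}

/-- `Z` has a local decomposition at `y` into Nash sets with the identity principle -/
def DecAt (y : CE n) (Z : Set (CE n)) : Prop :=
  ∃ W0, IsOpen W0 ∧ y ∈ W0 ∧ ∃ S : Set (Set (CE n)), S.Finite ∧ (∀ X ∈ S, IsNashSet W0 X ∧ GermID X y) ∧ Z ∩ W0 = ⋃₀ S

theorem RelID.restrict {X W W' V : Set (CE n)} (h : RelID X (W ∩ W') V) (hW : IsOpen W) (hW' : IsOpen W') (hV : V ⊆ W ∩ W') : RelID (X ∩ W') W V := by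
  intro A hA M hM hne hsub
  have e : X ∩ W' ∩ V = X ∩ V := by
    ext x; constructor
    · rintro ⟨⟨a, b⟩, c⟩; exact ⟨a, c⟩
    · rintro ⟨a, c⟩; exact ⟨⟨a, (hV c).2⟩, c⟩
  rw [e] at hne hsub ⊢
  have hA' : IsAnalyticSet (W ∩ W') (A ∩ (W ∩ W')) := LocSet.restrict good_an hA (hW.inter hW') inter_subset_left
  exact (h _ hA' M hM hne fun x hx => ⟨hsub hx, hV hx.1.2⟩).trans inter_subset_left

theorem GermID.restrict {X W' : Set (CE n)} (h : GermID X y) (hW' : IsOpen W') (hy : y ∈ W') : GermID (X ∩ W') y := by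
  intro W hW hyW
  obtain ⟨V, h1, h2, h3, h4⟩ := h (W ∩ W') (hW.inter hW') ⟨hyW, hy⟩
  exact ⟨V, h1, h2, fun x hx => (h3 hx).1, h4.restrict hW hW' h3⟩

theorem DecAt.shrink {Z W : Set (CE n)} (h : DecAt y Z) (hW : IsOpen W) (hy : y ∈ W) : 
    ∃ W0, IsOpen W0 ∧ y ∈ W0 ∧ W0 ⊆ W ∧ ∃ S : Set (Set (CE n)), S.Finite ∧ (∀ X ∈ S, IsNashSet W0 X ∧ GermID X y) ∧ Z ∩ W0 = ⋃₀ S := by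
  obtain ⟨W0, hW0, hyW0, S, hS, hSX, e⟩ := h
  refine ⟨W0 ∩ W, hW0.inter hW, ⟨hyW0, hy⟩, inter_subset_right, (fun X => X ∩ (W0 ∩ W)) '' S, hS.image _, ?_, ?_⟩
  · rintro _ ⟨X, hX, rfl⟩
    exact ⟨LocSet.restrict good_nash (hSX X hX).1 (hW0.inter hW) inter_subset_left, (hSX X hX).2.restrict (hW0.inter hW) ⟨hyW0, hy⟩⟩
  · rw [← inter_assoc, e]
    ext x
    simp only [mem_inter_iff, mem_sUnion, mem_image, exists_exists_and_eq_and]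
    constructor
    · rintro ⟨⟨X, h1, h2⟩, h3⟩; exact ⟨X, h1, h2, (hSX X h1).1.1 h2, h3⟩
    · rintro ⟨X, h1, h2, -, h3⟩; exact ⟨⟨X, h1, h2⟩, h3⟩

theorem DecAt.congr {Z Z' V : Set (CE n)} (h : DecAt y Z) (hV : IsOpen V) (hy : y ∈ V) (e : Z ∩ V = Z' ∩ V) : DecAt y Z' := by
  obtain ⟨W0, h1, h2, h3, S, hS, hSX, e'⟩ := h.shrink hV hy
  refine ⟨W0, h1, h2, S, hS, hSX, ?_⟩
  rw [← e', ← inter_eq_self_of_subset_right h3, ← inter_assoc, ← inter_assoc, e]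

theorem DecAt.empty : DecAt y (∅ : Set (CE n)) := ⟨univ, isOpen_univ, mem_univ _, ∅, finite_empty, by simp, by simp⟩

theorem DecAt.single {X W : Set (CE n)} (hW : IsOpen W) (hy : y ∈ W) (h : IsNashSet W X) (h' : GermID X y) : DecAt y X :=
  ⟨W, hW, hy, {X}, finite_singleton _, by simpa using ⟨h, h'⟩, by simpa using h.1⟩

theorem DecAt.union {Z Z' : Set (CE n)} (h : DecAt y Z) (h' : DecAt y Z') : DecAt y (Z ∪ Z') := by
  obtain ⟨W, hW, hy, S0, hS0, hSX0, e0⟩ := h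
  obtain ⟨W0, h1, h2, h3, S, hS, hSX, e⟩ := h'.shrink hW hy
  obtain ⟨W1, h11, h12, h13, S1, hS1, hSX1, e1⟩ := DecAt.shrink ⟨W, hW, hy, S0, hS0, hSX0, e0⟩ h1 h2
  refine ⟨W1, h11, h12, S1 ∪ (fun X => X ∩ W1) '' S, hS1.union (hS.image _), ?_, ?_⟩
  · rintro X (hX | ⟨X, hX, rfl⟩)
    · exact hSX1 X hX
    · exact ⟨LocSet.restrict good_nash (hSX X hX).1 h11 h13, (hSX X hX).2.restrict h11 h12⟩
  · rw [union_inter_distrib_right, sUnion_union, e1]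
    congr 1
    rw [← inter_eq_self_of_subset_right h13, ← inter_assoc, e]
    ext x
    simp only [mem_inter_iff, mem_sUnion, mem_image, exists_exists_and_eq_and]
    constructor
    · rintro ⟨⟨X, h1, h2⟩, h3⟩; exact ⟨X, h1, h2, h13 h3, h3⟩
    · rintro ⟨X, h1, h2, -, h3⟩; exact ⟨⟨X, h1, h2⟩, h3⟩

theorem DecAt.sUnion {S : Set (Set (CE n))} (hS : S.Finite) (h : ∀ X ∈ S, DecAt y X) : DecAt y (⋃₀ S) := by
  induction S, hS using Set.Finite.induction_on with
  | empty => simpa using DecAt.empty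
  | @insert a S _ _ ih =>
    rw [sUnion_insert]
    exact (h a (mem_insert _ _)).union (ih fun X hX => h X (mem_insert_of_mem _ hX))

theorem VI_sup {I : Ideal (MvPolynomial (Fin n) ℂ)} {q : MvPolynomial (Fin n) ℂ} {x : CE n} (h1 : x ∈ VI I) (h2 : eval x q = 0) :
    x ∈ VI (I ⊔ Ideal.span {q}) := by
  have : I ⊔ Ideal.span {q} ≤ RingHom.ker (eval x) := sup_le (fun p hp => h1 p hp) ((Ideal.span_singleton_le_iff_mem _).2 h2)
  exact fun p hp => this hp

theorem lt_sup_span {I : Ideal (MvPolynomial (Fin n) ℂ)} {q : MvPolynomial (Fin n) ℂ} (h : q ∉ I) : I < I ⊔ Ideal.span {q} := by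
  refine lt_of_le_of_ne le_sup_left fun e => h ?_
  rw [e]
  exact Ideal.mem_sup_right (Ideal.mem_span_singleton_self q)

theorem nash_zero_poly {W Z : Set (CE n)} (hW : IsOpen W) (h : IsNashSet W (Z ∩ W)) (q : MvPolynomial (Fin n) ℂ) :
    IsNashSet W ((Z ∩ {x | eval x q = 0}) ∩ W) := by
  have : IsNashSet W _ := LocSet.inter good_nash h (LocSet.zero (P := fun U (f : CE n → ℂ) => IsNashFn U f) hW (isNashFn_poly hW q))
  convert this using 1
  ext x; simp; tauto

theorem thmG (I : Ideal (MvPolynomial (Fin n) ℂ)) : ∀ Z : Set (CE n),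
    (∃ W, IsOpen W ∧ y ∈ W ∧ IsNashSet W (Z ∩ W) ∧ Z ∩ W ⊆ VI I) → DecAt y Z := by
  induction I using WellFoundedGT.induction with
  | ind I ih =>
  rintro Z ⟨W, hW, hyW, hZ, hZI⟩
  have step : ∀ (Z' W' : Set (CE n)) (q : MvPolynomial (Fin n) ℂ), q ∉ I → IsOpen W' → y ∈ W' → IsNashSet W' (Z' ∩ W') → Z' ∩ W' ⊆ VI I →
      (∀ x ∈ Z' ∩ W', eval x q = 0) → DecAt y Z' := by
    intro Z' W' q hq hW' hy' hN hVI h0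
    exact ih _ (lt_sup_span hq) Z' ⟨W', hW', hy', hN, fun x hx => VI_sup (hVI hx) (h0 x hx)⟩
  have hzero : ∀ q, q ∉ I → DecAt y (Z ∩ {x | eval x q = 0}) := fun q hq =>
    step _ W q hq hW hyW (nash_zero_poly hW hZ q) (fun x hx => hZI ⟨hx.1.1, hx.2⟩) (fun x hx => hx.1.2)
  by_cases htop : I = ⊤
  · refine DecAt.empty.congr hW hyW ?_
    rw [empty_inter]
    symm
    rw [eq_empty_iff_forall_notMem]
    intro x hx
    have := hZI hx 1 (by rw [htop]; trivial)
    simp at this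
  by_cases hI : I.IsPrime
  · obtain ⟨q0, hq0, W0, hW0, hyW0, S, hS, hSX, hcov⟩ := thmF hI y
    obtain ⟨U, hU, hyU, hUW, s, hs, hsZ⟩ := hZ.2 y hyW
    have hX : ∀ X ∈ S, DecAt y (Z ∩ X) := by
      intro X hX
      obtain ⟨hXN, hXG, hXD⟩ := hSX X hX
      have hd : ∀ f ∈ s, ∃ V, IsOpen V ∧ y ∈ V ∧ ((∀ x ∈ X ∩ V, f x = 0) ∨ ∃ q, q ∉ I ∧ ∀ x ∈ X ∩ V, f x = 0 → eval x q = 0) :=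
        fun f hf => hXD U f hyU (hs f hf)
      choose! V hVo hyV hV using hd
      by_cases hall : ∀ f ∈ s, ∀ x ∈ X ∩ V f, f x = 0
      · have hVo' : IsOpen (⋂ f ∈ s, V f) := isOpen_biInter_finset fun f hf => hVo f hf
        refine (DecAt.single hW0 hyW0 hXN hXG).congr (hVo'.inter hU) ⟨mem_iInter₂.2 hyV, hyU⟩ ?_
        ext x
        constructor
        · rintro ⟨h1, h2, h3⟩
          have : x ∈ Z ∩ W ∩ U := hsZ.superset ⟨h3, fun f hf => hall f hf x ⟨h1, mem_iInter₂.1 h2 f hf⟩⟩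
          exact ⟨⟨this.1.1, h1⟩, h2, h3⟩
        · rintro ⟨⟨h0, h1⟩, h2⟩; exact ⟨h1, h2⟩
      · push Not at hall
        obtain ⟨f, hf, x0, hx0, hne⟩ := hall
        obtain ⟨q, hq, hqx⟩ := (hV f hf).resolve_left (fun h => hne (h x0 hx0))
        have hWo : IsOpen (U ∩ W0 ∩ V f) := (hU.inter hW0).inter (hVo f hf)
        refine step _ (U ∩ W0 ∩ V f) q hq hWo ⟨⟨hyU, hyW0⟩, hyV f hf⟩ ?_ ?_ ?_
        · have h1 := LocSet.restrict good_nash hZ hWo (fun x hx => hUW hx.1.1)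
          have h2 := LocSet.restrict good_nash hXN hWo (fun x hx => hx.1.2)
          have : IsNashSet _ _ := LocSet.inter good_nash h1 h2
          convert this using 1
          ext x
          constructor
          · rintro ⟨⟨a, b⟩, c⟩; exact ⟨⟨⟨a, hUW c.1.1⟩, c⟩, b, c⟩
          · rintro ⟨⟨⟨a, _⟩, c⟩, b, _⟩; exact ⟨⟨a, b⟩, c⟩
        · rintro x ⟨h1, h2⟩; exact hZI ⟨h1.1, hUW h2.1.1⟩
        · rintro x ⟨h1, h2⟩
          exact hqx x ⟨h1.2, h2.2⟩ ((hsZ.subset ⟨⟨h1.1, hUW h2.1.1⟩, h2.1.1⟩).2 f hf)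
    have hall := (hzero q0 hq0).union (DecAt.sUnion (hS.image fun X => Z ∩ X) (by rintro _ ⟨X, hX', rfl⟩; exact hX X hX'))
    refine hall.congr (hW.inter hW0) ⟨hyW, hyW0⟩ ?_
    ext x
    constructor
    · rintro ⟨h1 | ⟨_, ⟨X, -, rfl⟩, h1⟩, h2⟩ <;> exact ⟨h1.1, h2⟩
    · rintro ⟨h1, h2⟩
      refine ⟨?_, h2⟩
      rcases hcov ⟨hZI ⟨h1, h2.1⟩, h2.2⟩ with h3 | ⟨X, hX', h3⟩
      · exact Or.inl ⟨h1, h3⟩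
      · exact Or.inr ⟨_, ⟨X, hX', rfl⟩, h1, h3⟩
  · rw [Ideal.isPrime_iff] at hI
    push Not at hI
    obtain ⟨a, b, hab, ha, hb⟩ := hI htop
    refine ((hzero a ha).union (hzero b hb)).congr hW hyW ?_
    ext x
    constructor
    · rintro ⟨h1 | h1, h2⟩ <;> exact ⟨h1.1, h2⟩
    · rintro ⟨h1, h2⟩
      refine ⟨?_, h2⟩
      have := hZI ⟨h1, h2⟩ _ hab
      rw [map_mul, mul_eq_zero] at this
      rcases this with h | h
      · exact Or.inl ⟨h1, h⟩
      · exact Or.inr ⟨h1, h⟩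

theorem decAt_of_nash {Ω Z : Set (CE n)} (hΩ : IsOpen Ω) (hZ : IsNashSet Ω Z) (hy : y ∈ Ω) : DecAt y Z :=
  thmG ⊥ Z ⟨Ω, hΩ, hy, by rwa [inter_eq_self_of_subset_left hZ.1], fun x _ p hp => by rw [(Submodule.mem_bot _).1 hp, map_zero]⟩

end NashAux

namespace NashAux

variable {n : ℕ} {Ω Z : Set (CE n)}

theorem local_dec (hΩ : IsOpen Ω) (hZ : IsNashSet Ω Z) (y : CE n) (hy : y ∈ Ω) :
    ∃ V, ∃ S : Set (Set (CE n)), IsOpen V ∧ y ∈ V ∧ V ⊆ Ω ∧ S.Finite ∧ (∀ X ∈ S, IsNashSet V X) ∧ Z ∩ V = ⋃₀ S ∧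
      (∀ X ∈ S, ∀ A, IsAnalyticSet Ω A → ∀ M, IsOpen M → (X ∩ M).Nonempty → X ∩ M ⊆ A → X ⊆ A) ∧
      (∀ X ∈ S, ∀ M, IsOpen M → (X ∩ M).Nonempty → ∃ x ∈ X ∩ M, ∀ X' ∈ S, X' ≠ X → x ∉ X') := by
  obtain ⟨W0, hW0, hyW0, hW0O, S, hS, hSX, e⟩ := (decAt_of_nash hΩ hZ hy).shrink hΩ hy
  have hex : ∀ X ∈ S, ∃ V, IsOpen V ∧ y ∈ V ∧ V ⊆ W0 ∧ RelID X W0 V := fun X hX => (hSX X hX).2 W0 hW0 hyW0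
  choose! VX hVo hyV hVs hid using hex
  set V := (⋂ X ∈ S, VX X) ∩ W0 with hV
  have hVopen : IsOpen V := (hS.isOpen_biInter fun X hX => hVo X hX).inter hW0
  have hyV' : y ∈ V := ⟨mem_iInter₂.2 hyV, hyW0⟩
  have hVX : ∀ X ∈ S, V ⊆ VX X := fun X hX x hx => mem_iInter₂.1 hx.1 X hX
  have hid' : ∀ X ∈ S, RelID X W0 V := by
    intro X hX A hA M hM hne hsub
    have := hid X hX A hA (V ∩ M) (hVopen.inter hM)
    have e1 : X ∩ VX X ∩ (V ∩ M) = X ∩ V ∩ M := by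
      ext x; constructor
      · rintro ⟨⟨a, b⟩, c, d⟩; exact ⟨⟨a, c⟩, d⟩
      · rintro ⟨⟨a, c⟩, d⟩; exact ⟨⟨a, hVX X hX c⟩, c, d⟩
    rw [e1] at this
    exact fun x hx => this hne hsub ⟨hx.1, hVX X hX hx.2⟩
  have hZV : Z ∩ V = ⋃₀ S ∩ V := by
    rw [← e, inter_assoc, inter_eq_self_of_subset_right (show V ⊆ W0 from inter_subset_right)]
  have hfin : {T : Set (Set (CE n)) | T ⊆ S ∧ ⋃₀ T ∩ V = ⋃₀ S ∩ V}.Finite := hS.finite_subsets.subset fun T hT => hT.1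
  obtain ⟨T, hT⟩ := hfin.exists_minimal ⟨S, subset_rfl, rfl⟩
  have hTS := hT.prop.1
  have hTfin := hS.subset hTS
  refine ⟨V, (fun X => X ∩ V) '' T, hVopen, hyV', fun x hx => hW0O hx.2, hTfin.image _, ?_, ?_, ?_, ?_⟩
  · rintro _ ⟨X, hX, rfl⟩
    exact LocSet.restrict good_nash (hSX X (hTS hX)).1 hVopen inter_subset_right
  · rw [hZV, ← hT.prop.2]
    ext x
    simp only [mem_inter_iff, mem_sUnion, mem_image, exists_exists_and_eq_and]
    constructor
    · rintro ⟨⟨X, h1, h2⟩, h3⟩; exact ⟨X, h1, h2, h3⟩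
    · rintro ⟨X, h1, h2, h3⟩; exact ⟨⟨X, h1, h2⟩, h3⟩
  · rintro _ ⟨X, hX, rfl⟩ A hA M hM hne hsub
    have hA' : IsAnalyticSet W0 (A ∩ W0) := LocSet.restrict good_an hA hW0 hW0O
    exact (hid' X (hTS hX) _ hA' M hM hne fun x hx => ⟨hsub hx, hx.1.2.2⟩).trans inter_subset_left
  · rintro _ ⟨X, hX, rfl⟩ M hM hne
    by_contra! hcon
    have hA : IsNashSet W0 (⋃₀ (T \ {X})) := LocSet.sUnion good_nash hW0 (hTfin.subset diff_subset) fun Y hY => (hSX Y (hTS hY.1)).1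
    have h1 := hid' X (hTS hX) _ (nash_analytic hA) M hM hne (by
      intro x hx
      obtain ⟨_, ⟨Y, hY, rfl⟩, hYX, hxY⟩ := hcon x hx
      exact ⟨Y, ⟨hY, fun h => hYX (by rw [mem_singleton_iff.1 h])⟩, hxY.1⟩)
    have h2 : T \ {X} ∈ {T : Set (Set (CE n)) | T ⊆ S ∧ ⋃₀ T ∩ V = ⋃₀ S ∩ V} := by
      refine ⟨diff_subset.trans hTS, ?_⟩
      rw [← hT.prop.2]
      apply Subset.antisymm
      · exact inter_subset_inter_left _ (sUnion_subset_sUnion diff_subset)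
      · rintro x ⟨⟨Y, hY, hxY⟩, hxV⟩
        refine ⟨?_, hxV⟩
        by_cases hYX : Y = X
        · subst hYX; exact h1 ⟨hxY, hxV⟩
        · exact ⟨Y, ⟨hY, hYX⟩, hxY⟩
    exact (hT.le_of_le h2 diff_subset hX).2 rfl

/-- a coherent choice of local decompositions -/
structure GD (Ω Z : Set (CE n)) (V : CE n → Set (CE n)) (S : CE n → Set (Set (CE n))) : Prop where
  hO : IsOpen Ω
  hZ : Z ⊆ Ω
  opn : ∀ y ∈ Ω, IsOpen (V y)
  mem : ∀ y ∈ Ω, y ∈ V y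
  sub : ∀ y ∈ Ω, V y ⊆ Ω
  fin : ∀ y ∈ Ω, (S y).Finite
  nash : ∀ y ∈ Ω, ∀ X ∈ S y, IsNashSet (V y) X
  cov : ∀ y ∈ Ω, Z ∩ V y = ⋃₀ S y
  id : ∀ y ∈ Ω, ∀ X ∈ S y, ∀ A, IsAnalyticSet Ω A → ∀ M, IsOpen M → (X ∩ M).Nonempty → X ∩ M ⊆ A → X ⊆ A
  pure : ∀ y ∈ Ω, ∀ X ∈ S y, ∀ M, IsOpen M → (X ∩ M).Nonempty → ∃ x ∈ X ∩ M, ∀ X' ∈ S y, X' ≠ X → x ∉ X'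

theorem exists_gd (hΩ : IsOpen Ω) (hZ : IsNashSet Ω Z) : ∃ V S, GD Ω Z V S := by
  have := local_dec hΩ hZ
  choose! V S h using this
  exact ⟨V, S, ⟨hΩ, hZ.1, fun y hy => (h y hy).1, fun y hy => (h y hy).2.1, fun y hy => (h y hy).2.2.1, fun y hy => (h y hy).2.2.2.1,
    fun y hy => (h y hy).2.2.2.2.1, fun y hy => (h y hy).2.2.2.2.2.1, fun y hy => (h y hy).2.2.2.2.2.2.1, fun y hy => (h y hy).2.2.2.2.2.2.2⟩⟩

/-- pure points -/
def Pu (S : Set (Set (CE n))) (X : Set (CE n)) (x : CE n) : Prop := x ∈ X ∧ ∀ X' ∈ S, X' ≠ X → x ∉ X'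

def Full (Ω : Set (CE n)) (V : CE n → Set (CE n)) (S : CE n → Set (Set (CE n))) (M : Set (CE n)) : Prop :=
  M ⊆ Ω ∧ ∀ y ∈ Ω, ∃ T ⊆ S y, M ∩ V y = ⋃₀ T

variable {V : CE n → Set (CE n)} {S : CE n → Set (Set (CE n))}

theorem GD.subZ (h : GD Ω Z V S) {y} (hy : y ∈ Ω) {X} (hX : X ∈ S y) : X ⊆ Z := fun x hx =>
  ((h.cov y hy).superset ⟨X, hX, hx⟩).1

theorem Full.nash {M : Set (CE n)} (h : GD Ω Z V S) (hM : Full Ω V S M) : IsNashSet Ω M := by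
  refine LocSet.of_local (P := fun U (f : CE n → ℂ) => IsNashFn U f) hM.1 fun y hy => ⟨V y, h.opn y hy, h.mem y hy, h.sub y hy, ?_⟩
  obtain ⟨T, hT, e⟩ := hM.2 y hy
  rw [e]
  exact LocSet.sUnion good_nash (h.opn y hy) ((h.fin y hy).subset hT) fun X hX => h.nash y hy X (hT hX)

theorem Full.an {M : Set (CE n)} (h : GD Ω Z V S) (hM : Full Ω V S M) : IsAnalyticSet Ω M := nash_analytic (hM.nash h)

theorem Full.subZ {M : Set (CE n)} (h : GD Ω Z V S) (hM : Full Ω V S M) : M ⊆ Z := by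
  intro x hx
  obtain ⟨T, hT, e⟩ := hM.2 x (hM.1 hx)
  obtain ⟨X, hX, hxX⟩ := e.subset ⟨hx, h.mem x (hM.1 hx)⟩
  exact h.subZ (hM.1 hx) (hT hX) hxX

theorem full_empty : Full Ω V S (∅ : Set (CE n)) := ⟨empty_subset _, fun y _ => ⟨∅, empty_subset _, by simp⟩⟩

theorem Full.union {M M' : Set (CE n)} (hM : Full Ω V S M) (hM' : Full Ω V S M') : Full Ω V S (M ∪ M') := by
  refine ⟨union_subset hM.1 hM'.1, fun y hy => ?_⟩
  obtain ⟨T, hT, e⟩ := hM.2 y hy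
  obtain ⟨T', hT', e'⟩ := hM'.2 y hy
  exact ⟨T ∪ T', union_subset hT hT', by rw [union_inter_distrib_right, sUnion_union, e, e']⟩

theorem full_sUnion {F : Set (Set (CE n))} (hF : F.Finite) (h : ∀ M ∈ F, Full Ω V S M) : Full Ω V S (⋃₀ F) := by
  induction F, hF using Set.Finite.induction_on with
  | empty => simpa using full_empty
  | @insert a F _ _ ih =>
    rw [sUnion_insert]
    exact (h a (mem_insert _ _)).union (ih fun X hX => h X (mem_insert_of_mem _ hX))

theorem GD.pu_nhds (h : GD Ω Z V S) {y} (hy : y ∈ Ω) {X} (hX : X ∈ S y) {x} (hx : Pu (S y) X x) :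
    ∃ M, IsOpen M ∧ x ∈ M ∧ Z ∩ M ⊆ X := by
  have hA : IsNashSet (V y) (⋃₀ (S y \ {X})) := LocSet.sUnion good_nash (h.opn y hy) ((h.fin y hy).subset diff_subset) fun X hX => h.nash y hy X hX.1
  have hxV : x ∈ V y := (h.nash y hy X hX).1 hx.1
  have hxc : x ∉ closure (⋃₀ (S y \ {X})) := by
    intro hc
    obtain ⟨X', hX', hxX'⟩ := analytic_closed (nash_analytic hA) hxV hc
    exact hx.2 X' hX'.1 hX'.2 hxX'
  refine ⟨V y ∩ (closure (⋃₀ (S y \ {X})))ᶜ, (h.opn y hy).inter isClosed_closure.isOpen_compl, ⟨hxV, hxc⟩, ?_⟩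
  rintro x' ⟨h1, h2, h3⟩
  obtain ⟨X', hX', hx'⟩ := (h.cov y hy).subset ⟨h1, h2⟩
  by_cases e : X' = X
  · exact e ▸ hx'
  · exact absurd (subset_closure (show x' ∈ ⋃₀ (S y \ {X}) from ⟨X', ⟨hX', e⟩, hx'⟩)) h3

theorem GD.pu_dense (h : GD Ω Z V S) {y} (hy : y ∈ Ω) {X} (hX : X ∈ S y) {O : Set (CE n)} (hO : ∀ x, Pu (S y) X x → x ∈ O) : X ⊆ closure O ∩ Ω := by
  intro x hx
  refine ⟨?_, h.hZ (h.subZ hy hX hx)⟩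
  rw [mem_closure_iff]
  intro M hM hxM
  obtain ⟨x', hx', hp⟩ := h.pure y hy X hX M hM ⟨x, hx, hxM⟩
  exact ⟨x', hx'.2, hO x' ⟨hx'.1, hp⟩⟩

theorem GD.full_of (h : GD Ω Z V S) {O : Set (CE n)} (hOZ : O ⊆ Z) (hop : ∀ x ∈ O, ∃ G, IsOpen G ∧ x ∈ G ∧ Z ∩ G ⊆ O)
    (hpu : ∀ y ∈ Ω, ∀ X ∈ S y, (∃ x ∈ O, Pu (S y) X x) → ∀ x, Pu (S y) X x → x ∈ O) : Full Ω V S (closure O ∩ Ω) := by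
  refine ⟨inter_subset_right, fun y hy => ⟨{X ∈ S y | ∃ x ∈ O, Pu (S y) X x}, fun X hX => hX.1, ?_⟩⟩
  apply Subset.antisymm
  · rintro x ⟨⟨hxc, hxO⟩, hxV⟩
    have hA : IsNashSet (V y) (⋃₀ {X ∈ S y | ∃ x ∈ O, Pu (S y) X x}) :=
      LocSet.sUnion good_nash (h.opn y hy) ((h.fin y hy).subset fun X hX => hX.1) fun X hX => h.nash y hy X hX.1
    apply analytic_closed (nash_analytic hA) hxV
    rw [mem_closure_iff] at hxc ⊢
    intro M hM hxM
    obtain ⟨o, ⟨hoM, hoV⟩, hoO⟩ := hxc (M ∩ V y) (hM.inter (h.opn y hy)) ⟨hxM, hxV⟩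
    obtain ⟨X, hX, hoX⟩ := (h.cov y hy).subset ⟨hOZ hoO, hoV⟩
    obtain ⟨G, hG, hoG, hGO⟩ := hop o hoO
    obtain ⟨x', ⟨h1, h2, h3⟩, hp⟩ := h.pure y hy X hX (G ∩ M) (hG.inter hM) ⟨o, hoX, hoG, hoM⟩
    exact ⟨x', h3, X, ⟨hX, x', hGO ⟨h.subZ hy hX h1, h2⟩, h1, hp⟩, h1⟩
  · rintro x ⟨X, ⟨hX, hXO⟩, hx⟩
    exact ⟨h.pu_dense hy hX (hpu y hy X hX hXO) hx, (h.nash y hy X hX).1 hx⟩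

/-- the part of `Z` near which `Z` is contained in all sets of a family -/
def Oo (Z : Set (CE n)) (F : Set (Set (CE n))) : Set (CE n) := {x ∈ Z | ∃ G, IsOpen G ∧ x ∈ G ∧ ∀ A ∈ F, Z ∩ G ⊆ A}

theorem GD.full_Oo (h : GD Ω Z V S) {F : Set (Set (CE n))} (hF : ∀ A ∈ F, IsAnalyticSet Ω A) : Full Ω V S (closure (Oo Z F) ∩ Ω) := by
  refine h.full_of (fun x hx => hx.1) ?_ ?_
  · rintro x ⟨hx, G, hG, hxG, hGA⟩
    exact ⟨G, hG, hxG, fun x' hx' => ⟨hx'.1, G, hG, hx'.2, hGA⟩⟩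
  · rintro y hy X hX ⟨x, ⟨hx, G, hG, hxG, hGA⟩, hpx⟩ x' hpx'
    obtain ⟨M, hM, hxM, hMX⟩ := h.pu_nhds hy hX hpx'
    refine ⟨h.subZ hy hX hpx'.1, M, hM, hxM, fun A hA => hMX.trans ?_⟩
    exact h.id y hy X hX A (hF A hA) G hG ⟨x, hpx.1, hxG⟩ fun z hz => hGA A hA ⟨h.subZ hy hX hz.1, hz.2⟩

theorem Oo_sub {F : Set (Set (CE n))} {A : Set (CE n)} (hA : A ∈ F) (han : IsAnalyticSet Ω A) : closure (Oo Z F) ∩ Ω ⊆ A := by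
  rintro x ⟨hx, hxO⟩
  refine analytic_closed han hxO (closure_mono ?_ hx)
  rintro x ⟨hx, G, hG, hxG, hGA⟩
  exact hGA A hA ⟨hx, hxG⟩

theorem GD.sub_Oo (h : GD Ω Z V S) {F : Set (Set (CE n))} {y} (hy : y ∈ Ω) {X} (hX : X ∈ S y) (hXF : ∀ A ∈ F, X ⊆ A) : X ⊆ closure (Oo Z F) ∩ Ω := by
  refine h.pu_dense hy hX fun x hx => ?_
  obtain ⟨M, hM, hxM, hMX⟩ := h.pu_nhds hy hX hx
  exact ⟨h.subZ hy hX hx.1, M, hM, hxM, fun A hA => hMX.trans (hXF A hA)⟩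

theorem GD.full_co (h : GD Ω Z V S) {M : Set (CE n)} (hM : Full Ω V S M) : Full Ω V S (closure (Z \ M) ∩ Ω) := by
  refine h.full_of diff_subset ?_ ?_
  · rintro x ⟨hxZ, hxM⟩
    refine ⟨(closure M)ᶜ, isClosed_closure.isOpen_compl, fun hc => hxM (analytic_closed (hM.an h) (h.hZ hxZ) hc), ?_⟩
    exact fun x' hx' => ⟨hx'.1, fun h' => hx'.2 (subset_closure h')⟩
  · rintro y hy X hX ⟨x, ⟨hxZ, hxM⟩, hpx⟩ x' hpx'
    refine ⟨h.subZ hy hX hpx'.1, fun hx'M => ?_⟩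
    obtain ⟨T, hT, e⟩ := hM.2 y hy
    obtain ⟨X', hX', hx'X'⟩ := e.subset ⟨hx'M, (h.nash y hy X hX).1 hpx'.1⟩
    by_cases e' : X' = X
    · subst e'
      exact hxM (e.superset ⟨X', hX', hpx.1⟩).1
    · exact hpx'.2 X' (hT hX') e' hx'X'

/-- the irreducible component through a local piece -/
def Ecomp (Ω Z : Set (CE n)) (V : CE n → Set (CE n)) (S : CE n → Set (Set (CE n))) (X : Set (CE n)) : Set (CE n) :=
  closure (Oo Z {M | Full Ω V S M ∧ X ⊆ M}) ∩ Ω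

theorem GD.full_E (h : GD Ω Z V S) (X : Set (CE n)) : Full Ω V S (Ecomp Ω Z V S X) := h.full_Oo fun _ hA => hA.1.an h

theorem GD.sub_E (h : GD Ω Z V S) {y} (hy : y ∈ Ω) {X} (hX : X ∈ S y) : X ⊆ Ecomp Ω Z V S X := h.sub_Oo hy hX fun _ hA => hA.2

theorem GD.E_sub (h : GD Ω Z V S) {X M : Set (CE n)} (hM : Full Ω V S M) (hXM : X ⊆ M) : Ecomp Ω Z V S X ⊆ M :=
  Oo_sub (F := {M | Full Ω V S M ∧ X ⊆ M}) ⟨hM, hXM⟩ (hM.an h)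

theorem GD.E_irred (h : GD Ω Z V S) {y} (hy : y ∈ Ω) {X} (hX : X ∈ S y) (hne : (Ecomp Ω Z V S X).Nonempty) :
    IsIrreducibleAnalyticSet Ω (Ecomp Ω Z V S X) := by
  have key : ∀ A B : Set (CE n), IsAnalyticSet Ω A → Ecomp Ω Z V S X = A ∪ B → X ⊆ A → Ecomp Ω Z V S X = A := by
    intro A B hA e hXA
    refine Subset.antisymm ?_ (by rw [e]; exact subset_union_left)
    have h1 : Full Ω V S (closure (Oo Z {A}) ∩ Ω) := h.full_Oo (by rintro _ rfl; exact hA)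
    exact (h.E_sub h1 (h.sub_Oo hy hX (by rintro _ rfl; exact hXA))).trans (Oo_sub rfl hA)
  refine ⟨(h.full_E X).an h, hne, fun A B hA hB e => ?_⟩
  by_cases hXA : X ⊆ A
  · exact Or.inl (key A B hA e hXA)
  · right
    refine key B A hB (by rw [e, union_comm]) ?_
    obtain ⟨x, hx, hxA⟩ := not_subset.1 hXA
    refine h.id y hy X hX B hB (closure A)ᶜ isClosed_closure.isOpen_compl
      ⟨x, hx, fun hc => hxA (analytic_closed hA (h.hZ (h.subZ hy hX hx)) hc)⟩ fun x' hx' => ?_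
    have := h.sub_E hy hX hx'.1
    rw [e] at this
    exact this.resolve_left fun h' => hx'.2 (subset_closure h')

theorem irred_cases {C A B : Set (CE n)} (hC : IsIrreducibleAnalyticSet Ω C) (hA : IsAnalyticSet Ω A) (hB : IsAnalyticSet Ω B) (h : C ⊆ A ∪ B) :
    C ⊆ A ∨ C ⊆ B := by
  have := hC.2.2 (C ∩ A) (C ∩ B) (LocSet.inter good_an hC.1 hA) (LocSet.inter good_an hC.1 hB)
    (by rw [← inter_union_distrib_left, inter_eq_self_of_subset_left h])
  rcases this with h | h
  · left; rw [h]; exact inter_subset_right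
  · right; rw [h]; exact inter_subset_right

theorem irred_sUnion (hΩ : IsOpen Ω) {C : Set (CE n)} (hC : IsIrreducibleAnalyticSet Ω C) {F : Set (Set (CE n))} (hF : F.Finite) (hFA : ∀ A ∈ F, IsAnalyticSet Ω A)
    (h : C ⊆ ⋃₀ F) : ∃ A ∈ F, C ⊆ A := by
  induction F, hF using Set.Finite.induction_on with
  | empty =>
    obtain ⟨x, hx⟩ := hC.2.1
    simpa using h hx
  | @insert a F _ hf ih =>
    rw [sUnion_insert] at h
    have hFA' : ∀ A ∈ F, IsAnalyticSet Ω A := fun A hA => hFA A (mem_insert_of_mem _ hA)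
    rcases irred_cases hC (hFA a (mem_insert _ _)) (LocSet.sUnion good_an hΩ hf hFA') h with h | h
    · exact ⟨a, mem_insert _ _, h⟩
    · obtain ⟨A, hA, hCA⟩ := ih hFA' h
      exact ⟨A, mem_insert_of_mem _ hA, hCA⟩

theorem exists_comp (hΩ : IsOpen Ω) (hZ : IsNashSet Ω Z) {C : Set (CE n)} (hC : IsIrreducibleAnalyticSet Ω C) (hCZ : C ⊆ Z) :
    ∃ E, IsNashSet Ω E ∧ IsIrreducibleAnalyticSet Ω E ∧ C ⊆ E ∧ E ⊆ Z := by
  obtain ⟨V, S, h⟩ := exists_gd hΩ hZ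
  obtain ⟨y, hyC⟩ := hC.2.1
  have hy : y ∈ Ω := hC.1.1 hyC
  have hfin := (h.fin y hy).image (Ecomp Ω Z V S)
  have hU : Full Ω V S (⋃₀ (Ecomp Ω Z V S '' S y)) := full_sUnion hfin (by rintro _ ⟨X, -, rfl⟩; exact h.full_E X)
  have hco := h.full_co hU
  have hsub : C ⊆ ⋃₀ (Ecomp Ω Z V S '' S y) ∪ (closure (Z \ ⋃₀ (Ecomp Ω Z V S '' S y)) ∩ Ω) := by
    intro x hx
    by_cases hxU : x ∈ ⋃₀ (Ecomp Ω Z V S '' S y)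
    · exact Or.inl hxU
    · exact Or.inr ⟨subset_closure ⟨hCZ hx, hxU⟩, hC.1.1 hx⟩
  rcases irred_cases hC (hU.an h) (hco.an h) hsub with h1 | h1
  · obtain ⟨_, ⟨X, hX, rfl⟩, hCX⟩ := irred_sUnion hΩ hC hfin (by rintro _ ⟨X, -, rfl⟩; exact (h.full_E X).an h) h1
    exact ⟨_, (h.full_E X).nash h, h.E_irred hy hX ⟨y, hCX hyC⟩, hCX, (h.full_E X).subZ h⟩
  · exfalso
    obtain ⟨x, hxV, hx, hxn⟩ := mem_closure_iff.1 (h1 hyC).1 (V y) (h.opn y hy) (h.mem y hy)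
    obtain ⟨X, hX, hxX⟩ := (h.cov y hy).subset ⟨hx, hxV⟩
    exact hxn ⟨_, ⟨X, hX, rfl⟩, h.sub_E hy hX hxX⟩

theorem irred_id (hΩ : IsOpen Ω) (hZ : IsNashSet Ω Z) (hZi : IsIrreducibleAnalyticSet Ω Z) {A : Set (CE n)} (hA : IsAnalyticSet Ω A)
    {G : Set (CE n)} (hG : IsOpen G) (hne : (Z ∩ G).Nonempty) (hsub : Z ∩ G ⊆ A) : Z ⊆ A := by
  obtain ⟨V, S, h⟩ := exists_gd hΩ hZ
  have h1 : Full Ω V S (closure (Oo Z {A}) ∩ Ω) := h.full_Oo (by rintro _ rfl; exact hA)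
  have hco := h.full_co h1
  have hZu : Z ⊆ (closure (Oo Z {A}) ∩ Ω) ∪ (closure (Z \ (closure (Oo Z {A}) ∩ Ω)) ∩ Ω) := by
    intro x hx
    by_cases hxU : x ∈ closure (Oo Z {A}) ∩ Ω
    · exact Or.inl hxU
    · exact Or.inr ⟨subset_closure ⟨hx, hxU⟩, hZ.1 hx⟩
  rcases irred_cases hZi (h1.an h) (hco.an h) hZu with h2 | h2
  · exact h2.trans (Oo_sub rfl hA)
  · exfalso
    obtain ⟨x, hx, hxG⟩ := hne
    obtain ⟨x', hx'G, hx', hn⟩ := mem_closure_iff.1 (h2 hx).1 G hG hxG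
    exact hn ⟨subset_closure ⟨hx', G, hG, hx'G, by rintro _ rfl; exact hsub⟩, hZ.1 hx'⟩

end NashAux

namespace NashAux

theorem loc_f {n : ℕ} {I : Ideal (MvPolynomial (Fin n) ℂ)} (N : NData I) {X V U : Set (Fin n → ℂ)} {x0 : Fin n → ℂ}
    {f : CE n → ℂ} (hV : IsOpen V) (hx0 : x0 ∈ X ∩ V) (hXV : X ∩ V ⊆ VI I)
    (hmax : ∀ q, q ∉ I → ∀ V', IsOpen V' → V' ⊆ V → (X ∩ V').Nonempty → ∃ x ∈ X ∩ V', eval x q ≠ 0)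
    (hδ : eval (zm N.ζ x0) N.δ ≠ 0) (hU : IsOpen U) (hxU : x0 ∈ U) (hf : IsNashFn U f) (hfX : ∀ x ∈ X ∩ U, f x = 0) :
    ∃ M, IsOpen M ∧ x0 ∈ M ∧ ∀ x ∈ VI I ∩ M, f x = 0 := by
  rw [isNashFn_iff] at hf
  obtain ⟨V1, hV1, hxV1, hV1U, hfa⟩ := hf.2 x0 hxU
  obtain ⟨r1, hr1, σ, hσ, hσO, hσ0, hσu⟩ := sec_exists N (hXV hx0) hδ (hV1.mem_nhds hxV1)
  have hfW : AnalyticOnNhd ℂ f V1 := hf.1.mono hV1U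
  obtain ⟨ha, hal⟩ := ac_lemma Metric.isOpen_ball (convex_ball (zm N.ζ x0) r1).isPreconnected ⟨_, Metric.mem_ball_self hr1⟩ hσ.ana hσ.intOn
    hV1 (fun z hz => hσO z hz) hfW hfa
  obtain ⟨M, hMs, hMo, hx0M⟩ := mem_nhds_iff.1 (inter_mem hσu ((continuous_zm N.ζ).continuousAt.preimage_mem_nhds (Metric.ball_mem_nhds _ hr1)))
  have hsec : ∀ x ∈ VI I ∩ M, zm N.ζ x ∈ Metric.ball (zm N.ζ x0) r1 ∧ σ (zm N.ζ x) = x := fun x hx =>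
    ⟨(hMs hx.2).2, (hMs hx.2).1 hx.1⟩
  by_cases h0 : ∃ z ∈ Metric.ball (zm N.ζ x0) r1, f (σ z) ≠ 0
  · exfalso
    obtain ⟨Q, hQ0, hQ⟩ := algOn_const_ne Metric.isOpen_ball (convex_ball (zm N.ζ x0) r1).isPreconnected ha hal h0
    obtain ⟨x, ⟨hxX, ⟨hxV, hxM⟩, hxU⟩, hxq⟩ := hmax _ (N.inj _ hQ0) (V ∩ M ∩ U) ((hV.inter hMo).inter hU) (fun x hx => hx.1.1)
      ⟨x0, hx0.1, ⟨hx0.2, hx0M⟩, hxU⟩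
    obtain ⟨h1, h2⟩ := hsec x ⟨hXV ⟨hxX, hxV⟩, hxM⟩
    have h3 := hQ _ h1
    rw [h2, hfX x ⟨hxX, hxU⟩, ev2_eq_eval₂, Polynomial.eval₂_at_zero, eval_zm] at h3
    exact hxq h3
  · push Not at h0
    refine ⟨M, hMo, hx0M, fun x hx => ?_⟩
    obtain ⟨h1, h2⟩ := hsec x hx
    have := h0 _ h1
    rwa [h2] at this

theorem nash_loc_alg {n : ℕ} {Ω X : Set (CE n)} (hΩ : IsOpen Ω) (hX : IsNashSet Ω X) (hne : X.Nonempty) :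
    ∃ V, IsOpen V ∧ ∃ I : Ideal (MvPolynomial (Fin n) ℂ), (X ∩ V).Nonempty ∧ X ∩ V = VI I ∩ V := by
  obtain ⟨I, ⟨V, hV, hVΩ, hVne, hXV⟩, hI⟩ := set_has_maximal_iff_noetherian.2 (inferInstance : IsNoetherian (MvPolynomial (Fin n) ℂ) (MvPolynomial (Fin n) ℂ))
    {I : Ideal (MvPolynomial (Fin n) ℂ) | ∃ V, IsOpen V ∧ V ⊆ Ω ∧ (X ∩ V).Nonempty ∧ X ∩ V ⊆ VI I}
    ⟨⊥, Ω, hΩ, subset_rfl, hne.imp fun x hx => ⟨hx, hX.1 hx⟩, fun x _ p hp => by rw [Ideal.mem_bot.1 hp]; simp⟩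
  have hmax : ∀ q, q ∉ I → ∀ V', IsOpen V' → V' ⊆ V → (X ∩ V').Nonempty → ∃ x ∈ X ∩ V', eval x q ≠ 0 := by
    intro q hq V' hV' hVV hne'
    by_contra hc
    push Not at hc
    exact hI _ ⟨V', hV', hVV.trans hVΩ, hne', fun x hx => VI_sup (hXV ⟨hx.1, hVV hx.2⟩) (hc x hx)⟩ (lt_sup_span hq)
  have hcont : ∀ q : MvPolynomial (Fin n) ℂ, IsOpen {x : Fin n → ℂ | eval x q ≠ 0} := fun q =>
    isOpen_ne_fun (MvPolynomial.continuous_eval q) continuous_const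
  have hIp : Ideal.IsPrime I := by
    refine ⟨?_, fun {a b} hab => ?_⟩
    · rintro rfl
      obtain ⟨x, hx⟩ := hVne
      have := hXV hx 1 trivial
      simp at this
    · by_contra! hc
      obtain ⟨x, hx, hxa⟩ := hmax a hc.1 V hV subset_rfl hVne
      obtain ⟨x', hx', hb⟩ := hmax b hc.2 (V ∩ {x | eval x a ≠ 0}) (hV.inter (hcont a)) inter_subset_left ⟨x, hx.1, hx.2, hxa⟩
      have := hXV ⟨hx'.1, hx'.2.1⟩ _ hab
      rw [map_mul] at this
      exact (mul_ne_zero hx'.2.2 hb) this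
  obtain ⟨N⟩ := exists_ndata I hIp
  obtain ⟨x0, hx0, hδ⟩ := hmax _ (N.inj _ N.δ_ne) V hV subset_rfl hVne
  rw [← eval_zm] at hδ
  obtain ⟨U, hU, hxU, hUΩ, s, hs, hsX⟩ := hX.2 x0 (hX.1 hx0.1)
  have hex : ∀ f ∈ s, ∃ M, IsOpen M ∧ x0 ∈ M ∧ ∀ x ∈ VI I ∩ M, f x = 0 := fun f hf =>
    loc_f N hV hx0 hXV hmax hδ hU hxU (hs f hf) fun x hx => (hsX.subset hx).2 f hf
  choose! M hMo hxM hM using hex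
  have hMo' : IsOpen (⋂ f ∈ s, M f) := isOpen_biInter_finset hMo
  refine ⟨V ∩ U ∩ ⋂ f ∈ s, M f, (hV.inter hU).inter hMo', I, ⟨x0, hx0.1, ⟨hx0.2, hxU⟩, mem_iInter₂.2 hxM⟩, ?_⟩
  ext x
  constructor
  · rintro ⟨h1, h2⟩
    exact ⟨hXV ⟨h1, h2.1.1⟩, h2⟩
  · rintro ⟨h1, h2⟩
    exact ⟨(hsX.superset ⟨h2.1.2, fun f hf => hM f hf x ⟨h1, mem_iInter₂.1 h2.2 f hf⟩⟩).1, h2⟩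

end NashAux

/-- Theorem 2.1, Tworzewski. Every irreducible Nash subset `X` of an open
`Ω ⊆ ℂ^n` is an analytic irreducible component of `Y ∩ Ω` for some algebraic `Y ⊆ ℂ^n`;
conversely, every analytic irreducible component of `Y ∩ Ω`, for `Y` algebraic, is an
irreducible Nash subset of `Ω`. -/
theorem nash_iff_component_of_algebraic (n : ℕ) (Ω : Set (CE n)) (hΩ : IsOpen Ω) :
    (∀ X : Set (CE n), IsNashSet Ω X → IsIrreducibleAnalyticSet Ω X →
      ∃ Y : Set (CE n), IsAlgebraicSet Y ∧ IsIrreducibleComponent Ω (Y ∩ Ω) X) ∧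
    (∀ Y : Set (CE n), IsAlgebraicSet Y → ∀ C : Set (CE n),
      IsIrreducibleComponent Ω (Y ∩ Ω) C →
      IsNashSet Ω C ∧ IsIrreducibleAnalyticSet Ω C) := by
  constructor
  · intro X hX hXi
    obtain ⟨V, hV, I, hne, hXV⟩ := NashAux.nash_loc_alg hΩ hX hXi.2.1
    have hYn := NashAux.nash_alg hΩ (NashAux.VI_alg I)
    have hsub : X ⊆ NashAux.VI I ∩ Ω := NashAux.irred_id hΩ hX hXi (NashAux.nash_analytic hYn) hV hne
      (fun x hx => ⟨(hXV.subset hx).1, hX.1 hx.1⟩)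
    refine ⟨NashAux.VI I, NashAux.VI_alg I, hXi, hsub, fun C' hC' hXC hCY => ?_⟩
    obtain ⟨E, hE, hEi, hCE, hEY⟩ := NashAux.exists_comp hΩ hYn hC' hCY
    have hEX : E ⊆ X := NashAux.irred_id hΩ hE hEi hXi.1 hV (hne.imp fun x hx => ⟨hCE (hXC hx.1), hx.2⟩)
      (fun x hx => (hXV.superset ⟨(hEY hx.1).1, hx.2⟩).1)
    exact (hCE.trans hEX).antisymm hXC
  · intro Y hY C hC
    obtain ⟨E, hE, hEi, hCE, hEY⟩ := NashAux.exists_comp hΩ (NashAux.nash_alg hΩ hY) hC.1 hC.2.1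
    have := hC.2.2 E hEi hCE hEY
    exact ⟨this ▸ hE, hC.1⟩
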